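/- For every prime p, the group ℤ_2³ × ℤ_p is a CI-group with respect to color ternary relational structures if and only if p ≠ 3 and p ≠ 7. -/

import Mathlib

/-- `σ` is an isomorphism from the color ternary relational structure `(V, E)`
to `(V, E')`. -/
def IsColorTernaryIso {V : Type*} {c : ℕ} (σ : Equiv.Perm V)
    (E E' : Fin c → Set (V × V × V)) : Prop :=
  ∀ i : Fin c, ∀ u v w : V, (σ u, σ v, σ w) ∈ E' i ↔ (u, v, w) ∈ E i

/-- `(G, E)` is a Cayley color ternary relational structure of `G`, i.e. the left
regular representation of `G` consists of automorphisms. -/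
def IsCayleyColorTernary (G : Type*) [Group G] {c : ℕ}
    (E : Fin c → Set (G × G × G)) : Prop :=
  ∀ g : G, IsColorTernaryIso (Equiv.mulLeft g) E E

/-- `G` is a CI-group with respect to color ternary relational structures. -/
def IsCIGroupColorTernary (G : Type*) [Group G] : Prop :=
  ∀ (c : ℕ) (E E' : Fin c → Set (G × G × G)),
    Pairwise (Function.onFun Disjoint E) → Pairwise (Function.onFun Disjoint E') →
    IsCayleyColorTernary G E → IsCayleyColorTernary G E' →
    (∃ σ : Equiv.Perm G, IsColorTernaryIso σ E E') →
    ∃ φ : G ≃* G, IsColorTernaryIso φ.toEquiv E E'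

set_option linter.unusedSectionVars false

namespace TernaryCI

open Equiv

section

/-- A permutation group is closed under approximation on triples of points. -/
def Closed3 {Ω : Type*} (A : Subgroup (Perm Ω)) : Prop :=
  ∀ σ : Perm Ω, (∀ u v w, ∃ a ∈ A, a u = σ u ∧ a v = σ v ∧ a w = σ w) → σ ∈ A

/-- The automorphism group of a ternary relation. -/
def relAut {Ω : Type*} (R : Ω → Ω → Ω → Prop) : Subgroup (Perm Ω) where
  carrier := {σ | ∀ u v w, R (σ u) (σ v) (σ w) ↔ R u v w}
  mul_mem' {a b} ha hb u v w := by simp only [Perm.mul_apply]; rw [ha, hb]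
  one_mem' u v w := Iff.rfl
  inv_mem' {a} ha u v w := by
    rw [← ha]; simp

theorem closed3_relAut {Ω : Type*} (R : Ω → Ω → Ω → Prop) : Closed3 (relAut R) := by
  intro σ h u v w
  obtain ⟨a, ha, hu, hv, hw⟩ := h u v w
  rw [← hu, ← hv, ← hw]
  exact ha u v w

theorem Closed3.inf {Ω : Type*} {A B : Subgroup (Perm Ω)} (hA : Closed3 A) (hB : Closed3 B) :
    Closed3 (A ⊓ B) := by
  intro σ h
  refine ⟨hA σ fun u v w => ?_, hB σ fun u v w => ?_⟩ <;>
  obtain ⟨a, ha, h⟩ := h u v w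
  exacts [⟨a, ha.1, h⟩, ⟨a, ha.2, h⟩]

theorem closed3_iInf {Ω ι : Type*} {A : ι → Subgroup (Perm Ω)} (hA : ∀ i, Closed3 (A i)) :
    Closed3 (⨅ i, A i) := by
  intro σ h
  rw [Subgroup.mem_iInf]
  intro i
  refine hA i σ fun u v w => ?_
  obtain ⟨a, ha, h⟩ := h u v w
  exact ⟨a, Subgroup.mem_iInf.1 ha i, h⟩

/-- The subgroup of permutations commuting with `g`. -/
def commWith {Ω : Type*} (g : Perm Ω) : Subgroup (Perm Ω) := relAut fun a b _ => b = g a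

theorem mem_commWith {Ω : Type*} {g a : Perm Ω} : a ∈ commWith g ↔ a * g = g * a := by
  constructor
  · intro h
    ext x
    exact (h x (g x) x).2 rfl
  · intro h u v _
    have : g (a u) = a (g u) := by
      have := congrArg (fun f : Perm Ω => f u) h
      exact this.symm
    show a v = g (a u) ↔ v = g u
    rw [this, a.apply_eq_iff_eq]

/-- Splitting: an element that can be moved pointwise inside `X` and outside `X`
restricts to `X`. -/
theorem Closed3.split {Ω : Type*} {A : Subgroup (Perm Ω)} (hA : Closed3 A) {k : Perm Ω}
    (hk : k ∈ A) (X : Set Ω) (hX : ∀ ω, k ω ∈ X ↔ ω ∈ X)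
    (h1 : ∀ ω ∈ X, ∃ a ∈ A, (∀ x ∉ X, a x = x) ∧ a ω = k ω)
    (h2 : ∀ ω ∉ X, ∃ a ∈ A, (∀ x ∈ X, a x = x) ∧ a ω = k ω) :
    ∃ k' ∈ A, (∀ ω ∈ X, k' ω = k ω) ∧ ∀ ω ∉ X, k' ω = ω := by
  classical
  let k' : Perm Ω := Perm.ofSubtype (k.subtypePerm (p := (· ∈ X)) hX)
  have e1 : ∀ ω ∈ X, k' ω = k ω := fun ω hω => by
    simp only [k']
    rw [Perm.ofSubtype_apply_of_mem (p := (· ∈ X)) _ hω]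
    rfl
  have e2 : ∀ ω ∉ X, k' ω = ω := fun ω hω => by
    simp only [k']
    rw [Perm.ofSubtype_apply_of_not_mem (p := (· ∈ X)) _ hω]
  have h2' : ∀ ω ∉ X, ∃ a ∈ A, (∀ x ∈ X, a x = k x) ∧ a ω = ω := fun ω hω => by
    obtain ⟨b, hb, hbX, hbω⟩ := h2 ω hω
    refine ⟨b⁻¹ * k, mul_mem (inv_mem hb) hk, fun x hx => ?_, ?_⟩
    · rw [Perm.mul_apply, Perm.inv_eq_iff_eq, hbX _ ((hX x).2 hx)]
    · rw [Perm.mul_apply, Perm.inv_eq_iff_eq, hbω]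
  refine ⟨k', hA k' fun u v w => ?_, e1, e2⟩
  by_cases hu : u ∈ X <;> by_cases hv : v ∈ X <;> by_cases hw : w ∈ X
  · exact ⟨k, hk, (e1 u hu).symm, (e1 v hv).symm, (e1 w hw).symm⟩
  · obtain ⟨a, ha, aX, aω⟩ := h2' w hw
    exact ⟨a, ha, by rw [aX u hu, e1 u hu], by rw [aX v hv, e1 v hv], by rw [aω, e2 w hw]⟩
  · obtain ⟨a, ha, aX, aω⟩ := h2' v hv
    exact ⟨a, ha, by rw [aX u hu, e1 u hu], by rw [aω, e2 v hv], by rw [aX w hw, e1 w hw]⟩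
  · obtain ⟨a, ha, aX, aω⟩ := h1 u hu
    exact ⟨a, ha, by rw [aω, e1 u hu], by rw [aX v hv, e2 v hv], by rw [aX w hw, e2 w hw]⟩
  · obtain ⟨a, ha, aX, aω⟩ := h2' u hu
    exact ⟨a, ha, by rw [aω, e2 u hu], by rw [aX v hv, e1 v hv], by rw [aX w hw, e1 w hw]⟩
  · obtain ⟨a, ha, aX, aω⟩ := h1 v hv
    exact ⟨a, ha, by rw [aX u hu, e2 u hu], by rw [aω, e1 v hv], by rw [aX w hw, e2 w hw]⟩
  · obtain ⟨a, ha, aX, aω⟩ := h1 w hw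
    exact ⟨a, ha, by rw [aX u hu, e2 u hu], by rw [aX v hv, e2 v hv], by rw [aω, e1 w hw]⟩
  · exact ⟨1, one_mem _, by simp [e2 u hu], by simp [e2 v hv], by simp [e2 w hw]⟩

/-- The automorphism group of a color ternary relational structure. -/
def structAut {Ω : Type*} {c : ℕ} (E : Fin c → Set (Ω × Ω × Ω)) : Subgroup (Perm Ω) :=
  ⨅ i, relAut fun u v w => (u, v, w) ∈ E i

theorem mem_structAut {Ω : Type*} {c : ℕ} {E : Fin c → Set (Ω × Ω × Ω)} {σ : Perm Ω} :
    σ ∈ structAut E ↔ IsColorTernaryIso σ E E := by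
  simp only [structAut, Subgroup.mem_iInf]
  rfl

/-- Babai's criterion. -/
theorem isCIGroup_of_conj {G : Type*} [Group G]
    (H : ∀ A : Subgroup (Perm G), Closed3 A → (∀ g : G, Equiv.mulLeft g ∈ A) →
      ∀ ψ : Perm G, (∀ g : G, ψ⁻¹ * Equiv.mulLeft g * ψ ∈ A) →
      ∃ a ∈ A, ∀ g : G, ∃ g' : G, a * (ψ⁻¹ * Equiv.mulLeft g * ψ) * a⁻¹ = Equiv.mulLeft g') :
    IsCIGroupColorTernary G := by
  intro c E E' _ _ hE hE' ⟨σ, hσ⟩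
  have hconj : ∀ g : G, σ⁻¹ * Equiv.mulLeft g * σ ∈ structAut E := fun g => by
    rw [mem_structAut]
    intro i u v w
    rw [← hσ i]
    simp only [Perm.mul_apply, Perm.coe_inv, Equiv.apply_symm_apply]
    have := hE' g i (σ u) (σ v) (σ w)
    rw [this, hσ i]
  obtain ⟨a, ha, hag⟩ := H (structAut E) (closed3_iInf fun i => closed3_relAut _)
    (fun g => mem_structAut.2 (hE g)) σ hconj
  have ha' := mem_structAut.1 (inv_mem ha)
  let τ : Perm G := σ * a⁻¹
  let φ : Perm G := Equiv.mulLeft (τ 1)⁻¹ * τ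
  have hφ1 : φ 1 = 1 := by simp [φ]
  have hφE : IsColorTernaryIso φ E E' := by
    intro i u v w
    have h1 := hE' (τ 1)⁻¹ i (τ u) (τ v) (τ w)
    have h2 := hσ i (a⁻¹ u) (a⁻¹ v) (a⁻¹ w)
    exact h1.trans (h2.trans (ha' i u v w))
  have key : ∀ g : G, ∃ g' : G, ∀ x, φ (g' * x) = g * φ x := by
    intro g
    obtain ⟨g', hg'⟩ := hag (τ 1 * g * (τ 1)⁻¹)
    refine ⟨g', fun x => ?_⟩
    have := congrArg (fun f : Perm G => φ (f x)) hg'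
    simp only [Perm.mul_apply, Equiv.coe_mulLeft] at this
    rw [← this]
    simp [φ, τ, mul_assoc]
  have hmul : ∀ y x, φ (y * x) = φ y * φ x := by
    intro y x
    obtain ⟨g', hg'⟩ := key (φ y)
    have : g' = y := by
      have := hg' 1
      rw [hφ1, mul_one, mul_one] at this
      exact φ.injective this
    rw [← hg', this]
  exact ⟨MulEquiv.mk φ hmul, hφE⟩

end

section

theorem inv_app {Ω : Type*} (a : Perm Ω) (x : Ω) : a⁻¹ (a x) = x := by simp

theorem app_inv {Ω : Type*} (a : Perm Ω) (x : Ω) : a (a⁻¹ x) = x := by simp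

/-- A regular action of an additive group by permutations. -/
structure IsReg {Γ Ω : Type*} [AddCommGroup Γ] (h : Γ → Perm Ω) : Prop where
  map_add : ∀ a b, h (a + b) = h a * h b
  trans : ∀ x y, ∃ γ, h γ x = y
  free : ∀ γ x, h γ x = x → γ = 0

namespace IsReg
variable {Γ Ω : Type*} [AddCommGroup Γ] {h : Γ → Perm Ω}

theorem map_zero (hh : IsReg h) : h 0 = 1 := by
  have := hh.map_add 0 0
  rw [add_zero] at this
  exact (left_eq_mul.1 this)

theorem comm (hh : IsReg h) (a b : Γ) : h a * h b = h b * h a := by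
  rw [← hh.map_add, ← hh.map_add, add_comm]

theorem map_nsmul (hh : IsReg h) (n : ℕ) (γ : Γ) : h (n • γ) = h γ ^ n := by
  induction n with
  | zero => simp [hh.map_zero]
  | succ n ih => rw [succ_nsmul, hh.map_add, ih, pow_succ]

theorem conj (hh : IsReg h) (a : Perm Ω) : IsReg fun γ => a * h γ * a⁻¹ where
  map_add x y := by simp only [hh.map_add]; group
  trans x y := by
    obtain ⟨γ, hγ⟩ := hh.trans (a⁻¹ x) (a⁻¹ y)
    exact ⟨γ, by simp only [Perm.mul_apply]; rw [hγ, app_inv]⟩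
  free γ x hx := by
    refine hh.free γ (a⁻¹ x) ?_
    rw [Perm.eq_inv_iff_eq]
    exact hx

theorem comp (hh : IsReg h) (e : Γ ≃+ Γ) : IsReg fun γ => h (e γ) where
  map_add x y := by simp only [_root_.map_add e, hh.map_add]
  trans x y := by
    obtain ⟨γ, hγ⟩ := hh.trans x y
    exact ⟨e.symm γ, by simpa using hγ⟩
  free γ x hx := by simpa using hh.free _ _ hx

theorem mem_of_comm (hh : IsReg h) [Nonempty Ω] {z : Perm Ω}
    (hz : ∀ γ, z * h γ = h γ * z) : ∃ γ, z = h γ := by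
  obtain ⟨x⟩ := ‹Nonempty Ω›
  obtain ⟨γ, hγ⟩ := hh.trans x (z x)
  refine ⟨γ, Equiv.ext fun y => ?_⟩
  obtain ⟨δ, rfl⟩ := hh.trans x y
  rw [← Perm.mul_apply, hz, Perm.mul_apply, ← hγ, ← Perm.mul_apply, hh.comm, Perm.mul_apply]

theorem mul_self (hh : IsReg h) {γ : Γ} (hγ : γ + γ = 0) : h γ * h γ = 1 := by
  rw [← hh.map_add, hγ, hh.map_zero]

theorem injective (hh : IsReg h) [Nonempty Ω] : Function.Injective h := by
  intro a b hab
  obtain ⟨x⟩ := ‹Nonempty Ω›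
  rw [← sub_eq_zero]
  refine hh.free _ x ?_
  rw [sub_eq_add_neg, hh.map_add, hab, ← hh.map_add, add_neg_cancel, hh.map_zero]
  rfl

end IsReg

/-- A finite `p`-subgroup generated additively by a map from a `p`-torsion group. -/
theorem exists_pgroup {Γ Ω : Type*} [AddCommGroup Γ] (p : ℕ) (h : Γ → Perm Ω)
    (hadd : ∀ a b, h (a + b) = h a * h b) (htor : ∀ γ : Γ, p • γ = 0) :
    ∃ R : Subgroup (Perm Ω), IsPGroup p R ∧ ∀ σ, σ ∈ R ↔ ∃ γ, h γ = σ := by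
  have h0 : h 0 = 1 := by
    have := hadd 0 0
    rw [add_zero] at this
    exact (left_eq_mul.1 this)
  let f : Multiplicative Γ →* Perm Ω :=
    { toFun := fun γ => h γ.toAdd
      map_one' := h0
      map_mul' := fun a b => hadd _ _ }
  refine ⟨f.range, ?_, fun σ => ?_⟩
  · rintro ⟨_, ⟨γ, rfl⟩⟩
    refine ⟨1, ?_⟩
    ext1
    rw [pow_one]
    show f γ ^ p = 1
    rw [← _root_.map_pow]
    have : γ ^ p = 1 := htor γ.toAdd
    rw [this, _root_.map_one]
  · exact ⟨fun ⟨γ, hγ⟩ => ⟨γ.toAdd, hγ⟩, fun ⟨γ, hγ⟩ => ⟨Multiplicative.ofAdd γ, hγ⟩⟩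

theorem sylow_conj {Ω : Type*} [Finite Ω] (p : ℕ) [Fact p.Prime] {A R R' : Subgroup (Perm Ω)}
    (hR : IsPGroup p R) (hR' : IsPGroup p R') (hRA : R ≤ A) (hRA' : R' ≤ A) :
    ∃ a ∈ A, ∃ P ≤ A, IsPGroup p P ∧ R ≤ P ∧ ∀ r ∈ R', a * r * a⁻¹ ∈ P := by
  have t1 : IsPGroup p (R.subgroupOf A) :=
    hR.of_equiv (Subgroup.subgroupOfEquivOfLe hRA).symm
  have t2 : IsPGroup p (R'.subgroupOf A) :=
    hR'.of_equiv (Subgroup.subgroupOfEquivOfLe hRA').symm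
  obtain ⟨P, hP⟩ := t1.exists_le_sylow
  obtain ⟨P', hP'⟩ := t2.exists_le_sylow
  obtain ⟨a, ha⟩ := MulAction.exists_smul_eq A P' P
  refine ⟨a, a.2, (P : Subgroup A).map A.subtype, Subgroup.map_subtype_le _,
    P.isPGroup'.map _, ?_, ?_⟩
  · intro r hr
    exact ⟨⟨r, hRA hr⟩, hP (Subgroup.mem_subgroupOf.2 hr), rfl⟩
  · intro r hr
    refine ⟨a * ⟨r, hRA' hr⟩ * a⁻¹, ?_, rfl⟩
    rw [← ha]
    show _ ∈ (a • P' : Sylow p A)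
    have : (⟨r, hRA' hr⟩ : A) ∈ P' := hP' (Subgroup.mem_subgroupOf.2 hr)
    exact Subgroup.smul_mem_pointwise_smul _ (MulAut.conj a) (P' : Subgroup A) this

/-- A `p`-group of permutations with all orbits of length at most `p` is commutative. -/
theorem comm_of_orbit_le {Ω : Type*} [Finite Ω] (p : ℕ) [hp : Fact p.Prime]
    {R : Subgroup (Perm Ω)} (hR : IsPGroup p R)
    (horb : ∀ x, ∃ O : Set Ω, x ∈ O ∧ O.ncard ≤ p ∧ ∀ r ∈ R, ∀ y ∈ O, r y ∈ O)
    {a b : Perm Ω} (ha : a ∈ R) (hb : b ∈ R) : a * b = b * a := by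
  ext x
  obtain ⟨O, hxO, hOc, hO⟩ := horb x
  let act : R →* Perm O :=
    { toFun := fun r => (r : Perm Ω).subtypePerm (p := (· ∈ O)) fun y =>
        ⟨fun h => by simpa using hO _ (inv_mem r.2) _ h, fun h => hO _ r.2 _ h⟩
      map_one' := by ext; rfl
      map_mul' := fun _ _ => by ext; rfl }
  have hrange : IsPGroup p act.range := hR.of_surjective act.rangeRestrict
    act.rangeRestrict_surjective
  obtain ⟨k, hk⟩ := IsPGroup.iff_card.1 hrange
  have hdvd : p ^ k ∣ p.factorial := by
    rw [← hk]
    refine (Subgroup.card_subgroup_dvd_card _).trans ?_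
    classical
    rw [Nat.card_perm, Nat.card_coe_set_eq]
    exact Nat.factorial_dvd_factorial hOc
  have hk1 : k ≤ 1 := by
    by_contra hk1
    have h2 : p ^ 2 ∣ p.factorial := (pow_dvd_pow p (by omega)).trans hdvd
    rw [← Nat.mul_factorial_pred hp.out.ne_zero, pow_two] at h2
    have := (Nat.Prime.dvd_factorial hp.out).1 (Nat.dvd_of_mul_dvd_mul_left hp.out.pos h2)
    have := hp.out.pos
    omega
  have hcyc : IsCyclic act.range := by
    refine isCyclic_of_card_dvd_prime (p := p) ?_
    rw [hk]
    simpa using pow_dvd_pow p hk1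
  have hc := IsCyclic.isMulCommutative (α := act.range)
  have := hc.is_comm.comm ⟨act ⟨a, ha⟩, ⟨_, rfl⟩⟩ ⟨act ⟨b, hb⟩, ⟨_, rfl⟩⟩
  have := congrArg (fun f : act.range => (((f : Perm O) ⟨x, hxO⟩ : O) : Ω)) this
  exact this

theorem common_element {Γ Ω : Type*} [AddCommGroup Γ] [Nontrivial Γ] [Nonempty Ω] [Finite Ω]
    {p : ℕ} [Fact p.Prime] {Q : Subgroup (Perm Ω)} (hQ : IsPGroup p Q) {g h : Γ → Perm Ω}
    (hg : IsReg g) (hh : IsReg h) (gQ : ∀ γ, g γ ∈ Q) (hQ' : ∀ γ, h γ ∈ Q) :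
    ∃ γ γ', γ ≠ 0 ∧ γ' ≠ 0 ∧ g γ = h γ' := by
  have hnt : Nontrivial Q := by
    obtain ⟨γ, hγ⟩ := exists_ne (0 : Γ)
    refine ⟨⟨⟨g γ, gQ γ⟩, 1, fun h => hγ ?_⟩⟩
    refine hg.injective ?_
    rw [hg.map_zero]
    exact congrArg Subtype.val h
  have := hQ.center_nontrivial
  obtain ⟨⟨z, hz⟩, hz1⟩ := exists_ne (1 : Subgroup.center Q)
  have hcomm : ∀ q ∈ Q, (z : Perm Ω) * q = q * z := fun q hq => by
    have := (Subgroup.mem_center_iff.1 hz) ⟨q, hq⟩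
    exact (congrArg Subtype.val this).symm
  obtain ⟨γ, hγ⟩ := hg.mem_of_comm fun γ => hcomm _ (gQ γ)
  obtain ⟨γ', hγ'⟩ := hh.mem_of_comm fun γ => hcomm _ (hQ' γ)
  have hz1' : (z : Perm Ω) ≠ 1 := fun h => hz1 (by ext1; ext1; exact h)
  refine ⟨γ, γ', ?_, ?_, hγ ▸ hγ'⟩
  · rintro rfl
    exact hz1' (hγ.trans hg.map_zero)
  · rintro rfl
    exact hz1' (hγ'.trans hh.map_zero)

end

section

/-- The elementary abelian group of order eight. -/
abbrev B := ZMod 2 × ZMod 2 × ZMod 2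

/-- The additive version of the group under study. -/
abbrev Pt (p : ℕ) := B × ZMod p

theorem B.add_self (v : B) : v + v = 0 := by revert v; decide

theorem B.add_add_self (w v : B) : w + v + v = w := by rw [add_assoc, B.add_self, add_zero]

theorem B.add_eq_zero {v w : B} : v + w = 0 ↔ v = w := by revert v w; decide

variable {p : ℕ}

/-- Translation. -/
def tr (γ : Pt p) : Perm (Pt p) := Equiv.addLeft γ

@[simp] theorem tr_apply (γ ω : Pt p) : tr γ ω = (γ.1 + ω.1, γ.2 + ω.2) := rfl

theorem isReg_tr : IsReg (tr (p := p)) where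
  map_add a b := by ext1 x; show a + b + x = a + (b + x); rw [add_assoc]
  trans x y := ⟨y - x, by show y - x + x = y; simp⟩
  free γ x hx := by
    have : γ + x = x := hx
    simpa using this

/-- Blockwise shifts. -/
def sh (c : B → ZMod p) : Perm (Pt p) where
  toFun ω := (ω.1, ω.2 + c ω.1)
  invFun ω := (ω.1, ω.2 - c ω.1)
  left_inv ω := by simp
  right_inv ω := by simp

@[simp] theorem sh_apply (c : B → ZMod p) (ω : Pt p) : sh c ω = (ω.1, ω.2 + c ω.1) := rfl

theorem sh_add (c d : B → ZMod p) : sh (c + d) = sh c * sh d := by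
  ext1 ω
  simp only [sh_apply, Perm.mul_apply, Pi.add_apply]
  congr 1
  ring

theorem sh_zero : sh (0 : B → ZMod p) = 1 := by
  ext1 ω
  simp

theorem sh_neg (c : B → ZMod p) : sh (-c) = (sh c)⁻¹ := by
  rw [eq_inv_iff_mul_eq_one, ← sh_add, neg_add_cancel, sh_zero]

theorem sh_comm (c d : B → ZMod p) : sh c * sh d = sh d * sh c := by
  rw [← sh_add, ← sh_add, add_comm]

theorem sh_nsmul (n : ℕ) (c : B → ZMod p) : sh (n • c) = sh c ^ n := by
  induction n with
  | zero => simp [sh_zero]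
  | succ n ih => rw [succ_nsmul, sh_add, ih, pow_succ]

theorem sh_injective : Function.Injective (sh (p := p)) := by
  intro c d h
  ext v
  have := congrArg (fun f : Perm (Pt p) => (f (v, 0)).2) h
  simpa using this

theorem tr_snd (x : ZMod p) : tr (0, x) = sh fun _ => x := by
  ext1 ω
  simp [add_comm]

theorem tr_sh_conj (v : B) (c : B → ZMod p) :
    tr (v, 0) * sh c * (tr (v, 0))⁻¹ = sh fun w => c (w + v) := by
  rw [mul_inv_eq_iff_eq_mul]
  ext1 ω
  simp only [Perm.mul_apply, tr_apply, sh_apply, zero_add]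
  rw [add_comm v, B.add_add_self]

/-- The functions whose blockwise shift lies in `A`. -/
def shG (A : Subgroup (Perm (Pt p))) : AddSubgroup (B → ZMod p) where
  carrier := {c | sh c ∈ A}
  add_mem' ha hb := by
    rw [Set.mem_ofPred_eq, sh_add]
    exact mul_mem ha hb
  zero_mem' := by
    rw [Set.mem_ofPred_eq, sh_zero]
    exact one_mem _
  neg_mem' ha := by
    rw [Set.mem_ofPred_eq, sh_neg]
    exact inv_mem ha

theorem mem_shG {A : Subgroup (Perm (Pt p))} {c : B → ZMod p} : c ∈ shG A ↔ sh c ∈ A := Iff.rfl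

/-- Translation invariance of a group of functions. -/
def TI (C : AddSubgroup (B → ZMod p)) : Prop := ∀ c ∈ C, ∀ v : B, (fun w => c (w + v)) ∈ C

theorem ti_shG {A : Subgroup (Perm (Pt p))} (hA : ∀ v : B, tr (v, 0) ∈ A) : TI (shG A) := by
  intro c hc v
  rw [mem_shG, ← tr_sh_conj]
  exact mul_mem (mul_mem (hA v) hc) (inv_mem (hA v))

/-- A translation invariant group of functions, not all invariant under `v`,
contains the indicator function of a set which `v` interchanges with its complement. -/
theorem exists_half_two (hp : p = 2) {C : AddSubgroup (B → ZMod p)} (hC : TI C)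
    {c : B → ZMod p} (hc : c ∈ C) {v : B} (hv : ∃ w, c (w + v) ≠ c w) :
    ∃ c' ∈ C, (∀ w, c' w = 0 ∨ c' w = 1) ∧ ∀ w, c' (w + v) = 1 - c' w := by
  subst hp
  have key : ∀ S : Finset B, ∃ c ∈ C, (∃ w, c (w + v) + c w ≠ 0) ∧
      ∀ e ∈ S, ∀ w, c (w + e + v) + c (w + e) = c (w + v) + c w := by
    intro S
    induction S using Finset.induction_on with
    | empty =>
      obtain ⟨w, hw⟩ := hv
      refine ⟨c, hc, ⟨w, ?_⟩, by simp⟩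
      intro h
      exact hw ((by decide : ∀ a b : ZMod 2, a + b = 0 → a = b) _ _ h)
    | insert e S _ ih =>
      obtain ⟨c, hc, ⟨w, hw⟩, hS⟩ := ih
      by_cases h : ∀ w, c (w + e + v) + c (w + e) = c (w + v) + c w
      · refine ⟨c, hc, ⟨w, hw⟩, fun e' he' => ?_⟩
        rcases Finset.mem_insert.1 he' with rfl | he'
        exacts [h, hS e' he']
      · push Not at h
        obtain ⟨w', hw'⟩ := h
        refine ⟨(fun w => c (w + e)) + c, C.add_mem (hC c hc e) hc, ⟨w', ?_⟩, ?_⟩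
        · simp only [Pi.add_apply]
          rw [add_right_comm w' v e]
          intro h0
          apply hw'
          generalize c (w' + e + v) = a at *
          generalize c (w' + v) = b at *
          generalize c (w' + e) = d at *
          generalize c w' = f at *
          revert a b d f
          decide
        · intro e' he' w
          simp only [Pi.add_apply]
          rcases Finset.mem_insert.1 he' with rfl | he'
          · rw [add_right_comm w e' v, add_right_comm (w + v) e' e', B.add_add_self, B.add_add_self]
            ring
          · have h1 := hS e' he' w
            have h2 := hS e' he' (w + e)
            rw [add_right_comm w e e'] at h2
            rw [add_right_comm _ v e, add_right_comm _ v e]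
            linear_combination h1 + h2
  obtain ⟨c, hc, ⟨w, hw⟩, h⟩ := key Finset.univ
  have z2 : ∀ a : ZMod 2, a = 0 ∨ a = 1 := by decide
  refine ⟨c, hc, fun w => z2 _, fun w' => ?_⟩
  have h1 := h (w + w') (Finset.mem_univ _) w
  rw [show w + (w + w') = w' by rw [← add_assoc, B.add_self, zero_add]] at h1
  have h2 : c (w' + v) + c w' = 1 := by
    rw [h1]
    exact (z2 _).resolve_left hw
  rw [← h2]
  ring

theorem exists_half_odd [Fact p.Prime] (hp : p ≠ 2) {C : AddSubgroup (B → ZMod p)} (hC : TI C)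
    (h1 : (fun _ => 1) ∈ C)
    {c : B → ZMod p} (hc : c ∈ C) {v : B} (hv : ∃ w, c (w + v) ≠ c w) :
    ∃ c' ∈ C, (∀ w, c' w = 0 ∨ c' w = 1) ∧ (∀ w, c' (w + v) = 1 - c' w) ∧
      ∀ e, (∀ w, c' (w + e) = c' w) ∨ ∀ w, c' (w + e) = 1 - c' w := by
  have h2 : (2 : ZMod p) ≠ 0 := by
    have := (ZMod.natCast_eq_zero_iff 2 p).not.2 fun h =>
      hp ((Nat.prime_dvd_prime_iff_eq Fact.out Nat.prime_two).1 h)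
    simpa using this
  have key : ∀ S : Finset B, ∃ c ∈ C, (∃ w, c w ≠ 0) ∧ (∀ w, c (w + v) = -c w) ∧
      ∀ e ∈ S, (∀ w, c (w + e) = c w) ∨ ∀ w, c (w + e) = -c w := by
    intro S
    induction S using Finset.induction_on with
    | empty =>
      obtain ⟨w, hw⟩ := hv
      refine ⟨(fun w => c (w + v)) - c, C.sub_mem (hC c hc v) hc, ⟨w, ?_⟩, fun w => ?_, by simp⟩
      · simpa [sub_eq_zero] using hw
      · simp [B.add_add_self]
    | insert e S _ ih =>
      obtain ⟨c, hc, ⟨w, hw⟩, hv, hS⟩ := ih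
      have aux : ∀ ε : ZMod p, (ε = 1 ∨ ε = -1) → (∃ w, ε * c (w + e) + c w ≠ 0) →
          ∃ c ∈ C, (∃ w, c w ≠ 0) ∧ (∀ w, c (w + v) = -c w) ∧
            ∀ e' ∈ insert e S, (∀ w, c (w + e') = c w) ∨ ∀ w, c (w + e') = -c w := by
        intro ε hε hw
        refine ⟨ε • (fun w => c (w + e)) + c, C.add_mem (ZMod.smul_mem (hC c hc e) ε) hc, hw,
          fun w => ?_, fun e' he' => ?_⟩
        · simp only [Pi.add_apply, Pi.smul_apply, smul_eq_mul]
          rw [add_right_comm, hv, hv]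
          ring
        · simp only [Pi.add_apply, Pi.smul_apply, smul_eq_mul]
          rcases Finset.mem_insert.1 he' with rfl | he'
          · simp only [B.add_add_self]
            rcases hε with rfl | rfl
            · exact Or.inl fun w => by ring
            · exact Or.inr fun w => by ring
          · rcases hS e' he' with h | h
            · exact Or.inl fun w => by rw [add_right_comm, h, h]
            · exact Or.inr fun w => by rw [add_right_comm, h, h]; ring
      by_cases h : ∃ w, (1 : ZMod p) * c (w + e) + c w ≠ 0
      · exact aux 1 (Or.inl rfl) h
      · push Not at h
        refine aux (-1) (Or.inr rfl) ⟨w, fun h' => hw ?_⟩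
        have : 2 * c w = 0 := by linear_combination h w + h'
        exact (mul_eq_zero.1 this).resolve_left h2
  obtain ⟨c, hc, ⟨w, hw⟩, hv, h⟩ := key Finset.univ
  have hpm : ∀ w', c w' = c w ∨ c w' = - c w := fun w' => by
    have : w + (w + w') = w' := by rw [← add_assoc, B.add_self, zero_add]
    rcases h (w + w') (Finset.mem_univ _) with h | h
    · exact Or.inl (by rw [← h w, this])
    · exact Or.inr (by rw [← h w, this])
  refine ⟨(2⁻¹ : ZMod p) • ((fun _ => 1) - (c w)⁻¹ • c),
    ZMod.smul_mem (C.sub_mem h1 (ZMod.smul_mem hc _)) _, fun w' => ?_, fun w' => ?_, fun e => ?_⟩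
  · simp only [Pi.smul_apply, Pi.sub_apply, smul_eq_mul]
    rcases hpm w' with h | h <;> rw [h]
    · left; field_simp; ring
    · right; field_simp; ring
  · simp only [Pi.smul_apply, Pi.sub_apply, smul_eq_mul, hv]
    field_simp; ring
  · rcases h e (Finset.mem_univ _) with h | h
    · exact Or.inl fun w' => by simp only [Pi.smul_apply, Pi.sub_apply, smul_eq_mul, h]
    · exact Or.inr fun w' => by
        simp only [Pi.smul_apply, Pi.sub_apply, smul_eq_mul, h]
        field_simp; ring

theorem exists_half [Fact p.Prime] {C : AddSubgroup (B → ZMod p)} (hC : TI C)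
    (h1 : (fun _ => 1) ∈ C)
    {c : B → ZMod p} (hc : c ∈ C) {v : B} (hv : ∃ w, c (w + v) ≠ c w) :
    ∃ c' ∈ C, (∀ w, c' w = 0 ∨ c' w = 1) ∧ ∀ w, c' (w + v) = 1 - c' w := by
  by_cases hp : p = 2
  · exact exists_half_two hp hC hc hv
  · obtain ⟨c', h1, h2, h3, _⟩ := exists_half_odd hp hC h1 hc hv
    exact ⟨c', h1, h2, h3⟩

end

section

variable {p : ℕ}

theorem zmod2_eq_one (hp : p = 2) {a : ZMod p} (ha : a ≠ 0) : a = 1 := by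
  subst hp
  exact (by decide : ∀ a : ZMod 2, a ≠ 0 → a = 1) a ha

/-- The group of permutations acting affinely between blocks. -/
def AffG (p : ℕ) : Subgroup (Perm (Pt p)) :=
  relAut fun a b c => (a.1 = b.1 ∧ b.1 = c.1) ∧ a.2 + c.2 = 2 * b.2

theorem closed3_affG : Closed3 (AffG p) := closed3_relAut _

/-- The action on blocks. -/
def bl (σ : Perm (Pt p)) (v : B) : B := (σ (v, 0)).1

/-- The multiplier on a block. -/
def mu (σ : Perm (Pt p)) (v : B) : ZMod p := (σ (v, 1)).2 - (σ (v, 0)).2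

/-- The offset on a block. -/
def off (σ : Perm (Pt p)) (v : B) : ZMod p := (σ (v, 0)).2

section Affine
variable [Fact p.Prime] {σ τ : Perm (Pt p)}

theorem aff_fst (hσ : σ ∈ AffG p) (v : B) (x y : ZMod p) : (σ (v, x)).1 = (σ (v, y)).1 := by
  have := (hσ (v, x) (v, y) (v, 2 * y - x)).2 ⟨⟨rfl, rfl⟩, by simp⟩
  exact this.1.1

theorem aff_apply (hσ : σ ∈ AffG p) (v : B) (x : ZMod p) :
    σ (v, x) = (bl σ v, mu σ v * x + off σ v) := by
  refine Prod.ext (aff_fst hσ v x 0) ?_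
  have key : ∀ n : ℕ, (σ (v, (n : ZMod p))).2 = mu σ v * n + off σ v ∧
      (σ (v, ((n + 1 : ℕ) : ZMod p))).2 = mu σ v * (n + 1 : ℕ) + off σ v := by
    intro n
    induction n with
    | zero => simp [mu, off]
    | succ n ih =>
      refine ⟨ih.2, ?_⟩
      have := ((hσ (v, (n : ZMod p)) (v, ((n + 1 : ℕ) : ZMod p))
        (v, ((n + 1 + 1 : ℕ) : ZMod p))).2 ⟨⟨rfl, rfl⟩, by push_cast; ring⟩).2
      rw [ih.1, ih.2] at this
      push_cast at *
      linear_combination this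
  have := (key x.val).1
  rwa [ZMod.natCast_zmod_val] at this

theorem bl_mul (hσ : σ ∈ AffG p) (hτ : τ ∈ AffG p) (v : B) : bl (σ * τ) v = bl σ (bl τ v) := by
  show (σ (τ (v, 0))).1 = _
  rw [aff_apply hτ, aff_apply hσ]

theorem mu_mul (hσ : σ ∈ AffG p) (hτ : τ ∈ AffG p) (v : B) :
    mu (σ * τ) v = mu σ (bl τ v) * mu τ v := by
  show (σ (τ (v, 1))).2 - (σ (τ (v, 0))).2 = _
  rw [aff_apply hτ, aff_apply hσ, aff_apply hτ, aff_apply hσ]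
  ring

theorem off_mul (hσ : σ ∈ AffG p) (hτ : τ ∈ AffG p) (v : B) :
    off (σ * τ) v = mu σ (bl τ v) * off τ v + off σ (bl τ v) := by
  show (σ (τ (v, 0))).2 = _
  rw [aff_apply hτ, aff_apply hσ]
  simp

@[simp] theorem bl_one (v : B) : bl (1 : Perm (Pt p)) v = v := rfl

@[simp] theorem mu_one (v : B) : mu (1 : Perm (Pt p)) v = 1 := by simp [mu]

theorem bl_inv_bl (hσ : σ ∈ AffG p) (v : B) : bl σ⁻¹ (bl σ v) = v := by
  rw [← bl_mul (inv_mem hσ) hσ]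
  simp

theorem bl_bl_inv (hσ : σ ∈ AffG p) (v : B) : bl σ (bl σ⁻¹ v) = v := by
  rw [← bl_mul hσ (inv_mem hσ)]
  simp

theorem mu_ne_zero (hσ : σ ∈ AffG p) (v : B) : mu σ v ≠ 0 := by
  intro h
  have := mu_mul (inv_mem hσ) hσ v
  rw [h] at this
  simp at this

@[simp] theorem bl_sh (c : B → ZMod p) (v : B) : bl (sh c) v = v := rfl

@[simp] theorem mu_sh (c : B → ZMod p) (v : B) : mu (sh c) v = 1 := by simp [mu]

@[simp] theorem off_sh (c : B → ZMod p) (v : B) : off (sh c) v = c v := by simp [off]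

@[simp] theorem bl_tr (γ : Pt p) (v : B) : bl (tr γ) v = v + γ.1 := by simp [bl, add_comm]

@[simp] theorem mu_tr (γ : Pt p) (v : B) : mu (tr γ) v = 1 := by simp [mu]

@[simp] theorem off_tr (γ : Pt p) (v : B) : off (tr γ) v = γ.2 := by simp [off]

/-- A permutation conjugating a blockwise nontrivial shift to another one is affine. -/
theorem mem_affG_of_conj {t d : B → ZMod p} (ht : ∀ v, t v ≠ 0) (hd : ∀ v, d v ≠ 0)
    (h : σ * sh t = sh d * σ) : σ ∈ AffG p := by
  have hpow : ∀ (τ : Perm (Pt p)) (t d : B → ZMod p), τ * sh t = sh d * τ →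
      ∀ (n : ZMod p) (v : B) (x : ZMod p),
      τ (v, x + n * t v) = ((τ (v, x)).1, (τ (v, x)).2 + n * d (τ (v, x)).1) := by
    intro τ t d hτ n v x
    have h1 : τ * sh (n.val • t) = sh (n.val • d) * τ := by
      rw [sh_nsmul, sh_nsmul]
      exact (SemiconjBy.pow_right (show SemiconjBy τ (sh t) (sh d) from hτ) _).eq
    have := congrArg (fun f : Perm (Pt p) => f (v, x)) h1
    simp only [Perm.mul_apply, sh_apply, Pi.smul_apply] at this
    simp only [nsmul_eq_mul, ZMod.natCast_zmod_val] at this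
    exact this
  have fwd : ∀ (τ : Perm (Pt p)) (t d : B → ZMod p), (∀ v, t v ≠ 0) → τ * sh t = sh d * τ →
      ∀ a b c : Pt p, ((a.1 = b.1 ∧ b.1 = c.1) ∧ a.2 + c.2 = 2 * b.2) →
      (((τ a).1 = (τ b).1 ∧ (τ b).1 = (τ c).1) ∧ (τ a).2 + (τ c).2 = 2 * (τ b).2) := by
    rintro τ t d ht hτ ⟨v, x⟩ ⟨_, y⟩ ⟨_, z⟩ ⟨⟨rfl, rfl⟩, hx⟩
    simp only at hx ⊢
    have e1 : y = x + ((y - x) / t v) * t v := by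
      rw [div_mul_cancel₀ _ (ht v)]; ring
    have e2 : z = x + (2 * ((y - x) / t v)) * t v := by
      rw [mul_assoc, div_mul_cancel₀ _ (ht v)]
      linear_combination hx
    rw [e2, hpow τ t d hτ, e1, hpow τ t d hτ, ← e1]
    refine ⟨⟨rfl, rfl⟩, ?_⟩
    simp only
    ring
  intro a b c
  refine ⟨fun h' => ?_, fwd σ t d ht h a b c⟩
  have h2 : σ⁻¹ * sh d = sh t * σ⁻¹ := by
    rw [inv_mul_eq_iff_eq_mul, ← mul_assoc, h, mul_assoc, mul_inv_cancel, mul_one]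
  have := fwd σ⁻¹ d t hd h2 _ _ _ h'
  simpa only [inv_app] using this

/-- A permutation commuting with a blockwise nontrivial shift is affine. -/
theorem mem_affG_of_comm {t : B → ZMod p} (ht : ∀ v, t v ≠ 0) (h : σ * sh t = sh t * σ) :
    σ ∈ AffG p := mem_affG_of_conj ht ht h

theorem sh_mem_affG (c : B → ZMod p) : sh c ∈ AffG p :=
  mem_affG_of_comm (t := fun _ => 1) (fun _ => one_ne_zero) (sh_comm _ _)

theorem tr_comm_sh (v : B) {c : B → ZMod p} (hc : ∀ w, c (w + v) = c w) :
    tr (v, 0) * sh c = sh c * tr (v, 0) := by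
  rw [← mul_inv_eq_iff_eq_mul, tr_sh_conj]
  simp only [hc]

theorem tr_mem_affG (γ : Pt p) : tr γ ∈ AffG p := by
  refine mem_affG_of_comm (t := fun _ => 1) (fun _ => one_ne_zero) ?_
  rw [← tr_snd, isReg_tr.comm]

theorem aff_ext (hσ : σ ∈ AffG p) (hτ : τ ∈ AffG p) (h1 : ∀ v, bl σ v = bl τ v)
    (h2 : ∀ v, mu σ v = mu τ v) (h3 : ∀ v, off σ v = off τ v) : σ = τ := by
  ext1 ⟨v, x⟩
  rw [aff_apply hσ, aff_apply hτ, h1, h2, h3]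

theorem mu_mul_of_comm (hσ : σ ∈ AffG p) {c d : B → ZMod p} (h : σ * sh c = sh d * σ) (v : B) :
    mu σ v * c v = d (bl σ v) := by
  have h1 := off_mul hσ (sh_mem_affG c) v
  have h2 := off_mul (sh_mem_affG d) hσ v
  rw [h] at h1
  simp only [off_sh, bl_sh, mu_sh, one_mul] at h1 h2
  linear_combination h2 - h1

theorem aff_sh_conj (hσ : σ ∈ AffG p) (c : B → ZMod p) :
    σ * sh c * σ⁻¹ = sh fun w => mu σ (bl σ⁻¹ w) * c (bl σ⁻¹ w) := by
  rw [mul_inv_eq_iff_eq_mul]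
  refine aff_ext (mul_mem hσ (sh_mem_affG _)) (mul_mem (sh_mem_affG _) hσ) (fun v => ?_)
    (fun v => ?_) (fun v => ?_)
  · rw [bl_mul hσ (sh_mem_affG _), bl_mul (sh_mem_affG _) hσ]
    rfl
  · rw [mu_mul hσ (sh_mem_affG _), mu_mul (sh_mem_affG _) hσ]
    simp
  · rw [off_mul hσ (sh_mem_affG _), off_mul (sh_mem_affG _) hσ]
    simp [bl_inv_bl hσ, add_comm]

theorem aff_eq_sh (hσ : σ ∈ AffG p) (h1 : ∀ v, bl σ v = v) (h2 : ∀ v, mu σ v = 1) :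
    σ = sh (off σ) :=
  aff_ext hσ (sh_mem_affG _) (by simpa using h1) (by simpa using h2) (by simp)

theorem bl_conj (hσ : σ ∈ AffG p) (hτ : τ ∈ AffG p) (v : B) :
    bl (σ * τ * σ⁻¹) v = bl σ (bl τ (bl σ⁻¹ v)) := by
  rw [bl_mul (mul_mem hσ hτ) (inv_mem hσ), bl_mul hσ hτ]

end Affine

/-- `h` can be conjugated into the translations by an element of `A`. -/
def Good (A : Subgroup (Perm (Pt p))) (h : Pt p → Perm (Pt p)) : Prop :=
  ∃ a ∈ A, ∀ γ, ∃ γ', a * h γ * a⁻¹ = tr γ'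

/-- Conjugate of an action. -/
def cj (a : Perm (Pt p)) (h : Pt p → Perm (Pt p)) (γ : Pt p) : Perm (Pt p) := a * h γ * a⁻¹

theorem cj_cj (a b : Perm (Pt p)) (h : Pt p → Perm (Pt p)) : cj a (cj b h) = cj (a * b) h := by
  ext1 γ
  simp only [cj]
  group

theorem cj_one (h : Pt p → Perm (Pt p)) : cj 1 h = h := by
  ext1 γ
  simp [cj]

theorem Good.of_cj {A : Subgroup (Perm (Pt p))} {h : Pt p → Perm (Pt p)} {a : Perm (Pt p)}
    (ha : a ∈ A) (hg : Good A (cj a h)) : Good A h := by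
  obtain ⟨b, hb, hbγ⟩ := hg
  refine ⟨b * a, mul_mem hb ha, fun γ => ?_⟩
  obtain ⟨γ', hγ'⟩ := hbγ γ
  exact ⟨γ', by rw [← hγ']; simp only [cj]; group⟩

theorem Good.mono {A A' : Subgroup (Perm (Pt p))} {h : Pt p → Perm (Pt p)}
    (hle : A' ≤ A) (hg : Good A' h) : Good A h := by
  obtain ⟨b, hb, hbγ⟩ := hg
  exact ⟨b, hle hb, hbγ⟩

theorem Good.of_comp {A : Subgroup (Perm (Pt p))} {h : Pt p → Perm (Pt p)} (e : Pt p ≃+ Pt p)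
    (hg : Good A fun γ => h (e γ)) : Good A h := by
  obtain ⟨b, hb, hbγ⟩ := hg
  refine ⟨b, hb, fun γ => ?_⟩
  simpa using hbγ (e.symm γ)

/-- The reduced situation: both regular groups are affine. -/
structure Core (A : Subgroup (Perm (Pt p))) (h : Pt p → Perm (Pt p)) (t : B → ZMod p) : Prop where
  closed : Closed3 A
  aff : A ≤ AffG p
  trmem : ∀ γ, tr γ ∈ A
  reg : IsReg h
  hmem : ∀ γ, h γ ∈ A
  h01 : h (0, 1) = sh t
  t_ne : ∀ v, t v ≠ 0

namespace Core
variable [Fact p.Prime] {A : Subgroup (Perm (Pt p))} {h : Pt p → Perm (Pt p)} {t : B → ZMod p}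

theorem conj (H : Core A h t) {a : Perm (Pt p)} (ha : a ∈ A) :
    Core A (cj a h) (fun w => mu a (bl a⁻¹ w) * t (bl a⁻¹ w)) where
  closed := H.closed
  aff := H.aff
  trmem := H.trmem
  reg := H.reg.conj a
  hmem γ := mul_mem (mul_mem ha (H.hmem γ)) (inv_mem ha)
  h01 := by rw [cj, H.h01, aff_sh_conj (H.aff ha)]
  t_ne v := mul_ne_zero (mu_ne_zero (H.aff ha) _) (H.t_ne _)

theorem cent (H : Core A h t) {γ γ' : Pt p} (hγ : h γ' = tr γ) :
    Core (A ⊓ commWith (tr γ)) h t where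
  closed := H.closed.inf (closed3_relAut _)
  aff := inf_le_left.trans H.aff
  trmem δ := ⟨H.trmem δ, mem_commWith.2 (isReg_tr.comm _ _)⟩
  reg := H.reg
  hmem δ := ⟨H.hmem δ, mem_commWith.2 (by rw [← hγ]; exact H.reg.comm _ _)⟩
  h01 := H.h01
  t_ne := H.t_ne

theorem one_mem_shG (H : Core A h t) (x : ZMod p) : (fun _ => x) ∈ shG A := by
  rw [mem_shG, ← tr_snd]
  exact H.trmem _

theorem ti (H : Core A h t) : TI (shG A) := ti_shG fun _ => H.trmem _

theorem t_mem (H : Core A h t) : t ∈ shG A := by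
  rw [mem_shG, ← H.h01]
  exact H.hmem _

theorem h_snd (H : Core A h t) (x : ZMod p) : h (0, x) = sh (x • t) := by
  have : ((0 : B), x) = x.val • ((0 : B), (1 : ZMod p)) := by
    ext <;> simp
  rw [this, H.reg.map_nsmul, H.h01, ← sh_nsmul]
  congr 1
  ext v
  simp

theorem h_eq (H : Core A h t) (γ : Pt p) : h γ = h (γ.1, 0) * sh (γ.2 • t) := by
  rw [← H.h_snd, ← H.reg.map_add]
  simp

theorem haff (H : Core A h t) (γ : Pt p) : h γ ∈ AffG p := H.aff (H.hmem γ)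

theorem bl_add (H : Core A h t) (u u' : B) (v : B) :
    bl (h (u + u', 0)) v = bl (h (u, 0)) (bl (h (u', 0)) v) := by
  rw [← bl_mul (H.haff _) (H.haff _), ← H.reg.map_add]
  simp

theorem bl_zero (H : Core A h t) (v : B) : bl (h (0, 0)) v = v := by
  have : h (0, 0) = 1 := H.reg.map_zero
  rw [this]
  rfl

theorem bl_free (H : Core A h t) {u v : B} (huv : bl (h (u, 0)) v = v) : u = 0 := by
  have h1 := aff_apply (H.haff (u, 0)) v 0
  rw [huv] at h1
  have h2 : h (u, -(off (h (u, 0)) v / t v)) (v, 0) = (v, 0) := by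
    have : ((u, -(off (h (u, 0)) v / t v)) : Pt p) = (0, -(off (h (u, 0)) v / t v)) + (u, 0) := by
      simp
    rw [this, H.reg.map_add, Perm.mul_apply, h1, H.h_snd]
    have := H.t_ne v
    simp
    field_simp
    ring
  have := H.reg.free _ _ h2
  exact congrArg Prod.fst this

theorem bl_trans (H : Core A h t) (v w : B) : ∃ u, bl (h (u, 0)) v = w := by
  obtain ⟨γ, hγ⟩ := H.reg.trans (v, 0) (w, 0)
  refine ⟨γ.1, ?_⟩
  rw [H.h_eq] at hγ
  have := congrArg Prod.fst hγ
  rwa [Perm.mul_apply, sh_apply, aff_apply (H.haff _)] at this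

theorem comm_t (H : Core A h t) (γ : Pt p) : h γ * sh t = sh t * h γ := by
  rw [← H.h01, H.reg.comm]

theorem mu_t (H : Core A h t) (γ : Pt p) (v : B) : mu (h γ) v * t v = t (bl (h γ) v) :=
  mu_mul_of_comm (H.haff γ) (H.comm_t γ) v

theorem sq (H : Core A h t) (u : B) : h (u, 0) * h (u, 0) = 1 :=
  H.reg.mul_self (by simp [B.add_self])

theorem tr_sq (v : B) : tr ((v, 0) : Pt p) * tr (v, 0) = 1 :=
  isReg_tr.mul_self (by simp [B.add_self])

/-- The quotient of an element of `h` by a translation. -/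
theorem k_mem (H : Core A h t) (u v : B) : h (u, 0) * tr (v, 0) ∈ A :=
  mul_mem (H.hmem _) (H.trmem _)

theorem bl_k (H : Core A h t) (u v w : B) :
    bl (h (u, 0) * tr (v, 0)) w = bl (h (u, 0)) (w + v) := by
  rw [bl_mul (H.haff _) (tr_mem_affG _)]
  simp

theorem conj_tr_of_half (H : Core A h t) {u v : B} (huv : ∀ w, bl (h (u, 0)) w = w + v)
    {c : B → ZMod p} (hc : c ∈ shG A) (hcv : ∃ w, c (w + v) ≠ c w) :
    ∃ a ∈ A, (∀ w, bl a w = w) ∧ a * h (u, 0) * a⁻¹ = tr (v, 0) := by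
  obtain ⟨d, hd, hd01, hdv⟩ := exists_half H.ti (H.one_mem_shG 1) hc hcv
  set g : Perm (Pt p) := tr (v, 0) with hg
  set k := h (u, 0) * g with hk
  have hkA : k ∈ A := H.k_mem u v
  have hkb : ∀ w, bl k w = w := fun w => by rw [hk, H.bl_k, huv, B.add_add_self]
  have hk1 : ∀ ω, (k ω).1 = ω.1 := fun ω => by
    rw [← Prod.mk.eta (p := ω), aff_apply (H.aff hkA)]
    exact hkb _
  obtain ⟨k', hk'A, hX, hX'⟩ := H.closed.split hkA {ω | d ω.1 = 1} (fun ω => by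
      simp only [Set.mem_ofPred_eq, hk1]) (fun ω hω => by
      refine ⟨sh (((k ω).2 - ω.2) • d), ZMod.smul_mem hd _, fun x hx => ?_, ?_⟩
      · have : d x.1 = 0 := (hd01 x.1).resolve_right hx
        simp [this]
      · have : d ω.1 = 1 := hω
        exact Prod.ext (hk1 ω).symm (by simp [this])) (fun ω hω => by
      refine ⟨sh (((k ω).2 - ω.2) • ((fun _ => 1) - d)),
        ZMod.smul_mem ((shG A).sub_mem (H.one_mem_shG 1) hd) _, fun x hx => ?_, ?_⟩
      · have : d x.1 = 1 := hx
        simp [this]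
      · have : d ω.1 = 0 := (hd01 ω.1).resolve_right hω
        exact Prod.ext (hk1 ω).symm (by simp [this]))
  have hk'b : ∀ ω, (k' ω).1 = ω.1 := fun ω => by
    by_cases h : ω ∈ {ω : Pt p | d ω.1 = 1}
    · rw [hX _ h, hk1]
    · rw [hX' _ h]
  refine ⟨k'⁻¹, inv_mem hk'A, fun w => ?_, ?_⟩
  · have : ∀ w, bl k' w = w := fun w => hk'b (w, 0)
    conv_lhs => rw [← this w]
    exact bl_inv_bl (H.aff hk'A) w
  · rw [inv_inv, mul_assoc, inv_mul_eq_iff_eq_mul]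
    ext1 ω
    have hgω : d (g ω).1 = 1 - d ω.1 := by
      rw [← hdv, hg]
      simp [add_comm]
    have hgg : ∀ ω, g (g ω) = ω := fun ω => by
      rw [← Perm.mul_apply, hg, tr_sq]
      rfl
    have hhh : ∀ ω, h (u, 0) (h (u, 0) ω) = ω := fun ω => by
      rw [← Perm.mul_apply, H.sq]
      rfl
    simp only [Perm.mul_apply]
    rcases hd01 ω.1 with h0 | h1
    · rw [hX' ω (by simp [h0]), hX (g ω) (by simp [hgω, h0]), hk, Perm.mul_apply, hgg]
    · rw [hX ω h1, hX' (g ω) (by simp [hgω, h1]), hk, Perm.mul_apply, hhh]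

theorem eq_tr_of_odd (hp : p ≠ 2) (H : Core A h t) {u v : B}
    (huv : ∀ w, bl (h (u, 0)) w = w + v) (hinv : ∀ c ∈ shG A, ∀ w, c (w + v) = c w) :
    h (u, 0) = tr (v, 0) := by
  have h2 : (2 : ZMod p) ≠ 0 := by
    have := (ZMod.natCast_eq_zero_iff 2 p).not.2 fun h =>
      hp ((Nat.prime_dvd_prime_iff_eq Fact.out Nat.prime_two).1 h)
    simpa using this
  have hkA := H.k_mem u v
  have hkb : ∀ w, bl (h (u, 0) * tr (v, 0)) w = w := fun w => by
    rw [H.bl_k, huv, B.add_add_self]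
  have hmu : ∀ w, mu (h (u, 0) * tr (v, 0)) w = 1 := fun w => by
    have : h (u, 0) * tr (v, 0) * sh t = sh t * (h (u, 0) * tr (v, 0)) := by
      rw [mul_assoc, tr_comm_sh v (hinv t H.t_mem), ← mul_assoc, H.comm_t, mul_assoc]
    have := mu_mul_of_comm (H.aff hkA) this w
    rw [hkb] at this
    exact mul_right_cancel₀ (H.t_ne w) (this.trans (one_mul _).symm)
  have hk := aff_eq_sh (H.aff hkA) hkb hmu
  set b := off (h (u, 0) * tr (v, 0)) with hb
  have hbC : b ∈ shG A := by rw [mem_shG, ← hk]; exact hkA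
  have hh : h (u, 0) = sh b * tr (v, 0) := by
    rw [← hk, mul_assoc, tr_sq, mul_one]
  have h1 := H.sq u
  rw [hh, mul_assoc, ← mul_assoc (tr _), tr_comm_sh v (hinv b hbC), mul_assoc, tr_sq, mul_one,
    ← sh_add, ← sh_zero] at h1
  have h3 := sh_injective h1
  have : b = 0 := by
    ext w
    have := congrFun h3 w
    simp only [Pi.add_apply, Pi.zero_apply, ← two_mul] at this
    exact (mul_eq_zero.1 this).resolve_left h2
  rw [hh, this, sh_zero, one_mul]

theorem exists_tr_of_two (hp : p = 2) (H : Core A h t)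
    (full : ∀ w, ∃ u, ∀ v, bl (h (u, 0)) v = v + w) {v : B}
    (hinv : ∀ c ∈ shG A, ∀ w, c (w + v) = c w) : ∃ γ, h γ = tr (v, 0) := by
  have hf : ∀ w, ∃ u, ∃ f ∈ shG A, h (u, 0) = sh f * tr (w, 0) := fun w => by
    obtain ⟨u, hu⟩ := full w
    have hkA := H.k_mem u w
    have hk := aff_eq_sh (H.aff hkA) (fun x => by rw [H.bl_k, hu, B.add_add_self])
      (fun x => zmod2_eq_one hp (mu_ne_zero (H.aff hkA) x))
    refine ⟨u, off (h (u, 0) * tr (w, 0)), ?_, ?_⟩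
    · rw [mem_shG, ← hk]
      exact hkA
    · rw [← hk, mul_assoc, tr_sq, mul_one]
  obtain ⟨u, f, hfC, hu⟩ := hf v
  have hconst : ∀ w, f w = f 0 := fun w => by
    obtain ⟨u', f', hfC', hu'⟩ := hf w
    have h1 := H.reg.comm (u, 0) (u', 0)
    rw [hu, hu'] at h1
    have h2 := congrArg (fun σ : Perm (Pt p) => (σ (w, 0)).2) h1
    simp only [Perm.mul_apply, tr_apply, sh_apply, zero_add] at h2
    have e1 := hinv f' hfC' 0
    have e2 := hinv f hfC 0
    have e3 := hinv f hfC w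
    rw [zero_add] at e1 e2
    rw [B.add_self, add_zero, add_comm v w, ← add_assoc, B.add_self, zero_add, e1, e2, e3] at h2
    linear_combination -h2
  refine ⟨(u, f 0), ?_⟩
  have ht : t = fun _ => 1 := funext fun w => zmod2_eq_one hp (H.t_ne w)
  have hff : f = fun _ => f 0 := funext hconst
  rw [H.h_eq, hu]
  simp only
  rw [mul_assoc, tr_comm_sh v (by simp [ht]), ← mul_assoc, ← sh_add]
  have : f + f 0 • t = 0 := by
    subst hp
    ext w
    simp only [ht, Pi.add_apply, Pi.smul_apply, smul_eq_mul, mul_one, Pi.zero_apply, hconst w]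
    exact CharTwo.add_self_eq_zero _
  rw [this, sh_zero, one_mul]

/-- If `h` and the translations contain elements with the same action `v` on blocks, these can
be identified. -/
theorem exists_conj_tr (H : Core A h t)
    (full : p ≠ 2 ∨ ∀ w, ∃ u, ∀ v, bl (h (u, 0)) v = v + w) {u v : B}
    (huv : ∀ w, bl (h (u, 0)) w = w + v) :
    ∃ a ∈ A, (∀ w, bl a w = w) ∧ ∃ γ, cj a h γ = tr (v, 0) := by
  by_cases hc : ∃ c ∈ shG A, ∃ w, c (w + v) ≠ c w
  · obtain ⟨c, hc, hcv⟩ := hc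
    obtain ⟨a, ha, hab, h1⟩ := H.conj_tr_of_half huv hc hcv
    exact ⟨a, ha, hab, _, h1⟩
  · push Not at hc
    refine ⟨1, one_mem _, fun w => rfl, ?_⟩
    rw [cj_one]
    by_cases hp : p = 2
    · exact H.exists_tr_of_two hp (full.resolve_left (by simp [hp])) hc
    · exact ⟨_, H.eq_tr_of_odd hp huv hc⟩

theorem bl_cj (H : Core A h t) {a : Perm (Pt p)} (ha : a ∈ A) (γ : Pt p) (v : B) :
    bl (cj a h γ) v = bl a (bl (h γ) (bl a⁻¹ v)) := bl_conj (H.aff ha) (H.haff _) v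

theorem bl_cj_of_trivial (H : Core A h t) {a : Perm (Pt p)} (ha : a ∈ A)
    (hab : ∀ w, bl a w = w) (γ : Pt p) (v : B) : bl (cj a h γ) v = bl (h γ) v := by
  have : bl a⁻¹ v = v := by
    conv_lhs => rw [← hab v]
    exact bl_inv_bl (H.aff ha) v
  rw [H.bl_cj ha, this, hab]

theorem good_of_full (H : Core A h t)
    (full : ∀ w, ∃ u, ∀ v, bl (h (u, 0)) v = v + w) : Good A h := by
  have key : ∀ S : Finset B, ∃ A' ≤ A, ∃ a ∈ A, ∃ t', Core A' (cj a h) t' ∧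
      (∀ w, ∃ u, ∀ v, bl (cj a h (u, 0)) v = v + w) ∧
      ∀ s ∈ S, (∃ γ, cj a h γ = tr (s, 0)) ∧ A' ≤ commWith (tr (s, 0)) := by
    intro S
    induction S using Finset.induction_on with
    | empty => exact ⟨A, le_rfl, 1, one_mem _, t, by rwa [cj_one], by rwa [cj_one], by simp⟩
    | insert v S _ ih =>
      obtain ⟨A', hA', a, ha, t', H', full', hS⟩ := ih
      obtain ⟨u, hu⟩ := full' v
      obtain ⟨b, hb, hbb, γ, hγ⟩ := H'.exists_conj_tr (Or.inr full') hu
      refine ⟨A' ⊓ commWith (tr (v, 0)), inf_le_left.trans hA', b * a, mul_mem (hA' hb) ha,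
        _, by rw [← cj_cj]; exact (H'.conj hb).cent hγ, fun w => ?_, fun s hs => ?_⟩
      · rw [← cj_cj]
        obtain ⟨u, hu⟩ := full' w
        exact ⟨u, fun x => by rw [H'.bl_cj_of_trivial hb hbb, hu]⟩
      · rw [← cj_cj]
        rcases Finset.mem_insert.1 hs with rfl | hs
        · exact ⟨⟨γ, hγ⟩, inf_le_right⟩
        · obtain ⟨⟨δ, hδ⟩, hle⟩ := hS s hs
          refine ⟨⟨δ, ?_⟩, inf_le_left.trans hle⟩
          rw [cj, hδ, mem_commWith.1 (hle hb), mul_inv_cancel_right]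
  obtain ⟨A', hA', a, ha, t', H', full', hS⟩ := key Finset.univ
  refine Good.of_cj ha (Good.mono hA' ?_)
  have hconst : ∀ v, t' v = t' 0 := fun v => by
    obtain ⟨γ, hγ⟩ := (hS v (Finset.mem_univ _)).1
    have := H'.mu_t γ 0
    rw [hγ, mu_tr, bl_tr] at this
    simpa using this.symm
  have hall : ∀ δ, ∃ γ, cj a h γ = tr δ := fun δ => by
    obtain ⟨γ, hγ⟩ := (hS δ.1 (Finset.mem_univ _)).1
    refine ⟨γ + (0, δ.2 / t' 0), ?_⟩
    rw [H'.reg.map_add, hγ, H'.h_snd]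
    have : (δ.2 / t' 0) • t' = fun _ => δ.2 := by
      ext v
      rw [Pi.smul_apply, smul_eq_mul, hconst v, div_mul_cancel₀ _ (H'.t_ne 0)]
    rw [this, ← tr_snd, ← isReg_tr.map_add]
    simp
  refine ⟨1, one_mem _, fun γ => ?_⟩
  rw [one_mul, inv_one, mul_one]
  refine isReg_tr.mem_of_comm fun δ => ?_
  obtain ⟨γ', hγ'⟩ := hall δ
  rw [← hγ', H'.reg.comm]

end Core

end

section

variable {p : ℕ}

set_option synthInstance.maxHeartbeats 400000 in
set_option synthInstance.maxSize 2000 in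
theorem B.span_cases_aux : ∀ s u w v : B, s ≠ 0 → u ≠ 0 → u ≠ s →
    (w ≠ 0 ∧ w ≠ s ∧ w ≠ u ∧ w ≠ s + u) →
    ((v = 0 ∨ v = s ∨ v = u ∨ v = s + u) ∨
      (v = w ∨ v = w + s ∨ v = w + u ∨ v = w + (s + u))) := by
  decide +kernel

theorem B.span_cases {s u : B} (hs : s ≠ 0) (hu : u ≠ 0) (hus : u ≠ s) {w : B}
    (h : w ≠ 0 ∧ w ≠ s ∧ w ≠ u ∧ w ≠ s + u) (v : B) :
    (v = 0 ∨ v = s ∨ v = u ∨ v = s + u) ∨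
      (v = w ∨ v = w + s ∨ v = w + u ∨ v = w + (s + u)) :=
  B.span_cases_aux s u w v hs hu hus h

set_option synthInstance.maxHeartbeats 400000 in
set_option synthInstance.maxSize 2000 in
theorem B.exists_dual : ∀ s u₀ u₁ : B, s ≠ 0 → u₀ ≠ 0 → u₀ ≠ s → (u₁ ≠ 0 ∧ u₁ ≠ s ∧ u₁ ≠ u₀ ∧
    u₁ ≠ s + u₀) → ∃ a : B, a.1 * s.1 + a.2.1 * s.2.1 + a.2.2 * s.2.2 = 0 ∧
      a.1 * u₀.1 + a.2.1 * u₀.2.1 + a.2.2 * u₀.2.2 = 0 ∧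
      a.1 * u₁.1 + a.2.1 * u₁.2.1 + a.2.2 * u₁.2.2 = 1 := by
  decide +kernel

/-- A basis `s, u₀, u₁` together with the coordinate functions for `u₀` and `u₁`. -/
structure Coord (s u₀ u₁ : B) (c₀ c₁ : B → ZMod 2) : Prop where
  s_ne : s ≠ 0
  add₀ : ∀ v w, c₀ (v + w) = c₀ v + c₀ w
  add₁ : ∀ v w, c₁ (v + w) = c₁ v + c₁ w
  s₀ : c₀ s = 0
  s₁ : c₁ s = 0
  u₀₀ : c₀ u₀ = 1
  u₀₁ : c₁ u₀ = 0
  u₁₀ : c₀ u₁ = 0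
  u₁₁ : c₁ u₁ = 1
  ker : ∀ v, c₀ v = 0 → c₁ v = 0 → v = 0 ∨ v = s

theorem zmod2_cases : ∀ a : ZMod 2, a = 0 ∨ a = 1 := by decide

theorem exists_coord {s u₀ u₁ : B} (hs : s ≠ 0) (h₀ : u₀ ≠ 0) (h₀s : u₀ ≠ s)
    (h₁ : u₁ ≠ 0 ∧ u₁ ≠ s ∧ u₁ ≠ u₀ ∧ u₁ ≠ s + u₀) :
    ∃ c₀ c₁, Coord s u₀ u₁ c₀ c₁ := by
  obtain ⟨a, a1, a2, a3⟩ := B.exists_dual s u₀ u₁ hs h₀ h₀s h₁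
  obtain ⟨b, b1, b2, b3⟩ := B.exists_dual s u₁ u₀ hs h₁.1 h₁.2.1 ⟨h₀, h₀s, fun h => h₁.2.2.1 h.symm,
    fun h => h₁.2.2.2 (by rw [h, ← add_assoc, B.add_self, zero_add])⟩
  let f : B → B → ZMod 2 := fun a w => a.1 * w.1 + a.2.1 * w.2.1 + a.2.2 * w.2.2
  have add : ∀ a v w : B, f a (v + w) = f a v + f a w := fun a v w => by
    show a.1 * (v.1 + w.1) + a.2.1 * (v.2.1 + w.2.1) + a.2.2 * (v.2.2 + w.2.2) = _
    simp only [f]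
    ring
  change f a s = 0 at a1
  change f a u₀ = 0 at a2
  change f a u₁ = 1 at a3
  change f b s = 0 at b1
  change f b u₁ = 0 at b2
  change f b u₀ = 1 at b3
  refine ⟨f b, f a, ⟨hs, add b, add a, b1, a1, b3, a2, b2, a3, fun v hb ha => ?_⟩⟩
  rcases B.span_cases hs h₀ h₀s h₁ v with (h | h | h | h) | (h | h | h | h)
  · exact Or.inl h
  · exact Or.inr h
  all_goals
    exfalso
    rw [h] at ha hb
    simp only [add, a1, a2, a3, b1, b2, b3] at ha hb
    revert ha hb
    decide

namespace Core
variable [Fact p.Prime] {A : Subgroup (Perm (Pt p))} {h : Pt p → Perm (Pt p)} {t : B → ZMod p}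

theorem isReg_add : IsReg fun v : B => Equiv.addRight v where
  map_add a b := by
    ext1 x
    show x + (a + b) = x + b + a
    abel
  trans x y := ⟨y - x, by show x + (y - x) = y; abel⟩
  free v x hx := by
    have : x + v = x := hx
    simpa using this

/-- The action of affine permutations on blocks. -/
def blHom (p : ℕ) [Fact p.Prime] : AffG p →* Perm B where
  toFun σ :=
    { toFun := bl (σ : Perm (Pt p))
      invFun := bl (σ : Perm (Pt p))⁻¹
      left_inv := bl_inv_bl σ.2
      right_inv := bl_bl_inv σ.2 }
  map_one' := rfl
  map_mul' σ τ := by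
    ext1 v
    exact bl_mul σ.2 τ.2 v

theorem isReg_bl (H : Core A h t) : IsReg fun u : B => blHom p ⟨h (u, 0), H.haff _⟩ where
  map_add a b := by
    ext1 v
    exact H.bl_add a b v
  trans x y := H.bl_trans x y
  free u v hv := H.bl_free hv

theorem exists_common_block (H : Core A h t) :
    ∃ a ∈ A, ∃ s, s ≠ 0 ∧ ∃ u, ∀ w, bl (cj a h (u, 0)) w = w + s := by
  have : Fact (Nat.Prime 2) := ⟨Nat.prime_two⟩
  obtain ⟨R, hR, hR'⟩ := exists_pgroup 2 (fun v : B => tr ((v, 0) : Pt p))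
    (fun a b => by rw [← isReg_tr.map_add]; simp) (fun v => by rw [two_nsmul, B.add_self])
  obtain ⟨S, hS, hS'⟩ := exists_pgroup 2 (fun v : B => h (v, 0))
    (fun a b => by rw [← H.reg.map_add]; simp) (fun v => by rw [two_nsmul, B.add_self])
  obtain ⟨a, ha, P, hPA, hP, hRP, hSP⟩ := sylow_conj 2 (A := A) hR hS
    (fun σ hσ => by obtain ⟨γ, rfl⟩ := (hR' σ).1 hσ; exact H.trmem _)
    (fun σ hσ => by obtain ⟨γ, rfl⟩ := (hS' σ).1 hσ; exact H.hmem _)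
  have H' := H.conj ha
  have hQ : IsPGroup 2 ((P.subgroupOf (AffG p)).map (blHom p)) :=
    (hP.of_equiv (Subgroup.subgroupOfEquivOfLe (hPA.trans H.aff)).symm).map _
  obtain ⟨s, u, hs, -, hsu⟩ := common_element hQ isReg_add H'.isReg_bl
    (fun v => ⟨⟨tr (v, 0), tr_mem_affG _⟩,
      Subgroup.mem_subgroupOf.2 (hRP ((hR' _).2 ⟨v, rfl⟩)), by
        ext1 w; exact bl_tr (p := p) (v, 0) w⟩)
    (fun v => ⟨⟨cj a h (v, 0), H'.haff _⟩,
      Subgroup.mem_subgroupOf.2 (hSP _ ((hS' _).2 ⟨v, rfl⟩)), rfl⟩)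
  refine ⟨a, ha, s, hs, u, fun w => ?_⟩
  exact (congrArg (fun f : Perm B => f w) hsu).symm

theorem full_of_two (H : Core A h t) {s u : B} (hs : s ≠ 0) (hu : u ≠ 0) (hus : u ≠ s) {qs q : B}
    (hqs : ∀ w, bl (h (qs, 0)) w = w + s) (hq : ∀ w, bl (h (q, 0)) w = w + u) :
    ∀ w, ∃ q, ∀ v, bl (h (q, 0)) v = v + w := by
  have hsub : ∀ v, (v = 0 ∨ v = s ∨ v = u ∨ v = s + u) →
      ∃ q, ∀ w, bl (h (q, 0)) w = w + v := by
    rintro v (rfl | rfl | rfl | rfl)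
    · exact ⟨0, fun w => by rw [H.bl_zero, add_zero]⟩
    · exact ⟨qs, hqs⟩
    · exact ⟨q, hq⟩
    · exact ⟨qs + q, fun w => by rw [H.bl_add, hq, hqs]; abel⟩
  intro w
  by_cases hw : w = 0 ∨ w = s ∨ w = u ∨ w = s + u
  · exact hsub w hw
  push Not at hw
  obtain ⟨r, hr⟩ := H.bl_trans 0 w
  have h1 : ∀ v, (v = 0 ∨ v = s ∨ v = u ∨ v = s + u) → bl (h (r, 0)) v = v + w := by
    intro v hv
    obtain ⟨q, hq⟩ := hsub v hv
    have := hq 0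
    rw [zero_add] at this
    conv_lhs => rw [← this]
    rw [← H.bl_add, add_comm, H.bl_add, hr, hq, add_comm]
  refine ⟨r, fun v => ?_⟩
  have h2 : ∀ v', (v' = 0 ∨ v' = s ∨ v' = u ∨ v' = s + u) → v = w + v' →
      bl (h (r, 0)) v = v + w := by
    rintro v' hv' rfl
    rw [add_comm w v', ← h1 v' hv', ← H.bl_add, B.add_self, H.bl_zero, h1 v' hv', B.add_add_self]
  rcases B.span_cases hs hu hus hw v with hv | hv | hv | hv | hv
  · exact h1 v hv
  · exact h2 0 (by simp) (by simpa using hv)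
  · exact h2 s (by simp) hv
  · exact h2 u (by simp) hv
  · exact h2 _ (by simp) hv

theorem good_of_two (H : Core A h t) {s u : B} (hs : s ≠ 0) (hu : u ≠ 0) (hus : u ≠ s) {qs q : B}
    (hqs : ∀ w, bl (h (qs, 0)) w = w + s) (hq : ∀ w, bl (h (q, 0)) w = w + u) : Good A h :=
  H.good_of_full (H.full_of_two hs hu hus hqs hq)

end Core

/-- The block action of `h` is the twisted one with respect to a basis. -/
structure Tw (h : Pt p → Perm (Pt p)) (s u₀ u₁ : B) (c₀ c₁ : B → ZMod 2) (qs q₀ q₁ : B) : Prop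
    extends Coord s u₀ u₁ c₀ c₁ where
  hs : ∀ w, bl (h (qs, 0)) w = w + s
  h₀ : ∀ w, bl (h (q₀, 0)) w = w + u₀ + c₁ w • s
  h₁ : ∀ w, bl (h (q₁, 0)) w = w + u₁ + c₀ w • s

theorem Coord.swap {s u₀ u₁ : B} {c₀ c₁ : B → ZMod 2} (C : Coord s u₀ u₁ c₀ c₁) :
    Coord s u₁ u₀ c₁ c₀ :=
  ⟨C.s_ne, C.add₁, C.add₀, C.s₁, C.s₀, C.u₁₁, C.u₁₀, C.u₀₁, C.u₀₀, fun v h1 h2 => C.ker v h2 h1⟩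

theorem Coord.zero₀ {s u₀ u₁ : B} {c₀ c₁ : B → ZMod 2} (C : Coord s u₀ u₁ c₀ c₁) : c₀ 0 = 0 := by
  have := C.add₀ 0 0
  rw [add_zero] at this
  exact left_eq_add.1 this

theorem Coord.zero₁ {s u₀ u₁ : B} {c₀ c₁ : B → ZMod 2} (C : Coord s u₀ u₁ c₀ c₁) : c₁ 0 = 0 :=
  C.swap.zero₀

theorem Coord.eq_of {s u₀ u₁ : B} {c₀ c₁ : B → ZMod 2} (C : Coord s u₀ u₁ c₀ c₁) {v w : B}
    (h₀ : c₀ v = c₀ w) (h₁ : c₁ v = c₁ w) : v = w ∨ v = w + s := by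
  have hd : ∀ a b : ZMod 2, a = b → a + b = 0 := by decide
  rcases C.ker (v + w) (by rw [C.add₀]; exact hd _ _ h₀) (by rw [C.add₁]; exact hd _ _ h₁) with h | h
  · exact Or.inl (B.add_eq_zero.1 h)
  · right
    rw [add_comm, ← h, B.add_add_self]

namespace Core
variable [Fact p.Prime] {A : Subgroup (Perm (Pt p))} {h : Pt p → Perm (Pt p)} {t : B → ZMod p}

theorem block_dichotomy (H : Core A h t) {s u₀ u₁ : B} {c₀ c₁ : B → ZMod 2}
    (C : Coord s u₀ u₁ c₀ c₁) {qs : B} (hqs : ∀ w, bl (h (qs, 0)) w = w + s) :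
    ∃ q, (∀ w, bl (h (q, 0)) w = w + u₀) ∨ (∀ w, bl (h (q, 0)) w = w + u₀ + c₁ w • s) := by
  obtain ⟨q, hq⟩ := H.bl_trans 0 u₀
  refine ⟨q, ?_⟩
  set η := bl (h (q, 0)) with hη
  have hinv : ∀ w, η (η w) = w := fun w => by
    rw [hη, ← H.bl_add, B.add_self, H.bl_zero]
  have hcom : ∀ w, η (w + s) = η w + s := fun w => by
    rw [← hqs, hη, ← H.bl_add, add_comm, H.bl_add, hqs]
  have hu0 : u₀ ≠ 0 := fun h0 => by
    have := C.u₀₀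
    rw [h0, C.zero₀] at this
    exact absurd this (by decide)
  have hu0s : u₀ ≠ s := fun h0 => by
    have := C.u₀₀
    rw [h0, C.s₀] at this
    exact absurd this (by decide)
  have hfix : ∀ w, η w ≠ w := fun w hw => by
    have := H.bl_free hw
    rw [hη, this, H.bl_zero] at hq
    exact hu0 hq.symm
  have hfixs : ∀ w, η w ≠ w + s := fun w hw => by
    have : bl (h (qs + q, 0)) w = w := by rw [H.bl_add, ← hη, hw, hqs, B.add_add_self]
    have := H.bl_free this
    rw [B.add_eq_zero] at this
    rw [hη, ← this, hqs, zero_add] at hq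
    exact hu0s hq.symm
  have hcom' : ∀ (a : ZMod 2) w, η (w + a • s) = η w + a • s := fun a w => by
    rcases zmod2_cases a with rfl | rfl
    · simp
    · simp [hcom]
  have hw1 : ∀ w, c₁ w = 0 → η w = w + u₀ := by
    intro w hw
    rcases zmod2_cases (c₀ w) with h0 | h0
    · rcases C.ker w h0 hw with rfl | rfl
      · rw [hq, zero_add]
      · have := hcom 0
        rwa [hq, zero_add, add_comm u₀] at this
    · rcases C.eq_of (v := w) (w := u₀) (by rw [h0, C.u₀₀]) (by rw [hw, C.u₀₁]) with rfl | rfl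
      · rw [B.add_self, ← hq, hinv]
      · rw [hcom, add_right_comm, B.add_self]
        conv_lhs => rw [← hq, hinv]
  have hc1 : ∀ w, c₁ w = 1 → c₁ (η w) = 1 := by
    intro w hw
    rcases zmod2_cases (c₁ (η w)) with h1 | h1
    · have := hw1 _ h1
      rw [hinv] at this
      rw [this, C.add₁, h1, C.u₀₁] at hw
      exact absurd hw (by decide)
    · exact h1
  have hw2 : ∀ w, c₁ w = 1 → η w = w + u₀ ∨ η w = w + u₀ + s := by
    intro w hw
    have h0 : c₀ (η w) ≠ c₀ w := fun h0 => by
      rcases C.eq_of h0 ((hc1 w hw).trans hw.symm) with h | h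
      exacts [hfix w h, hfixs w h]
    refine C.eq_of ?_ ?_
    · rw [C.add₀, C.u₀₀]
      exact (by decide : ∀ a b : ZMod 2, a ≠ b → a = b + 1) _ _ h0
    · rw [C.add₁, C.u₀₁, hw, hc1 w hw, add_zero]
  have hall : ∀ w, c₁ w = 1 → ∀ e : ZMod 2, η u₁ = u₁ + u₀ + e • s → η w = w + u₀ + e • s := by
    intro w hw e he
    rcases zmod2_cases (c₀ w) with h0 | h0
    · rcases C.eq_of (v := w) (w := u₁) (by rw [h0, C.u₁₀]) (by rw [hw, C.u₁₁]) with rfl | rfl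
      · exact he
      · rw [hcom, he]
        abel
    · have h2 : η (u₁ + u₀) = u₁ + e • s := by
        have := congrArg η he
        rw [hinv, hcom'] at this
        conv_rhs => rw [this]
        rw [add_assoc, ← add_smul, CharTwo.add_self_eq_zero e, zero_smul, add_zero]
      rcases C.eq_of (v := w) (w := u₁ + u₀) (by rw [h0, C.add₀, C.u₁₀, C.u₀₀, zero_add])
        (by rw [hw, C.add₁, C.u₁₁, C.u₀₁, add_zero]) with rfl | rfl
      · rw [h2, B.add_add_self]
      · rw [hcom, h2, add_right_comm (u₁ + u₀), B.add_add_self]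
        abel
  rcases hw2 u₁ C.u₁₁ with h2 | h2
  · left
    intro w
    rcases zmod2_cases (c₁ w) with h1 | h1
    · exact hw1 w h1
    · have := hall w h1 0 (by rw [h2]; simp)
      simpa using this
  · right
    intro w
    rcases zmod2_cases (c₁ w) with h1 | h1
    · rw [h1, hw1 w h1]; simp
    · rw [h1]
      exact hall w h1 1 (by rw [h2]; simp)

/-- Either `h` can be conjugated to the translations, or it is twisted with respect to every
basis starting with `s`. -/
theorem good_or_twisted (H : Core A h t) {s : B} {qs : B}
    (hqs : ∀ w, bl (h (qs, 0)) w = w + s) {u₀ u₁ : B} {c₀ c₁ : B → ZMod 2}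
    (C : Coord s u₀ u₁ c₀ c₁) : Good A h ∨ ∃ q₀ q₁, Tw h s u₀ u₁ c₀ c₁ qs q₀ q₁ := by
  have aux : ∀ {u₀ u₁ : B} {c₀ c₁ : B → ZMod 2}, Coord s u₀ u₁ c₀ c₁ → 
      Good A h ∨ ∃ q, ∀ w, bl (h (q, 0)) w = w + u₀ + c₁ w • s := by
    intro u₀ u₁ c₀ c₁ C
    obtain ⟨q, hq | hq⟩ := H.block_dichotomy C hqs
    · left
      refine H.good_of_two C.s_ne (fun h0 => ?_) (fun h0 => ?_) hqs hq
      · have := C.u₀₀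
        rw [h0, C.zero₀] at this
        exact absurd this (by decide)
      · have := C.u₀₀
        rw [h0, C.s₀] at this
        exact absurd this (by decide)
    · exact Or.inr ⟨q, hq⟩
  rcases aux C with h | ⟨q₀, h₀⟩
  · exact Or.inl h
  rcases aux C.swap with h | ⟨q₁, h₁⟩
  · exact Or.inl h
  exact Or.inr ⟨q₀, q₁, { C with hs := hqs, h₀ := h₀, h₁ := h₁ }⟩

/-- A suitable element of `A` removes the twist. -/
theorem good_of_untwist (H : Core A h t) {s u₀ u₁ : B} {c₀ c₁ : B → ZMod 2} {qs q₀ q₁ : B}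
    (T : Tw h s u₀ u₁ c₀ c₁ qs q₀ q₁) {D : Perm (Pt p)} (hD : D ∈ A) {φ : B → ZMod 2}
    (hDφ : ∀ w, bl D w = w + φ w • s) (hφs : ∀ w, φ (w + s) = φ w) {e : ZMod 2}
    (hφ : ∀ w, φ (w + u₀) + φ w + c₁ w = e) : Good A h := by
  have h2 : ∀ (a : ZMod 2), a + a = 0 := CharTwo.add_self_eq_zero
  have hφs' : ∀ w (a : ZMod 2), φ (w + a • s) = φ w := fun w a => by
    rcases zmod2_cases a with rfl | rfl
    · simp
    · simp [hφs]
  have hinv : ∀ w, bl D⁻¹ w = w + φ w • s := fun w => by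
    have : bl D (w + φ w • s) = w := by
      rw [hDφ, hφs', add_assoc, ← add_smul, h2, zero_smul, add_zero]
    conv_lhs => rw [← this]
    rw [bl_inv_bl (H.aff hD)]
  have hc1 : ∀ w (a : ZMod 2), c₁ (w + a • s) = c₁ w := fun w a => by
    rcases zmod2_cases a with rfl | rfl
    · simp
    · simp [T.add₁, T.s₁]
  refine Good.of_cj hD ((H.conj hD).good_of_two (s := s) (u := u₀ + e • s) (qs := qs) (q := q₀)
    T.s_ne (fun h0 => ?_) (fun h0 => ?_) (fun w => ?_) (fun w => ?_))
  · have h1 := congrArg c₀ h0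
    rcases zmod2_cases e with rfl | rfl <;>
    simp [T.add₀, T.s₀, T.u₀₀, T.zero₀] at h1
  · have h1 := congrArg c₀ h0
    rcases zmod2_cases e with rfl | rfl <;>
    simp [T.add₀, T.s₀, T.u₀₀] at h1
  · rw [H.bl_cj hD, hinv, T.hs, hDφ, hφs, hφs']
    rw [add_right_comm, add_assoc w, ← add_smul, h2, zero_smul, add_zero]
  · rw [H.bl_cj hD, hinv, T.h₀, hDφ, hc1, hφs', add_right_comm w, hφs', ← hφ w]
    module

end Core

end

section

variable {p : ℕ}

/-- A product of two indicator functions of shifts in `A` is again a shift in `A`. -/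
theorem mul_mem_shG [Fact p.Prime] {A : Subgroup (Perm (Pt p))} (hA : Closed3 A)
    (h1 : (fun _ => 1) ∈ shG A) {c d : B → ZMod p} (hc : c ∈ shG A) (hd : d ∈ shG A)
    (hc01 : ∀ w, c w = 0 ∨ c w = 1) : c * d ∈ shG A := by
  obtain ⟨k, hk, hX, hX'⟩ := hA.split (k := sh d) hd {ω | c ω.1 = 1} (fun ω => Iff.rfl)
    (fun ω hω => by
      refine ⟨sh (d ω.1 • c), ZMod.smul_mem hc _, fun x hx => ?_, ?_⟩
      · have : c x.1 = 0 := (hc01 x.1).resolve_right hx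
        simp [this]
      · have : c ω.1 = 1 := hω
        simp [this])
    (fun ω hω => by
      refine ⟨sh (d ω.1 • ((fun _ => 1) - c)), ZMod.smul_mem ((shG A).sub_mem h1 hc) _,
        fun x hx => ?_, ?_⟩
      · have : c x.1 = 1 := hx
        simp [this]
      · have : c ω.1 = 0 := (hc01 ω.1).resolve_right hω
        simp [this])
  have : sh (c * d) = k := by
    ext1 ω
    rcases hc01 ω.1 with h | h
    · rw [hX' ω (by simp [h])]
      simp [h]
    · rw [hX ω h]
      simp [h]
  rw [mem_shG, this]
  exact hk

/-- The indicator function of the group of common periods. -/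
theorem indicator_mem_shG [Fact p.Prime] {A : Subgroup (Perm (Pt p))} (hA : Closed3 A)
    (h1 : (fun _ => 1) ∈ shG A) (hT : TI (shG A)) (S : Set B)
    (hS : ∀ w, w ∈ S ↔ ∀ c ∈ shG A, ∀ v, c (v + w) = c v) (y : B) :
    ∃ d ∈ shG A, (∀ w, w + y ∈ S → d w = 1) ∧ ∀ w, w + y ∉ S → d w = 0 := by
  suffices h : ∃ d ∈ shG A, (∀ w, w ∈ S → d w = 1) ∧ ∀ w, w ∉ S → d w = 0 by
    obtain ⟨d, hd, h⟩ := h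
    exact ⟨_, hT d hd y, fun w => h.1 _, fun w => h.2 _⟩
  have key : ∀ E : Finset B, ∃ d ∈ shG A, (∀ w, d w = 0 ∨ d w = 1) ∧ d 0 = 1 ∧
      ∀ w ∈ E, w ∉ S → d w = 0 := by
    intro E
    induction E using Finset.induction_on with
    | empty => exact ⟨_, h1, by simp, rfl, by simp⟩
    | insert w E _ ih =>
      obtain ⟨d, hd, hd01, hd0, hE⟩ := ih
      by_cases hw : w ∈ S
      · refine ⟨d, hd, hd01, hd0, fun w' hw' hS' => ?_⟩
        rcases Finset.mem_insert.1 hw' with rfl | hw'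
        exacts [absurd hw hS', hE w' hw' hS']
      · obtain ⟨c, hc, hcv⟩ : ∃ c ∈ shG A, ∃ v, c (v + w) ≠ c v := by
          by_contra hcon
          push Not at hcon
          exact hw ((hS w).2 hcon)
        obtain ⟨e, he, he01, hew⟩ : ∃ e ∈ shG A, (∀ w, e w = 0 ∨ e w = 1) ∧ e 0 = 1 ∧ e w = 0 := by
          obtain ⟨e, he, he01, hew⟩ := exists_half hT h1 hc hcv
          have := hew 0
          rw [zero_add] at this
          rcases he01 0 with h0 | h0
          · refine ⟨(fun _ => 1) - e, (shG A).sub_mem h1 he, fun v => ?_, ?_, ?_⟩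
            · rcases he01 v with h | h <;> simp [h]
            · simp [h0]
            · simp [this, h0]
          · exact ⟨e, he, he01, h0, by simp [this, h0]⟩
        refine ⟨e * d, mul_mem_shG hA h1 he hd he01, fun v => ?_, ?_, fun w' hw' hS' => ?_⟩
        · rcases he01 v with h | h <;> simp [h, hd01 v]
        · simp [hew.1, hd0]
        · rcases Finset.mem_insert.1 hw' with rfl | hw'
          · simp [hew.2]
          · simp [hE w' hw' hS']
  obtain ⟨d, hd, -, hd0, h⟩ := key Finset.univ
  refine ⟨d, hd, fun w hw => ?_, fun w => h w (Finset.mem_univ _)⟩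
  have := (hS w).1 hw d hd 0
  rwa [zero_add, hd0] at this

namespace Core
variable [Fact p.Prime] {A : Subgroup (Perm (Pt p))} {h : Pt p → Perm (Pt p)} {t : B → ZMod p}

theorem good_of_restrict (H : Core A h t) {s u₀ u₁ : B} {c₀ c₁ : B → ZMod 2} {qs q₀ q₁ : B}
    (T : Tw h s u₀ u₁ c₀ c₁ qs q₀ q₁) {k : Perm (Pt p)} (hk : k ∈ A)
    (hkb : ∀ w, bl k w = w + c₀ w • s) (d : ZMod 2)
    (h1 : ∀ ω : Pt p, c₁ ω.1 = d → ∃ a ∈ A, (∀ x : Pt p, c₁ x.1 ≠ d → a x = x) ∧ a ω = k ω)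
    (h2 : ∀ ω : Pt p, c₁ ω.1 ≠ d → ∃ a ∈ A, (∀ x : Pt p, c₁ x.1 = d → a x = x) ∧ a ω = k ω) :
    Good A h := by
  have hk1 : ∀ ω : Pt p, (k ω).1 = ω.1 + c₀ ω.1 • s := fun ω => by
    rw [← Prod.mk.eta (p := ω), aff_apply (H.aff hk)]
    exact hkb _
  have hcs : ∀ w (a : ZMod 2), c₁ (w + a • s) = c₁ w := fun w a => by
    rcases zmod2_cases a with rfl | rfl
    · simp
    · simp [T.add₁, T.s₁]
  obtain ⟨D, hD, hX, hX'⟩ := H.closed.split hk {ω | c₁ ω.1 = d}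
    (fun ω => by simp only [Set.mem_ofPred_eq, hk1, hcs]) (fun ω hω => h1 ω hω)
    (fun ω hω => h2 ω hω)
  have hz : ∀ a b : ZMod 2, a = b → a + b + 1 = 1 := by decide
  have hz' : ∀ a b : ZMod 2, a ≠ b → a + b + 1 = 0 := by decide
  refine H.good_of_untwist T hD (φ := fun w => c₀ w * (c₁ w + d + 1)) (e := d + 1) (fun w => ?_)
    (fun w => ?_) (fun w => ?_)
  · by_cases hw : c₁ w = d
    · rw [hz _ _ hw, mul_one, ← hkb]
      exact congrArg Prod.fst (hX (w, 0) hw)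
    · rw [hz' _ _ hw, mul_zero, zero_smul, add_zero]
      exact congrArg Prod.fst (hX' (w, 0) hw)
  · simp only [T.add₀, T.add₁, T.s₀, T.s₁, add_zero]
  · simp only [T.add₀, T.add₁, T.u₀₀, T.u₀₁, add_zero]
    exact (by decide : ∀ a b d : ZMod 2, (a + 1) * (b + d + 1) + a * (b + d + 1) + b = d + 1) _ _ _

theorem smul_add_self (a : ZMod 2) (s : B) : a • s + a • s = 0 := by
  rw [← add_smul, CharTwo.add_self_eq_zero, zero_smul]

section CommS
variable {s : B}

theorem mu_add_s (H : Core A h t) (hA : A ≤ commWith (tr (s, 0))) {k : Perm (Pt p)} (hk : k ∈ A)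
    (w : B) : mu k (w + s) = mu k w := by
  have h1 := mem_commWith.1 (hA hk)
  have h2 := congrArg (fun f => mu f w) h1
  simpa [mu_mul (H.aff hk) (tr_mem_affG _), mu_mul (tr_mem_affG _) (H.aff hk)] using h2

theorem off_add_s (H : Core A h t) (hA : A ≤ commWith (tr (s, 0))) {k : Perm (Pt p)} (hk : k ∈ A)
    (w : B) : off k (w + s) = off k w := by
  have h1 := mem_commWith.1 (hA hk)
  have h2 := congrArg (fun f => off f w) h1
  simpa [off_mul (H.aff hk) (tr_mem_affG _), off_mul (tr_mem_affG _) (H.aff hk)] using h2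

theorem shG_add_s (hA : A ≤ commWith (tr (s, 0))) {c : B → ZMod p}
    (hc : c ∈ shG A) (w : B) : c (w + s) = c w := by
  have h1 := mem_commWith.1 (hA hc)
  have h2 := congrArg (fun f => (f (w, 0)).2) h1
  simpa [add_comm] using h2

theorem add_smul_s {f : B → ZMod p} (hf : ∀ w, f (w + s) = f w) (w : B) (a : ZMod 2) :
    f (w + a • s) = f w := by
  rcases zmod2_cases a with rfl | rfl
  · simp
  · simp [hf]

/-- For odd `p`, a power of a multiplier-free element with blockwise action by `s` is pure. -/
theorem exists_pure (hp : p ≠ 2) (H : Core A h t) (hA : A ≤ commWith (tr (s, 0)))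
    {k : Perm (Pt p)} (hk : k ∈ A) {φ : B → ZMod 2} (hφ : ∀ w, φ (w + s) = φ w)
    (hkb : ∀ w, bl k w = w + φ w • s) (hkm : ∀ w, mu k w = 1) :
    ∃ k' ∈ A, ∀ ω : Pt p, k' ω = (ω.1 + φ ω.1 • s, ω.2) := by
  have hφ' : ∀ w (a : ZMod 2), φ (w + a • s) = φ w := fun w a => by
    rcases zmod2_cases a with rfl | rfl
    · simp
    · simp [hφ]
  have hpow : ∀ n : ℕ, ∀ v x, (k ^ n) (v, x) = (v + ((n : ZMod 2) * φ v) • s, x + n * off k v) := by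
    intro n
    induction n with
    | zero => simp
    | succ n ih =>
      intro v x
      rw [pow_succ', Perm.mul_apply, ih, aff_apply (H.aff hk), hkb, hkm, hφ',
        add_smul_s (H.off_add_s hA hk)]
      ext1
      · push_cast
        rw [add_assoc, ← add_smul]
        congr 2
        ring
      · push_cast
        ring
  refine ⟨k ^ p, pow_mem hk _, fun ω => ?_⟩
  rw [← Prod.mk.eta (p := ω), hpow]
  have : (p : ZMod 2) = 1 := by
    have := (Nat.Prime.eq_two_or_odd (Fact.out : p.Prime)).resolve_left hp
    rw [← Nat.odd_iff] at this
    exact ZMod.natCast_eq_one_iff_odd.2 this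
  simp [this]

theorem bl_k_tw (H : Core A h t) {u q : B} {φ : B → ZMod 2}
    (hq : ∀ w, bl (h (q, 0)) w = w + u + φ w • s) (hφ : ∀ w, φ (w + u) = φ w) (w : B) :
    bl (h (q, 0) * tr (u, 0)) w = w + φ w • s := by
  rw [H.bl_k, hq, B.add_add_self, hφ]

theorem mu_k (H : Core A h t) (hA : A ≤ commWith (tr (s, 0))) {u q : B} {φ : B → ZMod 2}
    (hq : ∀ w, bl (h (q, 0)) w = w + u + φ w • s) (w : B) :
    mu (h (q, 0) * tr (u, 0)) w = t w / t (w + u) := by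
  rw [eq_div_iff (H.t_ne _), mu_mul (H.haff _) (tr_mem_affG _)]
  simp only [bl_tr, mu_tr, mul_one]
  rw [H.mu_t, hq, add_smul_s (shG_add_s hA H.t_mem), B.add_add_self]

theorem good_of_local (H : Core A h t) {s u₀ u₁ : B} {c₀ c₁ : B → ZMod 2} {qs q₀ q₁ : B}
    (T : Tw h s u₀ u₁ c₀ c₁ qs q₀ q₁) {S R : Perm (Pt p)} (hS : S ∈ A) (hR : R ∈ A)
    (hS0 : ∀ ω : Pt p, c₁ ω.1 = 0 → S ω = ω) (hS1 : ∀ ω : Pt p, c₁ ω.1 = 1 → (S ω).1 = ω.1 + s)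
    (hR1 : ∀ ω : Pt p, c₁ ω.1 = 1 → R ω = ω) (hR0 : ∀ ω : Pt p, c₁ ω.1 = 0 → (R ω).1 = ω.1 + s)
    {d : B → ZMod p} (hd : d ∈ shG A) (hd0 : ∀ w, c₁ w = 0 → d w = 0)
    (hd1 : ∀ w, c₁ w = 1 → d w = 1) : Good A h := by
  have z : ∀ a : ZMod 2, a ≠ 1 → a = 0 := by decide
  have hd' : (fun _ => 1) - d ∈ shG A := (shG A).sub_mem (H.one_mem_shG _) hd
  have hb1 := H.bl_k_tw T.h₁ fun w => by rw [T.add₀, T.u₁₀, add_zero]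
  have hc1 : ∀ w, c₁ (w + s) = c₁ w := fun w => by rw [T.add₁, T.s₁, add_zero]
  have hkA := H.k_mem q₁ u₁
  generalize h (q₁, 0) * tr (u₁, 0) = k at hkA hb1
  have hk1 : ∀ ω : Pt p, (k ω).1 = ω.1 + c₀ ω.1 • s := fun ω => by
    rw [← Prod.mk.eta (p := ω), aff_apply (H.aff hkA)]
    exact hb1 _
  have key : ∀ {e : B → ZMod p}, e ∈ shG A → ∀ {ω ω' : Pt p}, ω'.1 = (k ω).1 → e ω'.1 = 1 →
      sh (((k ω).2 - ω'.2) • e) ∈ A ∧ sh (((k ω).2 - ω'.2) • e) ω' = k ω := fun he ω ω' h1 h2 =>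
    ⟨ZMod.smul_mem he _, Prod.ext h1 (by simp [h2])⟩
  refine H.good_of_restrict T hkA hb1 1 (fun ω hω => ?_) (fun ω hω => ?_)
  · rcases zmod2_cases (c₀ ω.1) with h0 | h0
    · obtain ⟨hm, he⟩ := key hd (ω := ω) (ω' := ω) (by rw [hk1, h0]; simp) (hd1 _ hω)
      exact ⟨_, hm, fun x hx => by simp [hd0 x.1 (z _ hx)], he⟩
    · obtain ⟨hm, he⟩ := key hd (ω := ω) (ω' := S ω) (by rw [hk1, h0, hS1 ω hω]; simp)
        (hd1 _ (by rw [hS1 ω hω, hc1, hω]))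
      exact ⟨_, mul_mem hm hS, fun x hx => by
        rw [Perm.mul_apply, hS0 x (z _ hx)]; simp [hd0 x.1 (z _ hx)], he⟩
  · have hω' := z _ hω
    rcases zmod2_cases (c₀ ω.1) with h0 | h0
    · obtain ⟨hm, he⟩ := key hd' (ω := ω) (ω' := ω) (by rw [hk1, h0]; simp) (by simp [hd0 _ hω'])
      exact ⟨_, hm, fun x hx => by simp [hd1 x.1 hx], he⟩
    · obtain ⟨hm, he⟩ := key hd' (ω := ω) (ω' := R ω) (by rw [hk1, h0, hR0 ω hω']; simp)
        (by simp [hd0 (R ω).1 (by rw [hR0 ω hω', hc1, hω'])])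
      exact ⟨_, mul_mem hm hR, fun x hx => by
        rw [Perm.mul_apply, hR1 x hx]; simp [hd1 x.1 hx], he⟩

theorem good_odd_of_inv (hp : p ≠ 2) (H : Core A h t) (hA : A ≤ commWith (tr (s, 0))) {qs : B}
    (hqs : ∀ w, bl (h (qs, 0)) w = w + s) {u₀ u₁ : B} {c₀ c₁ : B → ZMod 2}
    (C : Coord s u₀ u₁ c₀ c₁) (ht : ∀ w, t (w + u₀) = t w) : Good A h := by
  rcases H.good_or_twisted hqs C with hg | ⟨q₀, q₁, T⟩
  · exact hg
  have hts := shG_add_s hA H.t_mem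
  have hc1 : ∀ w, c₁ (w + s) = c₁ w := fun w => by rw [C.add₁, C.s₁, add_zero]
  have hc0 : ∀ w, c₀ (w + s) = c₀ w := fun w => by rw [C.add₀, C.s₀, add_zero]
  have hb0 := H.bl_k_tw T.h₀ fun w => by rw [C.add₁, C.u₀₁, add_zero]
  have hb1 := H.bl_k_tw T.h₁ fun w => by rw [C.add₀, C.u₁₀, add_zero]
  obtain ⟨S, hSA, hS⟩ := H.exists_pure hp hA (H.k_mem q₀ u₀) hc1 hb0 fun w => by
    rw [H.mu_k hA T.h₀, ht, div_self (H.t_ne _)]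
  have hS0 : ∀ ω : Pt p, c₁ ω.1 = 0 → S ω = ω := fun ω hω => by rw [hS, hω]; simp
  have hS1 : ∀ ω : Pt p, c₁ ω.1 = 1 → S ω = (ω.1 + s, ω.2) := fun ω hω => by rw [hS, hω]; simp
  have hR : tr (s, 0) * S ∈ A := mul_mem (H.trmem _) hSA
  have hR1 : ∀ ω : Pt p, c₁ ω.1 = 1 → (tr ((s, 0) : Pt p) * S) ω = ω := fun ω hω => by
    rw [Perm.mul_apply, hS1 ω hω]
    ext1
    · simp [add_left_comm s, B.add_self]
    · simp
  have hR0 : ∀ ω : Pt p, c₁ ω.1 = 0 → (tr ((s, 0) : Pt p) * S) ω = (ω.1 + s, ω.2) := fun ω hω => by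
    rw [Perm.mul_apply, hS0 ω hω]
    simp [add_comm]
  have z : ∀ a : ZMod 2, a ≠ 1 → a = 0 := by decide
  have z' : ∀ a : ZMod 2, a = 1 → a ≠ 0 := by decide
  by_cases htc : ∀ w, t w = t 0
  · obtain ⟨S', hSA', hS'⟩ := H.exists_pure hp hA (H.k_mem q₁ u₁) hc0 hb1 fun w => by
      rw [H.mu_k hA T.h₁, htc w, htc (w + u₁), div_self (H.t_ne _)]
    refine H.good_of_restrict T hSA' (fun w => ?_) 1 (fun ω hω => ?_) (fun ω hω => ?_)
    · exact congrArg Prod.fst (hS' (w, 0))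
    · rcases zmod2_cases (c₀ ω.1) with h0 | h0
      · refine ⟨1, one_mem _, fun x _ => rfl, ?_⟩
        rw [hS', h0]
        simp
      · refine ⟨S, hSA, fun x hx => hS0 x (z _ hx), ?_⟩
        rw [hS', h0, hS1 ω hω]
        simp
    · rcases zmod2_cases (c₀ ω.1) with h0 | h0
      · refine ⟨1, one_mem _, fun x _ => rfl, ?_⟩
        rw [hS', h0]
        simp
      · refine ⟨_, hR, fun x hx => hR1 x hx, ?_⟩
        rw [hS', h0, hR0 ω (z _ hω)]
        simp
  · have htv : ∀ v w, c₁ v = c₁ w → t v = t w := by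
      intro v w hvw
      have h0 : ∀ v w, c₀ v = c₀ w → c₁ v = c₁ w → t v = t w := fun v w h0 h1 => by
        rcases C.eq_of h0 h1 with rfl | rfl
        exacts [rfl, hts _]
      by_cases h00 : c₀ v = c₀ w
      · exact h0 _ _ h00 hvw
      · rw [← ht w]
        refine h0 _ _ ?_ ?_
        · rw [C.add₀, C.u₀₀]
          exact (by decide : ∀ a b : ZMod 2, a ≠ b → a = b + 1) _ _ h00
        · rw [C.add₁, C.u₀₁, hvw, add_zero]
    have ht1 : t u₁ - t 0 ≠ 0 := fun h0 => htc fun w => by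
      rcases zmod2_cases (c₁ w) with h1 | h1
      · exact htv _ _ (by rw [h1, C.zero₁])
      · rw [← sub_eq_zero.1 h0]
        exact htv _ _ (by rw [h1, C.u₁₁])
    obtain ⟨d, hd, hd0, hd1⟩ : ∃ d ∈ shG A, (∀ w, c₁ w = 0 → d w = 0) ∧
        (∀ w, c₁ w = 1 → d w = 1) := by
      refine ⟨(t u₁ - t 0)⁻¹ • (t - fun _ => t 0),
        ZMod.smul_mem ((shG A).sub_mem H.t_mem (H.one_mem_shG _)) _, fun w hw => ?_, fun w hw => ?_⟩
      · simp [htv w 0 (by rw [hw, C.zero₁])]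
      · simp [htv w u₁ (by rw [hw, C.u₁₁]), inv_mul_cancel₀ ht1]
    exact H.good_of_local T hSA hR hS0 (fun ω hω => by rw [hS1 ω hω]) hR1
      (fun ω hω => by rw [hR0 ω hω]) hd hd0 hd1

end CommS
end Core

end

section

variable {p : ℕ}

theorem B.exists_ne : ∀ s u : B, ∃ w, w ≠ 0 ∧ w ≠ s ∧ w ≠ u ∧ w ≠ s + u := by
  decide +kernel

theorem B.exists_ne_two (s : B) : ∃ w, w ≠ 0 ∧ w ≠ s := by
  obtain ⟨w, h0, hs, -⟩ := B.exists_ne s s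
  exact ⟨w, h0, hs⟩

theorem Coord.diag {s u₀ u₁ : B} {c₀ c₁ : B → ZMod 2} (C : Coord s u₀ u₁ c₀ c₁) :
    Coord s (u₀ + u₁) u₀ c₁ (fun w => c₀ w + c₁ w) where
  s_ne := C.s_ne
  add₀ := C.add₁
  add₁ v w := by rw [C.add₀, C.add₁]; ring
  s₀ := C.s₁
  s₁ := by rw [C.s₀, C.s₁, add_zero]
  u₀₀ := by rw [C.add₁, C.u₀₁, C.u₁₁, zero_add]
  u₀₁ := by rw [C.add₀, C.add₁, C.u₀₁, C.u₁₁, C.u₀₀, C.u₁₀]; decide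
  u₁₀ := C.u₀₁
  u₁₁ := by rw [C.u₀₁, C.u₀₀, add_zero]
  ker v h0 h1 := C.ker v (by rw [h0, add_zero] at h1; exact h1) h0

/-- The subgroup of multipliers at `0` of the elements fixing all blocks. -/
def muG [Fact p.Prime] (A : Subgroup (Perm (Pt p))) (hA : A ≤ AffG p) :
    Subgroup (ZMod p)ˣ where
  carrier := {m | ∃ k ∈ A, (∀ w, bl k w = w) ∧ mu k 0 = m}
  one_mem' := ⟨1, one_mem _, fun w => rfl, by simp⟩
  mul_mem' := by
    rintro a b ⟨k, hk, hkb, hkm⟩ ⟨l, hl, hlb, hlm⟩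
    refine ⟨k * l, mul_mem hk hl, fun w => ?_, ?_⟩
    · rw [bl_mul (hA hk) (hA hl), hlb, hkb]
    · rw [mu_mul (hA hk) (hA hl), hlb, hkm, hlm, Units.val_mul]
  inv_mem' := by
    rintro a ⟨k, hk, hkb, hkm⟩
    have hb : ∀ w, bl k⁻¹ w = w := fun w => by
      conv_lhs => rw [← hkb w]
      exact bl_inv_bl (hA hk) w
    refine ⟨k⁻¹, inv_mem hk, hb, ?_⟩
    have := mu_mul (inv_mem (hA hk)) (hA hk) 0
    rw [hkb, hkm] at this
    simp only [inv_mul_cancel, mu_one] at this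
    rw [Units.val_inv_eq_inv_val]
    exact eq_inv_of_mul_eq_one_left this.symm

theorem IsCyclic.eq_one_or_eq_or_eq {G : Type*} [CommGroup G] [IsCyclic G] [Finite G] {a b : G}
    (ha : a ^ 2 = 1) (hb : b ^ 2 = 1) : a = 1 ∨ b = 1 ∨ a = b := by
  classical
  cases nonempty_fintype G
  by_contra! hcon
  obtain ⟨h1, h2, h3⟩ := hcon
  have := IsCyclic.card_pow_eq_one_le (α := G) (n := 2) (by norm_num)
  have hsub : ({1, a, b} : Finset G) ⊆ Finset.univ.filter fun x : G => x ^ 2 = 1 := by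
    intro x hx
    simp only [Finset.mem_insert, Finset.mem_singleton] at hx
    rcases hx with rfl | rfl | rfl <;> simp [ha, hb]
  have h4 := Finset.card_le_card hsub
  rw [Finset.card_insert_of_notMem, Finset.card_pair h3] at h4
  · omega
  · simp [h1.symm, h2.symm]

namespace Core
variable [Fact p.Prime] {A : Subgroup (Perm (Pt p))} {h : Pt p → Perm (Pt p)} {t : B → ZMod p}

theorem mu_mem_muG (H : Core A h t) {k : Perm (Pt p)} (hk : k ∈ A) (hb : ∀ w, bl k w = w) (y : B)
    {m : (ZMod p)ˣ} (hm : mu k y = m) : m ∈ muG A H.aff := by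
  refine ⟨tr (y, 0) * k * tr (y, 0), mul_mem (mul_mem (H.trmem _) hk) (H.trmem _), fun w => ?_, ?_⟩
  · rw [bl_mul (mul_mem (tr_mem_affG _) (H.aff hk)) (tr_mem_affG _),
      bl_mul (tr_mem_affG _) (H.aff hk), hb]
    simp [B.add_add_self]
  · rw [mu_mul (mul_mem (tr_mem_affG _) (H.aff hk)) (tr_mem_affG _),
      mu_mul (tr_mem_affG _) (H.aff hk)]
    simp [hm]

section CommS
variable {s : B}

theorem exists_local (H : Core A h t) (hA : A ≤ commWith (tr (s, 0)))
    (hS : ∀ w, (∀ c ∈ shG A, ∀ v, c (v + w) = c v) → w = 0 ∨ w = s)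
    {m : (ZMod p)ˣ} (hm : m ∈ muG A H.aff) (y : B) :
    ∃ k ∈ A, (∀ w, bl k w = w) ∧ ∀ w, mu k w = if w = y ∨ w = y + s then (m : ZMod p) else 1 := by
  obtain ⟨k₀, hk₀, hb₀, hm₀⟩ := hm
  obtain ⟨d, hd, hd1, hd0⟩ := indicator_mem_shG H.closed (H.one_mem_shG 1) H.ti {w | w = 0 ∨ w = s}
    (fun w => ⟨by
      rintro (rfl | rfl) c hc v
      · rw [add_zero]
      · exact shG_add_s hA hc v, hS w⟩) y
  have hmem : ∀ w : B, w + y ∈ {w : B | w = 0 ∨ w = s} ↔ w = y ∨ w = y + s := fun w => by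
    rw [Set.mem_ofPred_eq, B.add_eq_zero, ← eq_sub_iff_add_eq, sub_eq_add_neg,
      neg_eq_of_add_eq_zero_left (B.add_self y), add_comm s]
  simp only [hmem] at hd1 hd0
  have hd' : (fun _ => 1) - d ∈ shG A := (shG A).sub_mem (H.one_mem_shG _) hd
  obtain ⟨k, hk, hkb, hkm⟩ : ∃ k ∈ A, (∀ w, bl k w = w) ∧ mu k y = m := by
    refine ⟨tr (y, 0) * k₀ * tr (y, 0), mul_mem (mul_mem (H.trmem _) hk₀) (H.trmem _),
      fun w => ?_, ?_⟩
    · rw [bl_mul (mul_mem (tr_mem_affG _) (H.aff hk₀)) (tr_mem_affG _),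
        bl_mul (tr_mem_affG _) (H.aff hk₀), hb₀]
      simp [B.add_add_self]
    · rw [mu_mul (mul_mem (tr_mem_affG _) (H.aff hk₀)) (tr_mem_affG _),
        mu_mul (tr_mem_affG _) (H.aff hk₀)]
      simp [hm₀, B.add_self]
  have hk1 : ∀ ω : Pt p, (k ω).1 = ω.1 := fun ω => by
    rw [← Prod.mk.eta (p := ω), aff_apply (H.aff hk)]
    exact hkb _
  obtain ⟨k', hk', hX, hX'⟩ := H.closed.split hk {ω | ω.1 = y ∨ ω.1 = y + s}
    (fun ω => by simp only [Set.mem_ofPred_eq, hk1])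
    (fun ω hω => ⟨sh (((k ω).2 - ω.2) • d), ZMod.smul_mem hd _, fun x hx => by
      simp [hd0 x.1 hx], Prod.ext (hk1 ω).symm (by simp [hd1 _ hω])⟩)
    (fun ω hω => ⟨sh (((k ω).2 - ω.2) • ((fun _ => 1) - d)), ZMod.smul_mem hd' _, fun x hx => by
      simp [hd1 x.1 hx], Prod.ext (hk1 ω).symm (by simp [hd0 _ hω])⟩)
  refine ⟨k', hk', fun w => ?_, fun w => ?_⟩
  · by_cases hw : w = y ∨ w = y + s
    · exact (congrArg Prod.fst (hX (w, 0) hw)).trans (hkb w)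
    · exact congrArg Prod.fst (hX' (w, 0) hw)
  · split_ifs with hw
    · have : mu k' w = mu k w := by
        rw [mu, mu, hX (w, 1) hw, hX (w, 0) hw]
      rw [this]
      rcases hw with rfl | rfl
      · exact hkm
      · rw [H.mu_add_s hA hk, hkm]
    · rw [mu, hX' (w, 1) hw, hX' (w, 0) hw, sub_zero]

theorem good_odd_of_pair (hp : p ≠ 2) (H : Core A h t) (hA : A ≤ commWith (tr (s, 0)))
    (hS : ∀ w, (∀ c ∈ shG A, ∀ v, c (v + w) = c v) → w = 0 ∨ w = s) {qs : B}
    (hqs : ∀ w, bl (h (qs, 0)) w = w + s) {u v : B} {c₀ c₁ : B → ZMod 2}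
    (C : Coord s u v c₀ c₁) {a b : (ZMod p)ˣ} (ha : a ∈ muG A H.aff) (hb : b ∈ muG A H.aff)
    (ha' : t 0 = a * t u) (hb' : t v = b * t (u + v)) : Good A h := by
  obtain ⟨k, hk, hkb, hkm⟩ := H.exists_local hA hS ha u
  obtain ⟨l, hl, hlb, hlm⟩ := H.exists_local hA hS hb (u + v)
  have hkl : k * l ∈ A := mul_mem hk hl
  have hbl : ∀ w, bl (k * l) w = w := fun w => by
    rw [bl_mul (H.aff hk) (H.aff hl), hlb, hkb]
  have hbl' : ∀ w, bl (k * l)⁻¹ w = w := fun w => by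
    conv_lhs => rw [← hbl w]
    exact bl_inv_bl (H.aff hkl) w
  have hmu : ∀ w, mu (k * l) w = mu k w * mu l w := fun w => by
    rw [mu_mul (H.aff hk) (H.aff hl), hlb]
  have H' := H.conj hkl
  simp only [hbl', hmu] at H'
  have hts := shG_add_s hA H.t_mem
  have hmus := H.mu_add_s hA hk
  have hmus' := H.mu_add_s hA hl
  refine Good.of_cj hkl (H'.good_odd_of_inv hp hA (qs := qs)
    (fun w => by rw [H.bl_cj_of_trivial hkl hbl, hqs]) C ?_)
  have e1 : (1 : ZMod 2) ≠ 0 := by decide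
  have e2 : (0 : ZMod 2) ≠ 1 := by decide
  have hc : ∀ {x y : B}, c₀ x ≠ c₀ y ∨ c₁ x ≠ c₁ y → ¬(x = y ∨ x = y + s) := by
    rintro x y hxy (rfl | rfl)
    · simp at hxy
    · simp [C.add₀, C.add₁, C.s₀, C.s₁] at hxy
  have hu1 : ¬ (0 = u ∨ 0 = u + s) := hc (by simp [C.zero₀, C.u₀₀])
  have hu2 : ¬ (0 = u + v ∨ 0 = u + v + s) := hc (by simp [C.add₀, C.zero₀, C.u₀₀, C.u₁₀])
  have hu3 : ¬ (u = u + v ∨ u = u + v + s) := hc (by simp [C.add₀, C.add₁, C.u₀₁, C.u₁₁])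
  have hu4 : ¬ (v = u ∨ v = u + s) := hc (by simp [C.u₀₀, C.u₁₀])
  have hu5 : ¬ (v = u + v ∨ v = u + v + s) := hc (by simp [C.add₀, C.u₀₀, C.u₁₀])
  have hu6 : ¬ (u + v = u ∨ u + v = u + s) := hc (by simp [C.add₁, C.u₀₁, C.u₁₁])
  have m0 : mu k 0 * mu l 0 * t 0 = mu k u * mu l u * t u := by
    simp only [hkm, hlm, if_neg hu1, if_neg hu2, if_neg hu3]
    simp [ha']
  have m1 : mu k v * mu l v * t v = mu k (u + v) * mu l (u + v) * t (u + v) := by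
    simp only [hkm, hlm, if_neg hu4, if_neg hu5, if_neg hu6]
    simp [hb']
  have hper : ∀ w (e : ZMod 2), mu k (w + e • s) * mu l (w + e • s) * t (w + e • s) =
      mu k w * mu l w * t w := fun w e => by
    rw [add_smul_s hts, add_smul_s hmus, add_smul_s hmus']
  intro w
  obtain ⟨e, x, hx, rfl⟩ : ∃ (e : ZMod 2) (x : B), (x = 0 ∨ x = u ∨ x = v ∨ x = u + v) ∧
      w = x + e • s := by
    have key : ∀ x : B, c₀ w = c₀ x → c₁ w = c₁ x → ∃ e : ZMod 2, w = x + e • s := fun x h0 h1 => by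
      rcases C.eq_of h0 h1 with rfl | rfl
      exacts [⟨0, by simp⟩, ⟨1, by simp⟩]
    rcases zmod2_cases (c₀ w) with h0 | h0 <;> rcases zmod2_cases (c₁ w) with h1 | h1
    · obtain ⟨e, he⟩ := key 0 (by rw [h0, C.zero₀]) (by rw [h1, C.zero₁])
      exact ⟨e, _, by simp, he⟩
    · obtain ⟨e, he⟩ := key v (by rw [h0, C.u₁₀]) (by rw [h1, C.u₁₁])
      exact ⟨e, _, by simp, he⟩
    · obtain ⟨e, he⟩ := key u (by rw [h0, C.u₀₀]) (by rw [h1, C.u₀₁])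
      exact ⟨e, _, by simp, he⟩
    · obtain ⟨e, he⟩ := key (u + v) (by simp [h0, C.add₀, C.u₀₀, C.u₁₀])
        (by simp [h1, C.add₁, C.u₀₁, C.u₁₁])
      exact ⟨e, _, by simp, he⟩
  rw [add_right_comm, hper, hper]
  rcases hx with rfl | rfl | rfl | rfl
  · rw [zero_add, m0]
  · rw [B.add_self, m0]
  · rw [add_comm x u, m1]
  · rw [add_right_comm, B.add_self, zero_add, m1]

theorem sq_mem_muG (H : Core A h t) (hA : A ≤ commWith (tr (s, 0))) {u q : B} {φ : B → ZMod 2}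
    (hq : ∀ w, bl (h (q, 0)) w = w + u + φ w • s) (hφ : ∀ w, φ (w + u) = φ w)
    (hφs : ∀ w, φ (w + s) = φ w) (y : B) {m : (ZMod p)ˣ} (hm : t y = m * t (y + u)) :
    m ^ 2 ∈ muG A H.aff := by
  have hk := H.k_mem q u
  have hb := H.bl_k_tw hq hφ
  have hmu := H.mu_k hA hq
  generalize h (q, 0) * tr (u, 0) = k at hk hb hmu
  have hφs' : ∀ w (a : ZMod 2), φ (w + a • s) = φ w := fun w a => by
    rcases zmod2_cases a with rfl | rfl
    · simp
    · simp [hφs]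
  refine H.mu_mem_muG (mul_mem hk hk) (fun w => ?_) y ?_
  · rw [bl_mul (H.aff hk) (H.aff hk), hb, hb, hφs', add_assoc, smul_add_self, add_zero]
  · rw [mu_mul (H.aff hk) (H.aff hk), hb, add_smul_s (H.mu_add_s hA hk), hmu, hm,
      mul_div_cancel_right₀ _ (H.t_ne _), pow_two, Units.val_mul]

theorem good_odd_of_commWith (hp : p ≠ 2) (H : Core A h t) (hA : A ≤ commWith (tr (s, 0)))
    (hs : s ≠ 0) {qs : B} (hqs : ∀ w, bl (h (qs, 0)) w = w + s) : Good A h := by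
  by_cases hS : ∀ w, (∀ c ∈ shG A, ∀ v, c (v + w) = c v) → w = 0 ∨ w = s
  swap
  · push Not at hS
    obtain ⟨u, hu, hu0, hus⟩ := hS
    obtain ⟨v, hv⟩ := B.exists_ne s u
    obtain ⟨c₀, c₁, C⟩ := exists_coord hs hu0 hus hv
    exact H.good_odd_of_inv hp hA hqs C (hu t H.t_mem)
  obtain ⟨u₀, h0, h0s⟩ := B.exists_ne_two s
  obtain ⟨u₁, hv⟩ := B.exists_ne s u₀
  obtain ⟨c₀, c₁, C⟩ := exists_coord hs h0 h0s hv
  rcases H.good_or_twisted hqs C with hg | ⟨q₀, q₁, T⟩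
  · exact hg
  have hex : ∀ v w, ∃ m : (ZMod p)ˣ, t v = m * t w := fun v w =>
    ⟨Units.mk0 (t v / t w) (div_ne_zero (H.t_ne _) (H.t_ne _)), by simp [H.t_ne]⟩
  obtain ⟨a, ha⟩ := hex 0 u₀
  obtain ⟨b, hb⟩ := hex 0 u₁
  obtain ⟨a', ha'⟩ := hex u₁ (u₁ + u₀)
  have hts := shG_add_s hA H.t_mem
  have hc1u : ∀ w, c₁ (w + u₀) = c₁ w := fun w => by rw [C.add₁, C.u₀₁, add_zero]
  have hc1s : ∀ w, c₁ (w + s) = c₁ w := fun w => by rw [C.add₁, C.s₁, add_zero]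
  have hc0u : ∀ w, c₀ (w + u₁) = c₀ w := fun w => by rw [C.add₀, C.u₁₀, add_zero]
  have hc0s : ∀ w, c₀ (w + s) = c₀ w := fun w => by rw [C.add₀, C.s₀, add_zero]
  have ha2 := H.sq_mem_muG hA T.h₀ hc1u hc1s 0 (m := a) (by rw [zero_add, ha])
  have hb2 := H.sq_mem_muG hA T.h₁ hc0u hc0s 0 (m := b) (by rw [zero_add, hb])
  have ha2' := H.sq_mem_muG hA T.h₀ hc1u hc1s u₁ ha'
  have h₂ : ∀ w, bl (h (q₀ + q₁, 0)) w = w + (u₀ + u₁) + (c₀ w + c₁ w + 1) • s := fun w => by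
    rw [H.bl_add, T.h₁, T.h₀]
    have : c₁ (w + u₁ + c₀ w • s) = c₁ w + 1 := by
      rw [add_smul_s hc1s, C.add₁, C.u₁₁]
    rw [this]
    module
  have h3 : a * b * (b * a') ∈ muG A H.aff := by
    have hk0 := H.k_mem q₀ u₀
    have hb0 := H.bl_k_tw T.h₀ hc1u
    have hm0 := H.mu_k hA T.h₀
    have hk1 := H.k_mem q₁ u₁
    have hb1 := H.bl_k_tw T.h₁ hc0u
    have hm1 := H.mu_k hA T.h₁
    have hk2 := H.k_mem (q₀ + q₁) (u₀ + u₁)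
    have hb2 := H.bl_k_tw h₂ (fun w => by
      rw [C.add₀, C.add₀, C.add₁, C.add₁, C.u₀₀, C.u₀₁, C.u₁₀, C.u₁₁]
      exact (by decide : ∀ a b : ZMod 2, a + (1 + 0) + (b + (0 + 1)) + 1 = a + b + 1) _ _)
    have hm2 := H.mu_k hA h₂
    generalize h (q₀, 0) * tr (u₀, 0) = k₀ at hk0 hb0 hm0
    generalize h (q₁, 0) * tr (u₁, 0) = k₁ at hk1 hb1 hm1
    generalize h (q₀ + q₁, 0) * tr (u₀ + u₁, 0) = k₂ at hk2 hb2 hm2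
    have hk01 := mul_mem hk0 hk1
    have hk012 := mul_mem hk01 hk2
    have hk := mul_mem hk012 (H.trmem (s, 0))
    have e : t u₁ = t 0 * (b : ZMod p)⁻¹ := by
      rw [hb]; field_simp
    refine H.mu_mem_muG hk (fun w => ?_) 0 ?_
    · rw [bl_mul (H.aff hk012) (tr_mem_affG _), bl_mul (H.aff hk01) (H.aff hk2),
        bl_mul (H.aff hk0) (H.aff hk1), hb2, hb1, hb0]
      simp only [bl_tr]
      rw [add_smul_s hc1s, add_smul_s hc0s, add_smul_s hc1s, hc0s, hc1s, add_assoc, ← add_smul,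
        add_assoc, ← add_smul]
      rw [(by decide : ∀ a b : ZMod 2, a + b + 1 + (a + b) = 1) (c₀ w) (c₁ w), one_smul,
        B.add_add_self]
    · rw [mu_mul (H.aff hk012) (tr_mem_affG _), mu_mul (H.aff hk01) (H.aff hk2),
        mu_mul (H.aff hk0) (H.aff hk1), hb2, hb1]
      simp only [bl_tr, mu_tr, mul_one]
      rw [H.mu_add_s hA hk2, add_smul_s (H.mu_add_s hA hk0), add_smul_s (H.mu_add_s hA hk0),
        add_smul_s (H.mu_add_s hA hk1), H.mu_add_s hA hk0, H.mu_add_s hA hk1, hm0, hm1, hm2]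
      have e0 : t 0 / t (0 + u₀) = a := by rw [zero_add, ha, mul_div_cancel_right₀ _ (H.t_ne _)]
      have e1 : t 0 / t (0 + u₁) = b := by rw [zero_add, hb, mul_div_cancel_right₀ _ (H.t_ne _)]
      have e2 : t 0 / t (0 + (u₀ + u₁)) = b * a' := by
        rw [zero_add, add_comm u₀, hb, ha', ← mul_assoc, mul_div_cancel_right₀ _ (H.t_ne _)]
      rw [e0, e1, e2]
      simp
  set M := muG A H.aff with hM
  have hq : ∀ x : (ZMod p)ˣ, (x : (ZMod p)ˣ ⧸ M) = 1 ↔ x ∈ M := fun x => QuotientGroup.eq_one_iff x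
  have fin : ∀ x y : (ZMod p)ˣ, x ^ 2 ∈ M → y ^ 2 ∈ M → x ∉ M → y ∉ M → x / y ∈ M := by
    intro x y hx hy hx' hy'
    rw [← hq] at hx hy hx' hy' ⊢
    rcases IsCyclic.eq_one_or_eq_or_eq (a := (x : (ZMod p)ˣ ⧸ M)) (b := y)
      (by simpa using hx) (by simpa using hy) with h | h | h
    · exact absurd h hx'
    · exact absurd h hy'
    · rw [QuotientGroup.mk_div, h, div_self']
  have h4 : a * a' ∈ M := by
    have : a * a' = (a * b * (b * a')) / b ^ 2 := by
      rw [eq_div_iff_mul_eq', pow_two]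
      ac_rfl
    rw [this]
    exact M.div_mem h3 hb2
  by_cases haM : a ∈ M
  · refine H.good_odd_of_pair hp hA hS hqs C haM (b := a') ?_ ha (by rw [ha', add_comm])
    rwa [M.mul_mem_cancel_left haM] at h4
  · by_cases hbM : b ∈ M
    · obtain ⟨b', hb'⟩ := hex u₀ (u₁ + u₀)
      have : b' = a' * b / a := by
        have : a * b' = b * a' := by
          apply Units.ext
          have h5 : (t 0) = a * b' * t (u₁ + u₀) := by rw [ha, hb', mul_assoc]
          rw [hb, ha', ← mul_assoc] at h5
          simpa using (mul_right_cancel₀ (H.t_ne _) h5).symm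
        rw [eq_div_iff_mul_eq', mul_comm, this, mul_comm]
      refine H.good_odd_of_pair hp hA hS hqs C.swap hbM (b := b') ?_ hb hb'
      rw [this]
      have : a' * b / a = (a * a') * b / a ^ 2 := by
        rw [div_eq_div_iff_mul_eq_mul, pow_two]
        ac_rfl
      rw [this]
      exact M.div_mem (M.mul_mem h4 hbM) ha2
    · have hab := fin a b ha2 hb2 haM hbM
      refine H.good_odd_of_pair hp hA hS hqs C.diag (a := b * a') (b := b / a) ?_ ?_ ?_ ?_
      · have : b * a' = (a * a') / (a / b) := by
          rw [eq_div_iff_mul_eq', mul_div_assoc', div_eq_iff_eq_mul]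
          ac_rfl
        rw [this]
        exact M.div_mem h4 hab
      · rw [← inv_div]
        exact M.inv_mem hab
      · rw [Units.val_mul, mul_assoc, add_comm u₀, ← ha', hb]
      · have : u₀ + u₁ + u₀ = u₁ := by rw [add_right_comm, B.add_self, zero_add]
        rw [this]
        have h6 : (b : ZMod p) * t u₁ = a * t u₀ := by rw [← hb, ha]
        rw [div_eq_mul_inv, Units.val_mul, mul_right_comm, h6, mul_right_comm, ← Units.val_mul,
          mul_inv_cancel, Units.val_one, one_mul]

end CommS

theorem good_of_odd (hp : p ≠ 2) (H : Core A h t) : Good A h := by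
  obtain ⟨a, ha, s, hs, u, hu⟩ := H.exists_common_block
  have H1 := H.conj ha
  refine Good.of_cj ha ?_
  obtain ⟨b, hb, hbb, γ, hγ⟩ := H1.exists_conj_tr (Or.inl hp) hu
  have H2 := H1.conj hb
  refine Good.of_cj hb (Good.mono inf_le_left ((H2.cent hγ).good_odd_of_commWith hp inf_le_right hs
    (qs := u) fun w => ?_))
  rw [H1.bl_cj_of_trivial hb hbb, hu]

end Core

end

section

theorem sum_eq_one_of_not_inv : ∀ {a b c d : ZMod 2}, ¬(b = a ∧ d = c) → ¬(c = a ∧ d = b) →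
    ¬(d = a ∧ c = b) → a + b + c + d = 1 := by
  decide

namespace Core
variable {A : Subgroup (Perm (Pt 2))} {h : Pt 2 → Perm (Pt 2)} {t : B → ZMod 2} {s : B}

theorem t_two (H : Core A h t) : t = fun _ => 1 :=
  funext fun w => zmod2_eq_one rfl (H.t_ne w)

theorem apply_two (H : Core A h t) {σ : Perm (Pt 2)} (hσ : σ ∈ A) (v : B) (x : ZMod 2) :
    σ (v, x) = (bl σ v, x + off σ v) := by
  rw [aff_apply (H.aff hσ), zmod2_eq_one rfl (mu_ne_zero (H.aff hσ) v), one_mul]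

theorem off_mul_two (H : Core A h t) {σ τ : Perm (Pt 2)} (hσ : σ ∈ A) (hτ : τ ∈ A) (v : B) :
    off (σ * τ) v = off τ v + off σ (bl τ v) := by
  rw [off_mul (H.aff hσ) (H.aff hτ), zmod2_eq_one rfl (mu_ne_zero (H.aff hσ) _), one_mul]

theorem off_sq_two (H : Core A h t) {u q : B} {φ : B → ZMod 2}
    (hq : ∀ w, bl (h (q, 0)) w = w + u + φ w • s) (w : B) :
    off (h (q, 0)) (w + u + φ w • s) = off (h (q, 0)) w := by
  have h1 := congrArg (fun σ => off σ w) (H.sq q)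
  simp only [H.off_mul_two (H.hmem _) (H.hmem _), hq] at h1
  have h2 : off (1 : Perm (Pt 2)) w = 0 := rfl
  rw [h2] at h1
  exact (CharTwo.add_eq_zero.1 h1).symm

theorem off_comm_two (H : Core A h t) (q q' w : B) :
    off (h (q, 0)) w + off (h (q', 0)) (bl (h (q, 0)) w) =
      off (h (q', 0)) w + off (h (q, 0)) (bl (h (q', 0)) w) := by
  rw [← H.off_mul_two (H.hmem _) (H.hmem _), ← H.off_mul_two (H.hmem _) (H.hmem _), H.reg.comm]

theorem k_apply_two (H : Core A h t) {u q : B} {φ : B → ZMod 2}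
    (hq : ∀ w, bl (h (q, 0)) w = w + u + φ w • s) (hφ : ∀ w, φ (w + u) = φ w) (w : B)
    (x : ZMod 2) : (h (q, 0) * tr (u, 0) : Perm (Pt 2)) (w, x) = (w + φ w • s, x + off (h (q, 0)) (w + u)) := by
  rw [H.apply_two (H.k_mem _ _), H.bl_k_tw hq hφ, H.off_mul_two (H.hmem _) (H.trmem _)]
  simp

theorem exists_nearly_pure_two (H : Core A h t) (hA : A ≤ commWith (tr (s, 0))) {u v q : B}
    {c c' : B → ZMod 2} (C : Coord s u v c c') (hq : ∀ w, bl (h (q, 0)) w = w + u + c' w • s) :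
    ∃ S ∈ A, ∀ ω : Pt 2, S ω =
      (ω.1 + c' ω.1 • s, ω.2 + c' ω.1 * (off (h (q, 0)) v + off (h (q, 0)) 0)) := by
  have hc' : ∀ w, c' (w + u) = c' w := fun w => by rw [C.add₁, C.u₀₁, add_zero]
  have hrs := H.off_add_s hA (H.hmem (q, 0))
  have hk := H.k_apply_two hq hc'
  have hru : ∀ w, off (h (q, 0)) (w + u) = off (h (q, 0)) w := fun w => by
    rw [← H.off_sq_two hq w, add_smul_s hrs]
  have hr : ∀ v w, c' v = c' w → off (h (q, 0)) v = off (h (q, 0)) w := by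
    intro v w hvw
    have h0 : ∀ v w, c v = c w → c' v = c' w → off (h (q, 0)) v = off (h (q, 0)) w :=
      fun v w h0 h1 => by
        rcases C.eq_of h0 h1 with rfl | rfl
        exacts [rfl, hrs _]
    by_cases h00 : c v = c w
    · exact h0 _ _ h00 hvw
    · rw [← hru w]
      refine h0 _ _ ?_ (by rw [hc', hvw])
      rw [C.add₀, C.u₀₀]
      exact (by decide : ∀ a b : ZMod 2, a ≠ b → a = b + 1) _ _ h00
  refine ⟨h (q, 0) * tr (u, 0) * sh fun _ => off (h (q, 0)) 0,
    mul_mem (H.k_mem _ _) (H.one_mem_shG _), fun ω => ?_⟩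
  rw [Perm.mul_apply, sh_apply, hk, hru]
  refine Prod.ext rfl ?_
  rcases zmod2_cases (c' ω.1) with h1 | h1
  · simp only [h1, hr ω.1 0 (by rw [h1, C.zero₁])]
    exact (by decide : ∀ a b c : ZMod 2, a + b + b = a + 0 * c) _ _ _
  · simp only [h1, hr ω.1 v (by rw [h1, C.u₁₁])]
    ring

theorem good_two_of_commWith (H : Core A h t) (hA : A ≤ commWith (tr (s, 0)))
    (hs : s ≠ 0) {qs : B} (hqs : ∀ w, bl (h (qs, 0)) w = w + s) : Good A h := by
  obtain ⟨u₀, h0, h0s⟩ := B.exists_ne_two s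
  obtain ⟨u₁, hv⟩ := B.exists_ne s u₀
  obtain ⟨c₀, c₁, C⟩ := exists_coord hs h0 h0s hv
  rcases H.good_or_twisted hqs C with hg | ⟨q₀, q₁, T⟩
  · exact hg
  obtain ⟨S, hS, hSω⟩ := H.exists_nearly_pure_two hA C T.h₀
  obtain ⟨S', hS', hSω'⟩ := H.exists_nearly_pure_two hA C.swap T.h₁
  have hβ : off (h (q₁, 0)) u₀ + off (h (q₁, 0)) 0 = off (h (q₀, 0)) u₁ + off (h (q₀, 0)) 0 := by
    have := H.off_comm_two q₀ q₁ 0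
    rw [T.h₀, T.h₁, C.zero₀, C.zero₁, zero_smul, add_zero, add_zero, zero_add, zero_add] at this
    exact (by decide : ∀ a b c d : ZMod 2, a + b = c + d → b + c = d + a) _ _ _ _ this
  rw [hβ] at hSω'
  generalize off (h (q₀, 0)) u₁ + off (h (q₀, 0)) 0 = β at hSω hSω'
  have hR : ∀ ω : Pt 2, (tr (s, β) * S : Perm (Pt 2)) ω =
      (ω.1 + (c₁ ω.1 + 1) • s, ω.2 + (c₁ ω.1 + 1) * β) := fun ω => by
    rw [Perm.mul_apply, hSω, tr_apply]
    refine Prod.ext ?_ ?_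
    · simp only
      module
    · simp only
      ring
  have z : ∀ a : ZMod 2, a ≠ 1 → a = 0 := by decide
  refine H.good_of_restrict T hS' (fun w => congrArg Prod.fst (hSω' (w, 0))) 1
    (fun ω hω => ?_) (fun ω hω => ?_)
  · rcases zmod2_cases (c₀ ω.1) with h0 | h0
    · exact ⟨1, one_mem _, fun x _ => rfl, by simp [hSω', h0]⟩
    · exact ⟨S, hS, fun x hx => by simp [hSω, z _ hx], by rw [hSω, hSω', h0, hω]⟩
  · rcases zmod2_cases (c₀ ω.1) with h0 | h0
    · exact ⟨1, one_mem _, fun x _ => rfl, by simp [hSω', h0]⟩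
    · refine ⟨tr (s, β) * S, mul_mem (H.trmem _) hS, fun x hx => ?_, ?_⟩
      · rw [hR, hx, CharTwo.add_self_eq_zero]; simp
      · rw [hR, hSω', h0, z _ hω, zero_add]

section Inv

theorem off_add_s_two (H : Core A h t) {qs : B} {f : B → ZMod 2}
    (hf : ∀ v x, h (qs, 0) (v, x) = (v + s, x + f v)) (hfs : ∀ w, f (w + s) = f w) {u q : B}
    {φ : B → ZMod 2} (hq : ∀ w, bl (h (q, 0)) w = w + u + φ w • s) (w : B) :
    off (h (q, 0)) (w + s) + off (h (q, 0)) w = f w + f (w + u) := by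
  have hb : ∀ w, bl (h (qs, 0)) w = w + s := fun w => congrArg Prod.fst (hf w 0)
  have ho : ∀ w, off (h (qs, 0)) w = f w := fun w => (congrArg Prod.snd (hf w 0)).trans (zero_add _)
  have := H.off_comm_two qs q w
  rw [hb, hq, ho, ho, add_smul_s hfs] at this
  exact (by decide : ∀ a b c d : ZMod 2, a + b = c + d → b + c = a + d) _ _ _ _ this

theorem good_two_of_inv (H : Core A h t) {qs q₀ q₁ u₀ u₁ : B} {c₀ c₁ : B → ZMod 2}
    (T : Tw h s u₀ u₁ c₀ c₁ qs q₀ q₁) {f : B → ZMod 2} (hfm : f ∈ shG A)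
    (hf : ∀ v x, h (qs, 0) (v, x) = (v + s, x + f v)) (hfs : ∀ w, f (w + s) = f w)
    (hfu : ∀ w, f (w + u₀) = f w) (hfc : ∃ w, f w ≠ f 0) : Good A h := by
  have hcu : ∀ w, c₁ (w + u₀) = c₁ w := fun w => by rw [T.add₁, T.u₀₁, add_zero]
  have dep : ∀ {r : B → ZMod 2}, (∀ w, r (w + s) = r w) → (∀ w, r (w + u₀) = r w) →
      ∀ v, r v = r 0 + c₁ v * (r u₁ + r 0) := by
    intro r hrs hru
    have hr : ∀ v w, c₁ v = c₁ w → r v = r w := by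
      intro v w hvw
      have h0 : ∀ v w, c₀ v = c₀ w → c₁ v = c₁ w → r v = r w := fun v w h0 h1 => by
        rcases T.eq_of h0 h1 with rfl | rfl
        exacts [rfl, hrs _]
      by_cases h00 : c₀ v = c₀ w
      · exact h0 _ _ h00 hvw
      · rw [← hru w]
        refine h0 _ _ ?_ (by rw [hcu, hvw])
        rw [T.add₀, T.u₀₀]
        exact (by decide : ∀ a b : ZMod 2, a ≠ b → a = b + 1) _ _ h00
    intro v
    rcases zmod2_cases (c₁ v) with h1 | h1
    · rw [hr v 0 (by rw [h1, T.zero₁]), h1, zero_mul, add_zero]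
    · rw [hr v u₁ (by rw [h1, T.u₁₁]), h1]
      exact (by decide : ∀ a b : ZMod 2, a = b + 1 * (a + b)) _ _
  have hd : c₁ ∈ shG A := by
    have hf1 : f u₁ + f 0 = 1 := by
      obtain ⟨w, hw⟩ := hfc
      rw [dep hfs hfu w] at hw
      exact (by decide : ∀ a b c : ZMod 2, a + b * c ≠ a → c = 1) _ _ _ hw
    have : c₁ = f - fun _ => f 0 := by
      ext1 v
      rw [Pi.sub_apply, dep hfs hfu v, hf1, mul_one, add_sub_cancel_left]
    rw [this]
    exact (shG A).sub_mem hfm (H.one_mem_shG _)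
  have hrs : ∀ w, off (h (q₀, 0)) (w + s) = off (h (q₀, 0)) w := fun w => by
    have := H.off_add_s_two hf hfs T.h₀ w
    rw [hfu, CharTwo.add_self_eq_zero] at this
    exact CharTwo.add_eq_zero.1 this
  have hru : ∀ w, off (h (q₀, 0)) (w + u₀) = off (h (q₀, 0)) w := fun w => by
    rw [← H.off_sq_two T.h₀ w, add_smul_s hrs]
  have hk := H.k_apply_two T.h₀ hcu
  have hr : off (h (q₀, 0)) ∈ shG A := by
    have : off (h (q₀, 0)) = (fun _ => off (h (q₀, 0)) 0) +
        (off (h (q₀, 0)) u₁ + off (h (q₀, 0)) 0) • c₁ := by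
      ext1 v
      rw [dep hrs hru v]
      simp [mul_comm]
    rw [this]
    exact (shG A).add_mem (H.one_mem_shG _) (ZMod.smul_mem hd _)
  have hSm := mul_mem (H.k_mem q₀ u₀) hr
  obtain ⟨S, hS, hSω⟩ : ∃ S ∈ A, ∀ ω : Pt 2, S ω = (ω.1 + c₁ ω.1 • s, ω.2) := by
    refine ⟨_, hSm, fun ω => ?_⟩
    rw [Perm.mul_apply, sh_apply, hk, hru, add_assoc, CharTwo.add_self_eq_zero, add_zero]
  refine H.good_of_local T hS (mul_mem (H.trmem (s, 0)) hS) (fun ω hω => ?_) (fun ω hω => ?_)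
    (fun ω hω => ?_) (fun ω hω => ?_) hd (fun w hw => hw) (fun w hw => hw)
  · simp [hSω, hω]
  · simp [hSω, hω]
  · rw [Perm.mul_apply, hSω, hω, tr_apply]
    refine Prod.ext ?_ (by simp)
    simp [add_left_comm s, B.add_self]
  · simp [hSω, hω, add_comm]

theorem mem_shG_of_add_s (H : Core A h t) (hs : ∀ c ∈ shG A, ∀ v, c (v + s) = c v)
    (hS : ∀ w, (∀ c ∈ shG A, ∀ v, c (v + w) = c v) → w = 0 ∨ w = s)
    {F : B → ZMod 2} (hF : ∀ w, F (w + s) = F w) : F ∈ shG A := by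
  have key : ∀ E : Finset B, ∃ c ∈ shG A, ∀ w ∈ E, c w = F w := by
    intro E
    induction E using Finset.induction_on with
    | empty => exact ⟨0, (shG A).zero_mem, by simp⟩
    | insert y E _ ih =>
      obtain ⟨c, hc, hcF⟩ := ih
      obtain ⟨d, hd, hd1, hd0⟩ := indicator_mem_shG H.closed (H.one_mem_shG 1) H.ti
        {w | w = 0 ∨ w = s} (fun w => ⟨by
          rintro (rfl | rfl) c hc v
          · rw [add_zero]
          · exact hs c hc v, hS w⟩) y
      have hy : ∀ w, w + y ∈ {w : B | w = 0 ∨ w = s} → c w + (F y - c y) * d w = F w := by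
        intro w hw
        rw [hd1 w hw]
        rcases hw with hw | hw
        · rw [B.add_eq_zero.1 hw]; ring
        · have : w = y + s := by rw [← hw, add_comm, B.add_add_self]
          rw [this, hs c hc, hF]; ring
      refine ⟨c + (F y - c y) • d, (shG A).add_mem hc (ZMod.smul_mem hd _), fun w hw => ?_⟩
      simp only [Pi.add_apply, Pi.smul_apply, smul_eq_mul]
      by_cases hwy : w + y ∈ {w : B | w = 0 ∨ w = s}
      · exact hy w hwy
      · rw [hd0 w hwy, mul_zero, add_zero]
        rcases Finset.mem_insert.1 hw with rfl | hw
        · exact absurd (Or.inl (B.add_self w)) hwy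
        · exact hcF w hw
  obtain ⟨c, hc, h⟩ := key Finset.univ
  rwa [← funext fun w => h w (Finset.mem_univ _)]

theorem good_two_of_not_inv (H : Core A h t) {qs q₀ q₁ u₀ u₁ : B} {c₀ c₁ : B → ZMod 2}
    (T : Tw h s u₀ u₁ c₀ c₁ qs q₀ q₁) {f : B → ZMod 2}
    (hf : ∀ v x, h (qs, 0) (v, x) = (v + s, x + f v)) (hfs : ∀ w, f (w + s) = f w)
    (hs : ∀ c ∈ shG A, ∀ v, c (v + s) = c v)
    (hS : ∀ w, (∀ v, f (v + w) = f v) → w = 0 ∨ w = s) (hfm : f ∈ shG A) : Good A h := by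
  have hall : ∀ {F : B → ZMod 2}, (∀ w, F (w + s) = F w) → F ∈ shG A := fun hF =>
    H.mem_shG_of_add_s hs (fun w hw => hS w (hw f hfm)) hF
  have hcu : ∀ w, c₁ (w + u₀) = c₁ w := fun w => by rw [T.add₁, T.u₀₁, add_zero]
  have hcs : ∀ w, c₁ (w + s) = c₁ w := fun w => by rw [T.add₁, T.s₁, add_zero]
  have four : ∀ {P : B → Prop}, (∀ w, P w → P (w + s)) → P 0 → P u₀ → P u₁ → P (u₀ + u₁) →
      ∀ w, P w := by
    intro P hP p0 p1 p2 p3 w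
    have key : ∀ x : B, c₀ w = c₀ x → c₁ w = c₁ x → P x → P w := fun x h0 h1 hx => by
      rcases T.eq_of h0 h1 with rfl | rfl
      exacts [hx, hP _ hx]
    rcases zmod2_cases (c₀ w) with h0 | h0 <;> rcases zmod2_cases (c₁ w) with h1 | h1
    · exact key 0 (by rw [h0, T.zero₀]) (by rw [h1, T.zero₁]) p0
    · exact key u₁ (by rw [h0, T.u₁₀]) (by rw [h1, T.u₁₁]) p2
    · exact key u₀ (by rw [h0, T.u₀₀]) (by rw [h1, T.u₀₁]) p1
    · exact key (u₀ + u₁) (by simp [h0, T.add₀, T.u₀₀, T.u₁₀])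
        (by simp [h1, T.add₁, T.u₀₁, T.u₁₁]) p3
  have inv4 : ∀ u, f (0 + u) = f 0 → f (u₀ + u) = f u₀ → f (u₁ + u) = f u₁ →
      f (u₀ + u₁ + u) = f (u₀ + u₁) → u = 0 ∨ u = s := fun u a b c d =>
    hS u (four (fun w hw => by rw [add_right_comm, hfs, hfs, hw]) a b c d)
  have e1 : u₀ + u₁ + u₀ = u₁ := by rw [add_right_comm, B.add_self, zero_add]
  have e2 : u₀ + (u₀ + u₁) = u₁ := by rw [add_comm, e1]
  have e3 : u₁ + (u₀ + u₁) = u₀ := by rw [add_comm u₀, ← add_assoc, B.add_self, zero_add]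
  have hne : ∀ {u}, c₀ u = 1 ∨ c₁ u = 1 → ¬ (u = 0 ∨ u = s) := by
    rintro u hu (rfl | rfl)
    · simp [T.zero₀, T.zero₁] at hu
    · simp [T.s₀, T.s₁] at hu
  have hodd : f 0 + f u₀ + f u₁ + f (u₀ + u₁) = 1 := by
    have i1 := inv4 u₀
    have i2 := inv4 u₁
    have i3 := inv4 (u₀ + u₁)
    simp only [hne (Or.inl T.u₀₀), hne (Or.inr T.u₁₁),
      hne (Or.inl (show c₀ (u₀ + u₁) = 1 by rw [T.add₀, T.u₀₀, T.u₁₀, add_zero])), zero_add,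
      B.add_self, e1, e2, e3, add_comm u₁ u₀, add_assoc u₀ u₁ u₁, add_zero] at i1 i2 i3
    exact sum_eq_one_of_not_inv (fun hh => i1 hh.1 hh.1.symm hh.2 hh.2.symm)
      (fun hh => i2 hh.1 hh.2 hh.1.symm hh.2.symm) (fun hh => i3 hh.1 hh.2 hh.2.symm hh.1.symm)
  obtain ⟨e, he⟩ : ∃ e, ∀ w, f w + f (w + u₀) = c₁ w + e := by
    refine ⟨f 0 + f u₀, four (fun w hw => ?_) ?_ ?_ ?_ ?_⟩
    · rw [add_right_comm, hfs, hfs, hw, hcs]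
    · rw [T.zero₁, zero_add, zero_add]
    · rw [B.add_self, T.u₀₁, zero_add, add_comm]
    · rw [T.u₁₁, add_comm u₁]
      exact (by decide : ∀ a b c d : ZMod 2, a + b + c + d = 1 → c + d = 1 + (a + b)) _ _ _ _ hodd
    · rw [e1, T.add₁, T.u₁₁, T.u₀₁]
      exact (by decide : ∀ a b c d : ZMod 2, a + b + c + d = 1 → d + c = 0 + 1 + (a + b))
        _ _ _ _ hodd
  obtain ⟨q, hq⟩ : ∃ q, ∀ w, bl (h (q, 0)) w = w + u₀ + (c₁ w + e) • s := by
    rcases zmod2_cases e with rfl | rfl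
    · exact ⟨q₀, by simpa using T.h₀⟩
    · refine ⟨q₀ + qs, fun w => ?_⟩
      rw [add_comm, H.bl_add, T.h₀, T.hs]
      module
  have hk := H.k_apply_two hq (fun w => by rw [hcu])
  have hoff : ∀ w, off (h (q, 0)) (w + s + u₀) + off (h (q, 0)) (w + u₀) = c₁ w + e := fun w => by
    rw [add_right_comm, H.off_add_s_two hf hfs hq, he, hcu]
  set g : B → ZMod 2 := fun w => c₁ w + e with hg
  have hgs : ∀ w, g (w + s) = g w := fun w => by simp only [hg, hcs]
  have hF : (fun w => off (h (q, 0)) (w + u₀) * (1 + g w)) ∈ shG A := hall fun w => by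
    have := hoff w
    simp only [hgs]
    change _ = g w at this
    exact (by decide : ∀ a b c : ZMod 2, a + b = c → a * (1 + c) = b * (1 + c)) _ _ _ this
  obtain ⟨κ, hκ, hκ0, hκ1⟩ : ∃ κ ∈ A, (∀ ω : Pt 2, g ω.1 = 0 → κ ω = ω) ∧
      ∀ ω : Pt 2, g ω.1 = 1 → (κ ω).1 = ω.1 + s := by
    refine ⟨_, mul_mem (H.k_mem q u₀) hF, fun ω hω => ?_, fun ω hω => ?_⟩
    · rw [Perm.mul_apply, sh_apply, hk]
      change c₁ ω.1 + e = 0 at hω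
      simp only [hg, hω, zero_smul, add_zero, mul_one]
      rw [add_assoc, CharTwo.add_self_eq_zero, add_zero]
    · rw [Perm.mul_apply, sh_apply, hk]
      change c₁ ω.1 + e = 1 at hω
      simp only [hω, one_smul]
  obtain ⟨κ', hκ', hκ0', hκ1'⟩ : ∃ κ ∈ A, (∀ ω : Pt 2, g ω.1 = 1 → κ ω = ω) ∧
      ∀ ω : Pt 2, g ω.1 = 0 → (κ ω).1 = ω.1 + s := by
    have hgu : ∀ w, g (u₁ + w) = g w + 1 := fun w => by
      simp only [hg, T.add₁, T.u₁₁]; ring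
    refine ⟨tr (u₁, 0) * κ * tr (u₁, 0), mul_mem (mul_mem (H.trmem _) hκ) (H.trmem _),
      fun ω hω => ?_, fun ω hω => ?_⟩
    · rw [Perm.mul_apply, Perm.mul_apply, hκ0 _ (by simp [hgu, hω, CharTwo.add_self_eq_zero]),
        ← Perm.mul_apply, tr_sq, Perm.one_apply]
    · rw [Perm.mul_apply, Perm.mul_apply, tr_apply]
      dsimp only
      rw [hκ1 _ (by simp [hgu, hω])]
      simp only [tr_apply]
      rw [add_assoc, ← add_assoc, B.add_self, zero_add]
  have hd := hall hcs
  rcases zmod2_cases e with rfl | rfl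
  · simp only [hg, add_zero] at hκ0 hκ1 hκ0' hκ1'
    exact H.good_of_local T hκ hκ' hκ0 hκ1 hκ0' hκ1' hd (fun w hw => hw) (fun w hw => hw)
  · have z : ∀ {a : ZMod 2}, a = 0 → a + 1 = 1 := by decide
    have z' : ∀ {a : ZMod 2}, a = 1 → a + 1 = 0 := by decide
    exact H.good_of_local T hκ' hκ (fun ω hω => hκ0' ω (z hω)) (fun ω hω => hκ1' ω (z' hω))
      (fun ω hω => hκ0 ω (z' hω)) (fun ω hω => hκ1 ω (z hω)) hd (fun w hw => hw) (fun w hw => hw)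

end Inv

theorem good_of_eq_two (H : Core A h t) : Good A h := by
  obtain ⟨a, ha, s, hs, qs, hqs⟩ := H.exists_common_block
  replace H := H.conj ha
  refine Good.of_cj ha ?_
  generalize cj a h = h at H hqs
  generalize (fun w => mu a (bl a⁻¹ w) * t (bl a⁻¹ w)) = t at H
  have common : ∀ {t h}, Core A h t → (∀ w, bl (h (qs, 0)) w = w + s) →
      ∀ γ, h γ = tr (s, 0) → Good A h := fun H hqs γ hγ =>
    Good.mono inf_le_left ((H.cent hγ).good_two_of_commWith inf_le_right hs hqs)
  by_cases hc : ∃ c ∈ shG A, ∃ w, c (w + s) ≠ c w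
  · obtain ⟨c, hc, hcv⟩ := hc
    obtain ⟨b, hb, hbb, hγ⟩ := H.conj_tr_of_half hqs hc hcv
    exact Good.of_cj hb (common (H.conj hb)
      (fun w => by rw [H.bl_cj_of_trivial hb hbb, hqs]) (qs, 0) hγ)
  push Not at hc
  have hkA := H.k_mem qs s
  have hkb : ∀ w, bl (h (qs, 0) * tr (s, 0)) w = w := fun w => by rw [H.bl_k, hqs, B.add_add_self]
  obtain ⟨f, hfm, hk⟩ : ∃ f ∈ shG A, h (qs, 0) * tr (s, 0) = sh f := by
    have := aff_eq_sh (H.aff hkA) hkb fun w => zmod2_eq_one rfl (mu_ne_zero (H.aff hkA) w)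
    exact ⟨_, by rw [mem_shG, ← this]; exact hkA, this⟩
  have hfs := hc f hfm
  have hh : h (qs, 0) = sh f * tr (s, 0) := by
    rw [← hk, mul_assoc, tr_sq, mul_one]
  have hf : ∀ v x, h (qs, 0) (v, x) = (v + s, x + f v) := fun v x => by
    rw [hh, Perm.mul_apply, tr_apply, sh_apply]
    simp [add_comm s, hfs]
  by_cases hfc : ∃ w, f w ≠ f 0
  swap
  · push Not at hfc
    refine common H hqs (qs, f 0) ?_
    rw [H.h_eq]
    ext1 ⟨v, x⟩
    rw [Perm.mul_apply, sh_apply, hf, H.t_two, tr_apply]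
    refine Prod.ext (add_comm _ _) ?_
    simp only [hfc v, Pi.smul_apply, smul_eq_mul, mul_one, zero_add]
    rw [add_assoc, CharTwo.add_self_eq_zero, add_zero]
  by_cases hS : ∀ w, (∀ v, f (v + w) = f v) → w = 0 ∨ w = s
  · obtain ⟨u₀, h0, h0s⟩ := B.exists_ne_two s
    obtain ⟨u₁, hv⟩ := B.exists_ne s u₀
    obtain ⟨c₀, c₁, C⟩ := exists_coord hs h0 h0s hv
    rcases H.good_or_twisted hqs C with hg | ⟨q₀, q₁, T⟩
    · exact hg
    exact H.good_two_of_not_inv T hf hfs hc hS hfm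
  · push Not at hS
    obtain ⟨u₀, hu, h0, h0s⟩ := hS
    obtain ⟨u₁, hv⟩ := B.exists_ne s u₀
    obtain ⟨c₀, c₁, C⟩ := exists_coord hs h0 h0s hv
    rcases H.good_or_twisted hqs C with hg | ⟨q₀, q₁, T⟩
    · exact hg
    exact H.good_two_of_inv T hfm hf hfs hu hfc

end Core

end

section

/-- Once a generator of the cyclic factor acts as a shift, the situation is affine. -/
theorem core_of_sh {p : ℕ} [Fact p.Prime] {A : Subgroup (Perm (Pt p))} {h : Pt p → Perm (Pt p)}
    {t : B → ZMod p} (hA : Closed3 A) (htr : ∀ γ, tr γ ∈ A) (hh : IsReg h) (hhA : ∀ γ, h γ ∈ A)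
    (h01 : h (0, 1) = sh t) : Core (A ⊓ AffG p) h t := by
  have t_ne : ∀ v, t v ≠ 0 := fun v hv => by
    have := hh.free (0, 1) (v, 0) (by rw [h01]; simp [hv])
    exact one_ne_zero (congrArg Prod.snd this)
  exact
    { closed := hA.inf closed3_affG
      aff := inf_le_right
      trmem := fun γ => ⟨htr γ, tr_mem_affG γ⟩
      reg := hh
      hmem := fun γ => ⟨hhA γ, mem_affG_of_comm t_ne (by rw [← h01]; exact hh.comm _ _)⟩
      h01 := h01
      t_ne := t_ne }

section Two

theorem exists_dual_two (y : Pt 2) (hy : y ≠ 0) :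
    ∃ f : Pt 2 →ₗ[ZMod 2] ZMod 2, f (0, 1) = 1 ∧ f y = 1 := by
  have key : ∀ y : Pt 2, y ≠ 0 → ∃ c : B,
      c.1 * y.1.1 + c.2.1 * y.1.2.1 + c.2.2 * y.1.2.2 + y.2 = 1 := by decide
  obtain ⟨c, hc⟩ := key y hy
  refine ⟨{ toFun := fun y => c.1 * y.1.1 + c.2.1 * y.1.2.1 + c.2.2 * y.1.2.2 + y.2
            map_add' := fun x y => ?_
            map_smul' := fun r x => ?_ }, ?_, hc⟩
  · simp only [Prod.fst_add, Prod.snd_add]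
    ring
  · simp only [Prod.smul_fst, Prod.smul_snd, smul_eq_mul, RingHom.id_apply]
    ring
  · simp

theorem exists_auto_two (y : Pt 2) (hy : y ≠ 0) : ∃ e : Pt 2 ≃+ Pt 2, e (0, 1) = y := by
  obtain ⟨f, h1, h2⟩ := exists_dual_two y hy
  have two : ∀ w : Pt 2, w + w = 0 := fun w => Prod.ext (B.add_self _) (CharTwo.add_self_eq_zero _)
  have hf : f ((0, 1) + y) = 0 := by rw [map_add, h1, h2]; rfl
  have inv : Function.Involutive fun w : Pt 2 => w + f w • ((0, 1) + y) := fun w => by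
    simp only [map_add f, map_smul, smul_eq_mul] at hf ⊢
    rw [hf, mul_zero, add_zero, add_assoc, two, add_zero]
  refine ⟨{ toFun := fun w => w + f w • ((0, 1) + y)
            invFun := fun w => w + f w • ((0, 1) + y)
            left_inv := inv
            right_inv := inv
            map_add' := fun a b => ?_ }, ?_⟩
  · simp only [map_add f, add_smul]
    abel
  · show (0, 1) + f (0, 1) • ((0, 1) + y) = y
    rw [h1, one_smul, ← add_assoc, two, zero_add]

theorem Closed3.comap {Ω : Type*} {A : Subgroup (Perm Ω)} (hA : Closed3 A) (φ : Perm Ω) :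
    Closed3 (A.comap (MulAut.conj φ).toMonoidHom) := by
  intro σ hσ
  refine hA _ fun u v w => ?_
  obtain ⟨a, ha, h1, h2, h3⟩ := hσ (φ⁻¹ u) (φ⁻¹ v) (φ⁻¹ w)
  refine ⟨φ * a * φ⁻¹, ha, ?_⟩
  simp only [MulEquiv.toMonoidHom_eq_coe, MonoidHom.coe_coe, MulAut.conj_apply, Perm.mul_apply,
    h1, h2, h3, and_self]

theorem good_two {A : Subgroup (Perm (Pt 2))} {h : Pt 2 → Perm (Pt 2)}
    (hA : Closed3 A) (htr : ∀ γ, tr γ ∈ A) (hh : IsReg h) (hhA : ∀ γ, h γ ∈ A) : Good A h := by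
  have htor : ∀ γ : Pt 2, 2 • γ = 0 := fun w => by
    rw [two_nsmul]
    exact Prod.ext (B.add_self _) (CharTwo.add_self_eq_zero _)
  obtain ⟨R, hR, hRm⟩ := exists_pgroup 2 (tr (p := 2)) isReg_tr.map_add htor
  obtain ⟨R', hR', hRm'⟩ := exists_pgroup 2 h hh.map_add htor
  obtain ⟨a, ha, P, hPA, hP, hRP, haP⟩ := sylow_conj 2 hR hR'
    (fun σ hσ => by obtain ⟨γ, rfl⟩ := (hRm σ).1 hσ; exact htr γ)
    (fun σ hσ => by obtain ⟨γ, rfl⟩ := (hRm' σ).1 hσ; exact hhA γ)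
  obtain ⟨γ, γ', hγ, hγ', e⟩ := common_element hP (isReg_tr (p := 2)) (hh.conj a)
    (fun γ => hRP ((hRm _).2 ⟨γ, rfl⟩)) (fun γ => haP _ ((hRm' _).2 ⟨γ, rfl⟩))
  refine Good.of_cj ha ?_
  have hcA : ∀ γ, cj a h γ ∈ A := fun γ => mul_mem (mul_mem ha (hhA γ)) (inv_mem ha)
  have hcr : IsReg (cj a h) := hh.conj a
  change tr γ = cj a h γ' at e
  generalize cj a h = h at *
  obtain ⟨φ, hφ⟩ := exists_auto_two γ hγ
  obtain ⟨φ', hφ'⟩ := exists_auto_two γ' hγ'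
  refine Good.of_comp φ' ?_
  let Φ : Perm (Pt 2) := φ.toEquiv
  have hΦ : ∀ δ, Φ * tr δ * Φ⁻¹ = tr (φ δ) := fun δ => by
    rw [mul_inv_eq_iff_eq_mul]
    ext1 w
    exact map_add φ δ w
  have C : Core _ (fun γ => Φ⁻¹ * h (φ' γ) * Φ⁻¹⁻¹) fun _ => 1 :=
    core_of_sh (hA.comap Φ) (fun δ => by
        change Φ * tr δ * Φ⁻¹ ∈ A
        rw [hΦ]
        exact htr _)
      ((hcr.comp φ').conj Φ⁻¹) (fun δ => by
        change Φ * (Φ⁻¹ * h (φ' δ) * Φ⁻¹⁻¹) * Φ⁻¹ ∈ A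
        have : Φ * (Φ⁻¹ * h (φ' δ) * Φ⁻¹⁻¹) * Φ⁻¹ = h (φ' δ) := by group
        rw [this]
        exact hcA _)
      (by
        rw [hφ', ← e, ← hφ, ← hΦ, ← tr_snd]
        group)
  obtain ⟨b, hb, hbγ⟩ := C.good_of_eq_two
  refine ⟨Φ * b * Φ⁻¹, hb.1, fun δ => ?_⟩
  obtain ⟨δ', hδ'⟩ := hbγ δ
  refine ⟨φ δ', ?_⟩
  rw [← hΦ, ← hδ']
  group

end Two

end

section

/-- A permutation that commutes with a fixed-point-free shift and preserves its orbits is a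
shift. -/
theorem exists_eq_sh {p : ℕ} [Fact p.Prime] {t : B → ZMod p} (ht : ∀ v, t v ≠ 0)
    {g : Perm (Pt p)} (hg : g * sh t = sh t * g) (hb : ∀ ω, ∃ i : ℕ, g ω = (sh t ^ i) ω) :
    ∃ c, g = sh c := by
  have hA := mem_affG_of_comm ht hg
  have hbl : ∀ v, bl g v = v := fun v => by
    obtain ⟨i, hi⟩ := hb (v, 0)
    rw [bl, hi, ← sh_nsmul]
    rfl
  refine ⟨_, aff_eq_sh hA hbl fun v => ?_⟩
  have := mu_mul_of_comm hA hg v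
  rw [hbl] at this
  exact mul_right_cancel₀ (ht v) (this.trans (one_mul _).symm)

theorem sh_pow_apply {p : ℕ} (t : B → ZMod p) (i : ℕ) (ω : Pt p) :
    (sh t ^ i) ω = (ω.1, ω.2 + i * t ω.1) := by
  rw [← sh_nsmul, sh_apply, Pi.smul_apply, nsmul_eq_mul]

theorem exists_pow_sh {p : ℕ} [Fact p.Prime] {t : B → ZMod p} (ht : ∀ v, t v ≠ 0) (v : B)
    (x y : ZMod p) : ∃ i : ℕ, (v, y) = (sh t ^ i) (v, x) := by
  refine ⟨((y - x) / t v).val, ?_⟩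
  rw [sh_pow_apply, ZMod.natCast_val, ZMod.cast_id', id, div_mul_cancel₀ _ (ht v)]
  simp

theorem exists_eq_sh_of_orbit_le {p : ℕ} [Fact p.Prime] {P : Subgroup (Perm (Pt p))}
    (hP : IsPGroup p P)
    (horb : ∀ x, ∃ O : Set (Pt p), x ∈ O ∧ O.ncard ≤ p ∧ ∀ r ∈ P, ∀ y ∈ O, r y ∈ O)
    {t : B → ZMod p} (ht : ∀ v, t v ≠ 0) (htP : sh t ∈ P) {g : Perm (Pt p)} (hg : g ∈ P) :
    ∃ c, g = sh c := by
  refine exists_eq_sh ht (comm_of_orbit_le p hP horb hg htP) fun ω => ?_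
  obtain ⟨O, hωO, hOc, hO⟩ := horb ω
  have hsub : Set.range (fun x : ZMod p => ((ω.1, x) : Pt p)) ⊆ O := by
    rintro _ ⟨x, rfl⟩
    obtain ⟨i, hi⟩ := exists_pow_sh ht ω.1 ω.2 x
    show (ω.1, x) ∈ O
    rw [hi]
    exact hO _ (pow_mem htP i) _ hωO
  have hcard : (Set.range (fun x : ZMod p => ((ω.1, x) : Pt p))).ncard = p := by
    rw [Set.ncard_range_of_injective (fun x y h => congrArg Prod.snd h), Nat.card_zmod]
  have heq := Set.eq_of_subset_of_ncard_le hsub (by rw [hcard]; exact hOc) (Set.toFinite O)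
  have := hO g hg ω hωO
  rw [← heq] at this
  obtain ⟨x, hx⟩ := this
  obtain ⟨i, hi⟩ := exists_pow_sh ht ω.1 ω.2 x
  exact ⟨i, by rw [← hi, ← hx]⟩

/-- Orbits of a `p`-group in fewer than `p ^ 2` points. -/
theorem exists_orbit_le {Ω : Type*} [Finite Ω] (p : ℕ) [hp : Fact p.Prime]
    {P : Subgroup (Perm Ω)} (hP : IsPGroup p P) (hΩ : Nat.card Ω < p ^ 2) (x : Ω) :
    ∃ O : Set Ω, x ∈ O ∧ O.ncard ≤ p ∧ ∀ r ∈ P, ∀ y ∈ O, r y ∈ O := by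
  refine ⟨MulAction.orbit P x, MulAction.mem_orbit_self x, ?_, fun r hr y hy => ?_⟩
  · obtain ⟨n, hn⟩ := hP.card_orbit x
    rw [Nat.card_coe_set_eq] at hn
    have h2 : p ^ n < p ^ 2 := by
      rw [← hn]
      exact (Set.ncard_le_card _).trans_lt hΩ
    have h3 := (Nat.pow_lt_pow_iff_right hp.out.one_lt).1 h2
    rw [hn]
    exact (Nat.pow_le_pow_right hp.out.pos (by omega : n ≤ 1)).trans (pow_one p).le
  · obtain ⟨s, rfl⟩ := hy
    exact ⟨⟨r, hr⟩ * s, rfl⟩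

theorem zpowers_pgroup {Ω : Type*} {p : ℕ} {g : Perm Ω} (hg : g ^ p = 1) :
    IsPGroup p (Subgroup.zpowers g) := by
  rintro ⟨_, i, rfl⟩
  refine ⟨1, Subtype.ext ?_⟩
  show (g ^ i) ^ p ^ 1 = 1
  rw [pow_one, ← zpow_natCast, ← zpow_mul, mul_comm, zpow_mul, zpow_natCast, hg, one_zpow]

theorem sh_pow_prime {p : ℕ} (c : B → ZMod p) : sh c ^ p = 1 := by
  rw [← sh_nsmul, ← sh_zero]
  congr 1
  ext v
  simp

theorem card_pt (p : ℕ) : Nat.card (Pt p) = 8 * p := by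
  simp [Nat.card_prod, Nat.card_zmod]

/-- For large primes the two cyclic factors can be aligned. -/
theorem exists_conj_sh_of_large {p : ℕ} [Fact p.Prime] (hp : 8 < p)
    {A : Subgroup (Perm (Pt p))} (h1 : sh (fun _ => 1) ∈ A) {z : Perm (Pt p)} (hz : z ∈ A)
    (hzp : z ^ p = 1) : ∃ a ∈ A, ∃ c, a * z * a⁻¹ = sh c := by
  obtain ⟨a, ha, P, -, hP, hRP, hzP⟩ := sylow_conj p (zpowers_pgroup (sh_pow_prime (p := p) _))
    (zpowers_pgroup hzp) ((Subgroup.zpowers_le).2 h1) ((Subgroup.zpowers_le).2 hz)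
  refine ⟨a, ha, exists_eq_sh_of_orbit_le hP (exists_orbit_le p hP ?_) (t := fun _ => 1)
    (fun _ => one_ne_zero) (hRP (Subgroup.mem_zpowers _)) (hzP _ (Subgroup.mem_zpowers _))⟩
  rw [card_pt, pow_two]
  exact Nat.mul_lt_mul_of_pos_right hp (by omega)

end

section

section Normalizer
variable {p : ℕ}

/-- The group of all shifts. -/
def shT (p : ℕ) : Subgroup (Perm (Pt p)) where
  carrier := Set.range sh
  mul_mem' := by
    rintro _ _ ⟨c, rfl⟩ ⟨d, rfl⟩
    exact ⟨c + d, sh_add c d⟩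
  one_mem' := ⟨0, sh_zero⟩
  inv_mem' := by
    rintro _ ⟨c, rfl⟩
    exact ⟨-c, sh_neg c⟩

theorem isPGroup_shT : IsPGroup p (shT p) := by
  rintro ⟨_, c, rfl⟩
  exact ⟨1, Subtype.ext (by rw [pow_one]; exact sh_pow_prime c)⟩

/-- The elements of `A` normalising the shifts contained in `A`. -/
def nrm (A : Subgroup (Perm (Pt p))) : Subgroup (Perm (Pt p)) :=
  A ⊓ Subgroup.normalizer (A ⊓ shT p : Subgroup (Perm (Pt p)))

variable {A : Subgroup (Perm (Pt p))} {σ : Perm (Pt p)}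

theorem nrm_conj (hσ : σ ∈ nrm A) {c : B → ZMod p} (hc : c ∈ shG A) :
    ∃ d ∈ shG A, σ * sh c = sh d * σ := by
  obtain ⟨h1, d, hd⟩ := ((Subgroup.mem_normalizer_iff.1 hσ.2) (sh c)).1 ⟨hc, c, rfl⟩
  refine ⟨d, ?_, ?_⟩
  · rw [mem_shG, hd]
    exact h1
  · rw [hd]
    group

theorem nrm_aff [Fact p.Prime] (h1 : (fun _ => 1) ∈ shG A) (hσ : σ ∈ nrm A) : σ ∈ AffG p := by
  obtain ⟨d, -, hd⟩ := nrm_conj hσ h1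
  refine mem_affG_of_conj (t := fun _ => 1) (fun _ => one_ne_zero) (fun v hv => ?_) hd
  have h2 := congrArg (fun f : Perm (Pt p) => f (σ⁻¹ (v, 0))) hd
  simp only [Perm.mul_apply, app_inv] at h2
  rw [show sh d (v, 0) = (v, 0) by simp [hv], ← Perm.eq_inv_iff_eq] at h2
  have := congrArg Prod.snd h2
  rw [sh_apply] at this
  exact one_ne_zero (add_eq_left.1 this)

theorem conj_sh_or_exists_nrm [Fact p.Prime] {z : Perm (Pt p)} (hz : z ∈ A) (hzp : z ^ p = 1) :
    (∃ a ∈ A, ∃ c, a * z * a⁻¹ = sh c) ∨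
      ∃ n ∈ nrm A, n ∉ shT p ∧ ∃ k : ℕ, n ^ p ^ k = 1 := by
  obtain ⟨a, ha, P, hPA, hP, hRP, hzP⟩ := sylow_conj p
    (isPGroup_shT.to_le inf_le_right : IsPGroup p (A ⊓ shT p : Subgroup (Perm (Pt p))))
    (zpowers_pgroup hzp) inf_le_left ((Subgroup.zpowers_le).2 hz)
  by_cases hPT : P ≤ shT p
  · obtain ⟨c, hc⟩ := hPT (hzP _ (Subgroup.mem_zpowers _))
    exact Or.inl ⟨a, ha, c, hc.symm⟩
  right
  have := hP.isNilpotent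
  have hlt : (A ⊓ shT p).subgroupOf P < ⊤ := by
    rw [lt_top_iff_ne_top, Ne, Subgroup.subgroupOf_eq_top]
    exact fun h => hPT (h.trans inf_le_right)
  have hN := Group.normalizerCondition_of_isNilpotent _ hlt
  obtain ⟨n, hn, hn'⟩ := SetLike.exists_of_lt hN
  have hnT : n.1 ∉ shT p := fun h => hn' ⟨hPA n.2, h⟩
  rw [Subgroup.mem_normalizer_iff] at hn
  refine ⟨n, ⟨hPA n.2, Subgroup.mem_normalizer_iff.2 fun τ => ?_⟩, hnT, ?_⟩
  · constructor
    · intro hτ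
      exact (hn ⟨τ, hRP hτ⟩).1 hτ
    · intro hτ
      have h3 : n.1⁻¹ * (n.1 * τ * n.1⁻¹) * n.1 ∈ P :=
        mul_mem (mul_mem (inv_mem n.2) (hRP hτ)) n.2
      have h4 : n.1⁻¹ * (n.1 * τ * n.1⁻¹) * n.1 = τ := by group
      rw [h4] at h3
      exact (hn ⟨τ, h3⟩).2 hτ
  · obtain ⟨k, hk⟩ := hP n
    exact ⟨k, congrArg Subtype.val hk⟩

end Normalizer

end

section

section Counting
variable {α : Type*} [Finite α] {p : ℕ} [Fact p.Prime] {y : Perm α} {k : ℕ}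

theorem isPGroup_zpowers (hy : y ^ p ^ k = 1) : IsPGroup p (Subgroup.zpowers y) := by
  rintro ⟨_, i, rfl⟩
  refine ⟨k, Subtype.ext ?_⟩
  show (y ^ i) ^ p ^ k = 1
  rw [← zpow_natCast, ← zpow_mul, mul_comm, zpow_mul, zpow_natCast, hy, one_zpow]

theorem card_modEq_ncard_fixed (hy : y ^ p ^ k = 1) :
    Nat.card α ≡ {x | y x = x}.ncard [MOD p] := by
  have h := (isPGroup_zpowers hy).card_modEq_card_fixedPoints α
  rw [Nat.card_coe_set_eq] at h
  convert h using 3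
  ext x
  constructor
  · rintro hx ⟨_, i, rfl⟩
    exact Function.IsFixedPt.perm_zpow hx i
  · intro hx
    exact hx ⟨y, Subgroup.mem_zpowers y⟩

theorem le_ncard_of_moved (hy : y ^ p ^ k = 1) {x : α} (hx : y x ≠ x) {W : Set α}
    (hW : ∀ w ∈ W, y w ∈ W) (hxW : x ∈ W) : p ≤ W.ncard := by
  have hpow : ∀ i : ℕ, ∀ w ∈ W, (y ^ i) w ∈ W := by
    intro i
    induction i with
    | zero => exact fun w hw => hw
    | succ i ih => exact fun w hw => by rw [pow_succ]; exact ih _ (hW w hw)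
  obtain ⟨j, hj⟩ := (isPGroup_zpowers hy).card_orbit x
  rw [Nat.card_coe_set_eq] at hj
  have hsub : MulAction.orbit (Subgroup.zpowers y) x ⊆ W := by
    rintro _ ⟨⟨g, hg⟩, rfl⟩
    obtain ⟨i, rfl⟩ := mem_powers_iff_mem_zpowers.2 hg
    exact hpow i x hxW
  refine le_trans ?_ (Set.ncard_le_ncard hsub (Set.toFinite W))
  rw [hj]
  rcases j with _ | j
  · rw [pow_zero, Set.ncard_eq_one] at hj
    obtain ⟨a, ha⟩ := hj
    have h1 : x ∈ MulAction.orbit (Subgroup.zpowers y) x := MulAction.mem_orbit_self x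
    have h2 : y x ∈ MulAction.orbit (Subgroup.zpowers y) x :=
      ⟨⟨y, Subgroup.mem_zpowers y⟩, rfl⟩
    rw [ha] at h1 h2
    exact absurd (h2.trans h1.symm) hx
  · exact Nat.le_self_pow (Nat.succ_ne_zero j) p

end Counting

instance fact_prime_seven : Fact (Nat.Prime 7) := ⟨by norm_num⟩
instance fact_prime_five : Fact (Nat.Prime 5) := ⟨by norm_num⟩

theorem card_B : Nat.card B = 8 := by simp

/-- A group acting on eight points that contains the translations and acts nontrivially through
a 5-element has order divisible by 7. -/
theorem seven_dvd_card {N : Type*} [Group N] [Finite N] [MulAction N B]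
    (htr : ∀ v : B, ∃ g : N, ∀ w : B, g • w = w + v) (n : N) (k : ℕ) (hn : n ^ 5 ^ k = 1)
    (hn1 : ∃ w : B, n • w ≠ w) : 7 ∣ Nat.card N := by
  have hy : ∀ g : N, g ^ 5 ^ k = 1 → (MulAction.toPermHom N B g) ^ 5 ^ k = 1 := fun g hg => by
    rw [← map_pow, hg, map_one]
  let F : Set B := {w | n • w = w}
  have hF1 : Nat.card B ≡ F.ncard [MOD 5] := card_modEq_ncard_fixed (hy n hn)
  have hF2 : F.ncard < 8 := by
    rw [← card_B, ← Set.ncard_univ]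
    refine Set.ncard_lt_ncard (Set.ssubset_univ_iff.2 fun h => ?_) (Set.toFinite _)
    obtain ⟨w, hw⟩ := hn1
    exact hw (h ▸ Set.mem_univ w : w ∈ F)
  have hF : F.ncard = 3 := by
    rw [card_B] at hF1
    have : F.ncard % 5 = 3 := hF1.symm
    omega
  have hmove : ∀ w : B, w ≠ 0 → ∃ g ∈ MulAction.stabilizer N (0 : B), g ^ 5 ^ k = 1 ∧ g • w ≠ w := by
    intro w hw
    obtain ⟨f, hf, hfw⟩ : ∃ f ∈ F, f + w ∉ F := by
      by_contra! hall
      let τ : Perm F :=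
        { toFun := fun f => ⟨f.1 + w, hall _ f.2⟩
          invFun := fun f => ⟨f.1 + w, hall _ f.2⟩
          left_inv := fun f => Subtype.ext (B.add_add_self _ _)
          right_inv := fun f => Subtype.ext (B.add_add_self _ _) }
      have hτ : τ ^ 2 ^ 1 = 1 := by
        ext1 f
        exact Subtype.ext (B.add_add_self _ _)
      have hmod := card_modEq_ncard_fixed hτ
      rw [Nat.card_coe_set_eq, hF] at hmod
      have hempty : {x | τ x = x} = ∅ := by
        ext f
        simp only [Set.mem_ofPred_eq, Set.mem_empty_iff_false, iff_false]
        intro h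
        exact hw (add_eq_left.1 (congrArg Subtype.val h))
      rw [hempty, Set.ncard_empty] at hmod
      exact absurd hmod (by decide)
    obtain ⟨g, hg⟩ := htr f
    refine ⟨g⁻¹ * n * g, ?_, ?_, ?_⟩
    · rw [MulAction.mem_stabilizer_iff, mul_smul, mul_smul, hg, zero_add, hf, inv_smul_eq_iff, hg,
        zero_add]
    · have := conj_pow (i := 5 ^ k) (a := g⁻¹) (b := n)
      rw [inv_inv, hn] at this
      rw [this]
      group
    · rw [mul_smul, mul_smul, hg, Ne, inv_smul_eq_iff, hg, add_comm w f]
      exact hfw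
  have horb : ∀ w : B, w ≠ 0 → 5 ≤ (MulAction.orbit (MulAction.stabilizer N (0 : B)) w).ncard := by
    intro w hw
    obtain ⟨g, hg, hgk, hgw⟩ := hmove w hw
    refine le_ncard_of_moved (hy g hgk) (x := w) hgw ?_ (MulAction.mem_orbit_self w)
    rintro _ ⟨s, rfl⟩
    exact ⟨⟨g, hg⟩ * s, mul_smul _ _ _⟩
  have hz : ∀ w : B, w ≠ 0 → MulAction.orbit (MulAction.stabilizer N (0 : B)) w ⊆ {0}ᶜ := by
    rintro w hw _ ⟨⟨g, hg⟩, rfl⟩ h0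
    apply hw
    have h1 : g • w = 0 := h0
    rw [← MulAction.mem_stabilizer_iff.1 (inv_mem hg), ← h1, inv_smul_smul]
  have hc : ({0}ᶜ : Set B).ncard = 7 := by
    rw [Set.ncard_compl, card_B, Set.ncard_singleton]
  have hne : ((1, 0, 0) : B) ≠ 0 := by decide
  have hall : MulAction.orbit (MulAction.stabilizer N (0 : B)) ((1, 0, 0) : B) = {0}ᶜ := by
    refine (hz _ hne).antisymm fun w hw => ?_
    by_contra hwo
    have hdis : Disjoint (MulAction.orbit (MulAction.stabilizer N (0 : B)) ((1, 0, 0) : B))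
        (MulAction.orbit (MulAction.stabilizer N (0 : B)) w) := by
      rw [Set.disjoint_iff_forall_ne]
      rintro a ha _ hb rfl
      rw [← MulAction.orbit_eq_iff] at ha hb
      exact hwo (by rw [← ha, hb]; exact MulAction.mem_orbit_self w)
    have h1 := Set.ncard_union_eq hdis (Set.toFinite _) (Set.toFinite _)
    have h2 := Set.ncard_le_ncard (Set.union_subset (hz _ hne) (hz w hw)) (Set.toFinite _)
    have h3 := horb _ hne
    have h4 := horb w hw
    rw [hc] at h2
    omega
  have hcard := MulAction.index_stabilizer (MulAction.stabilizer N (0 : B)) ((1, 0, 0) : B)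
  rw [hall, hc] at hcard
  rw [← hcard]
  exact (Subgroup.index_dvd_card _).trans (Subgroup.card_subgroup_dvd_card _)

end

section

theorem tr_mem_nrm {p : ℕ} {A : Subgroup (Perm (Pt p))} (htr : ∀ γ, tr γ ∈ A) (v : B) :
    tr (v, 0) ∈ nrm A := by
  have hc : ∀ v : B, ∀ τ ∈ A ⊓ shT p, tr (v, 0) * τ * (tr (v, 0))⁻¹ ∈ A ⊓ shT p := by
    rintro v _ ⟨h1, c, rfl⟩
    refine Subgroup.mem_inf.2 ⟨A.mul_mem (A.mul_mem (htr _) h1) (A.inv_mem (htr _)), ?_⟩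
    rw [tr_sh_conj]
    exact ⟨_, rfl⟩
  refine ⟨htr _, Subgroup.mem_normalizer_iff.2 fun τ => ⟨hc v τ, fun h => ?_⟩⟩
  have h2 := hc v _ h
  have h3 : tr ((v, 0) : Pt p) * tr (v, 0) = 1 :=
    isReg_tr.mul_self (Prod.ext (B.add_self v) (add_zero _))
  have h4 : tr ((v, 0) : Pt p) * (tr (v, 0) * τ * (tr (v, 0))⁻¹) * (tr (v, 0))⁻¹ = τ := by
    rw [← eq_inv_iff_mul_eq_one] at h3
    nth_rewrite 1 [h3]
    nth_rewrite 3 [h3]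
    group
  rwa [h4] at h2

section Blocks
variable {p : ℕ} [Fact p.Prime] {σ : Perm (Pt p)}

theorem pow_of_bl_eq (hσ : σ ∈ AffG p) {v : B} (hv : bl σ v = v) (m : ℕ) :
    bl (σ ^ m) v = v ∧ mu (σ ^ m) v = mu σ v ^ m := by
  induction m with
  | zero => exact ⟨rfl, by simp⟩
  | succ m ih =>
    rw [pow_succ, bl_mul (pow_mem hσ m) hσ, mu_mul (pow_mem hσ m) hσ, hv, ih.1, ih.2, pow_succ]
    exact ⟨rfl, rfl⟩

theorem off_pow_of_bl_eq (hσ : σ ∈ AffG p) {v : B} (hv : bl σ v = v) (hm : mu σ v = 1) (m : ℕ) :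
    off (σ ^ m) v = m * off σ v := by
  induction m with
  | zero => simp [off]
  | succ m ih =>
    rw [pow_succ, off_mul (pow_mem hσ m) hσ, hv, ih, (pow_of_bl_eq hσ hv m).2, hm]
    push_cast
    ring

theorem aff_sh_conj_ne (hσ : σ ∈ AffG p) {c : B → ZMod p} (hc : ∀ v, c v ≠ 0) :
    ∃ d, (∀ v, d v ≠ 0) ∧ sh d = σ * sh c * σ⁻¹ :=
  ⟨_, fun _ => mul_ne_zero (mu_ne_zero hσ _) (hc _), (aff_sh_conj hσ c).symm⟩

end Blocks

/-- An affine permutation of order 7 commutes with some nowhere vanishing shift. -/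
theorem exists_sh_comm {σ : Perm (Pt 5)} (hσ : σ ∈ AffG 5) (h7 : σ ^ 7 = 1) :
    ∃ t : B → ZMod 5, (∀ v, t v ≠ 0) ∧ σ * sh t = sh t * σ := by
  let X := {τ : Perm (Pt 5) // ∃ c : B → ZMod 5, (∀ v, c v ≠ 0) ∧ sh c = τ}
  let π : Perm X := Perm.subtypePerm (MulAut.conj σ).toEquiv fun τ => by
    constructor
    · rintro ⟨c, hc, h⟩
      obtain ⟨d, hd, h'⟩ := aff_sh_conj_ne (inv_mem hσ) hc
      refine ⟨d, hd, ?_⟩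
      rw [h', h]
      show σ⁻¹ * (σ * τ * σ⁻¹) * σ⁻¹⁻¹ = τ
      group
    · rintro ⟨c, hc, rfl⟩
      exact aff_sh_conj_ne hσ hc
  have hπ' : ∀ (i : ℕ) (x : X), ((π ^ i) x).1 = σ ^ i * x.1 * (σ ^ i)⁻¹ := by
    intro i x
    induction i with
    | zero => simp
    | succ i ih =>
      rw [pow_succ' π, Perm.mul_apply]
      show σ * ((π ^ i) x).1 * σ⁻¹ = _
      rw [ih, pow_succ' σ]
      group
  have hπ : π ^ 7 ^ 1 = 1 := by
    ext1 x
    exact Subtype.ext (by rw [pow_one, hπ', h7]; simp)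
  have hX : Nat.card X = 4 ^ 8 := by
    let e : (B → {x : ZMod 5 // x ≠ 0}) ≃ X := Equiv.ofBijective
      (fun c => ⟨sh fun v => (c v).1, _, fun v => (c v).2, rfl⟩)
      ⟨fun c d h => by
          have h' : sh (fun v => (c v).1) = sh fun v => (d v).1 := congrArg Subtype.val h
          have h'' := sh_injective h'
          exact funext fun v => Subtype.ext (congrFun h'' v),
        fun ⟨τ, c, hc, h⟩ => ⟨fun v => ⟨c v, hc v⟩, Subtype.ext h⟩⟩
    rw [← Nat.card_congr e, Nat.card_fun, card_B, Nat.card_eq_fintype_card]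
    rfl
  have hmod := card_modEq_ncard_fixed hπ
  rw [hX] at hmod
  obtain ⟨⟨_, t, ht, rfl⟩, hx⟩ : {x | π x = x}.Nonempty := by
    rw [Set.nonempty_iff_ne_empty]
    intro h
    rw [h, Set.ncard_empty] at hmod
    exact absurd hmod (by decide)
  have h1 : σ * sh t * σ⁻¹ = sh t := congrArg Subtype.val hx
  exact ⟨t, ht, mul_inv_eq_iff_eq_mul.1 h1⟩

/-- If all elements of order a power of 5 are not accounted for by shifts, there is a fixed-point
free shift commuting with an element of order 7. -/
theorem exists_seven {A : Subgroup (Perm (Pt 5))} (hA : Closed3 A) (htr : ∀ γ, tr γ ∈ A)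
    {n : Perm (Pt 5)} (hn : n ∈ nrm A) (hnT : n ∉ shT 5) {k : ℕ} (hk : n ^ 5 ^ k = 1) :
    ∃ t : B → ZMod 5, ∃ σ ∈ A, (∀ v, t v ≠ 0) ∧ sh t ∈ A ∧ σ ^ 7 = 1 ∧ σ * sh t = sh t * σ ∧
      {ω | σ ω = ω}.ncard = 5 := by
  have h1 : (fun _ => 1) ∈ shG A := by
    rw [mem_shG, ← tr_snd]
    exact htr _
  have haff : ∀ σ ∈ nrm A, σ ∈ AffG 5 := fun σ hσ => nrm_aff h1 hσ
  let _ : MulAction (nrm A) B :=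
    { smul := fun σ v => bl σ.1 v
      one_smul := bl_one
      mul_smul := fun σ τ v => bl_mul (haff _ σ.2) (haff _ τ.2) v }
  have hdvd : 7 ∣ Nat.card (nrm A) := by
    refine seven_dvd_card (fun v => ⟨⟨tr (v, 0), tr_mem_nrm htr v⟩, bl_tr _⟩) ⟨n, hn⟩ k
      (Subtype.ext hk) ?_
    by_contra! hbl
    have hbl' : ∀ v, bl n v = v := hbl
    refine hnT ⟨_, (aff_eq_sh (haff n hn) hbl' fun v => ?_).symm⟩
    have h2 := (pow_of_bl_eq (haff n hn) (hbl' v) (5 ^ k)).2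
    rw [hk, mu_one, ZMod.pow_card_pow] at h2
    exact h2.symm
  obtain ⟨⟨σ, hσ⟩, hord⟩ := exists_prime_orderOf_dvd_card' 7 hdvd
  have hσA := haff σ hσ
  have h7 : σ ^ 7 = 1 := by
    have := pow_orderOf_eq_one (⟨σ, hσ⟩ : nrm A)
    rw [hord] at this
    exact congrArg Subtype.val this
  have hσ1 : σ ≠ 1 := by
    rintro rfl
    have : (⟨1, hσ⟩ : nrm A) = 1 := rfl
    rw [this, orderOf_one] at hord
    exact absurd hord (by decide)
  have hmu : ∀ v, bl σ v = v → mu σ v = 1 := fun v hv => by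
    have h2 := (pow_of_bl_eq hσA hv 7).2
    rw [h7, mu_one] at h2
    exact (by decide : ∀ a : ZMod 5, 1 = a ^ 7 → a = 1) _ h2
  have hoff : ∀ v, bl σ v = v → off σ v = 0 := fun v hv => by
    have h2 := off_pow_of_bl_eq hσA hv (hmu v hv) 7
    rw [h7] at h2
    exact (by decide : ∀ a : ZMod 5, 0 = ((7 : ℕ) : ZMod 5) * a → a = 0) _ h2
  have hfix : ∀ v x, bl σ v = v → σ (v, x) = (v, x) := fun v x hv => by
    rw [aff_apply hσA, hv, hmu v hv, hoff v hv, one_mul, add_zero]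
  let β : Perm B := MulAction.toPermHom (nrm A) B ⟨σ, hσ⟩
  have hβ : ∀ v, β v = bl σ v := fun v => rfl
  have hβ7 : β ^ 7 ^ 1 = 1 := by
    rw [pow_one]
    show (MulAction.toPermHom (nrm A) B ⟨σ, hσ⟩) ^ 7 = 1
    rw [← map_pow, show (⟨σ, hσ⟩ : nrm A) ^ 7 = 1 from Subtype.ext h7, map_one]
  have hF1 : Nat.card B ≡ {v | β v = v}.ncard [MOD 7] := card_modEq_ncard_fixed hβ7
  have hF2 : {v | β v = v}.ncard < 8 := by
    rw [← card_B, ← Set.ncard_univ]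
    refine Set.ncard_lt_ncard (Set.ssubset_univ_iff.2 fun h => hσ1 ?_) (Set.toFinite _)
    ext1 ⟨v, x⟩
    exact hfix v x (h ▸ Set.mem_univ v : v ∈ {v | β v = v})
  have hF : {v | β v = v}.ncard = 1 := by
    rw [card_B] at hF1
    have : {v | β v = v}.ncard % 7 = 1 := hF1.symm
    omega
  obtain ⟨v₀, hv₀⟩ := Set.ncard_eq_one.1 hF
  have hv₀' : ∀ v, bl σ v = v ↔ v = v₀ := fun v => by
    have := Set.ext_iff.1 hv₀ v
    exact this
  have hb0 := (hv₀' v₀).2 rfl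
  have hcount : {ω | σ ω = ω}.ncard = 5 := by
    have : {ω | σ ω = ω} = Set.range fun x : ZMod 5 => ((v₀, x) : Pt 5) := by
      ext ⟨v, x⟩
      constructor
      · intro h
        have h2 : bl σ v = v := by
          have := congrArg Prod.fst (h : σ (v, x) = (v, x))
          rw [aff_apply hσA] at this
          exact this
        exact ⟨x, by rw [(hv₀' v).1 h2]⟩
      · rintro ⟨y, h⟩
        rw [← h]
        exact hfix _ _ hb0
    rw [this, Set.ncard_range_of_injective (fun x y h => congrArg Prod.snd h), Nat.card_zmod]
  have htrans : ∀ w ≠ v₀, ∀ u ≠ v₀, ∃ i : ℕ, (β ^ i) w = u := by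
    intro w hw u hu
    have h2 : 7 ≤ {u | ∃ i : ℕ, (β ^ i) w = u}.ncard := by
      refine le_ncard_of_moved hβ7 (fun h => hw ((hv₀' w).1 h)) ?_ ⟨0, rfl⟩
      rintro _ ⟨i, rfl⟩
      exact ⟨i + 1, by rw [pow_succ', Perm.mul_apply]⟩
    have h3 : {u | ∃ i : ℕ, (β ^ i) w = u} ⊆ {v₀}ᶜ := by
      rintro _ ⟨i, rfl⟩ h
      apply hw
      apply (β ^ i).injective
      rw [h]
      exact (Function.IsFixedPt.perm_pow (show Function.IsFixedPt β v₀ from hb0) i).symm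
    have h4 : ({v₀}ᶜ : Set B).ncard = 7 := by
      rw [Set.ncard_compl, card_B, Set.ncard_singleton]
    have h5 := Set.eq_of_subset_of_ncard_le h3 (by rw [h4]; exact h2) (Set.toFinite _)
    have h6 : u ∈ ({v₀}ᶜ : Set B) := hu
    rw [← h5] at h6
    exact h6
  by_cases hS : ∃ s : B, s ≠ 0 ∧ ∀ c ∈ shG A, ∀ v, c (v + s) = c v
  · obtain ⟨s, hs, hsS⟩ := hS
    have hw : v₀ + s ≠ v₀ := fun h => hs (add_eq_left.1 h)
    have hpull : ∀ c ∈ shG A, ∃ c' ∈ shG A, ∀ v, mu σ v * c' v = c (bl σ v) := fun c hc => by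
      obtain ⟨c', hc', h⟩ := nrm_conj (inv_mem hσ) hc
      refine ⟨c', hc', mu_mul_of_comm hσA ?_⟩
      rw [inv_mul_eq_iff_eq_mul, ← mul_assoc, eq_mul_inv_iff_mul_eq] at h
      exact h.symm
    obtain ⟨e, he, hee⟩ := hpull _ h1
    have hind : ∀ i : ℕ, ∀ c ∈ shG A, c ((β ^ i) (v₀ + s)) = c v₀ := by
      intro i
      induction i with
      | zero => exact fun c hc => hsS c hc v₀
      | succ i ih =>
        intro c hc
        obtain ⟨c', hc', h⟩ := hpull c hc
        rw [pow_succ', Perm.mul_apply, hβ, ← h, ih c' hc']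
        have h2 := hee ((β ^ i) (v₀ + s))
        have h3 := hee v₀
        rw [ih e he] at h2
        have h4 : e v₀ ≠ 0 := fun h0 => by simp [h0] at h3
        rw [mul_right_cancel₀ h4 (h2.trans h3.symm), h, hb0]
    have hconst : ∀ c ∈ shG A, ∀ w, c w = c v₀ := by
      intro c hc w
      by_cases hw' : w = v₀
      · rw [hw']
      · obtain ⟨i, rfl⟩ := htrans _ hw w hw'
        exact hind i c hc
    obtain ⟨d, hd, hdσ⟩ := nrm_conj hσ h1
    refine ⟨fun _ => 1, σ, hσ.1, fun _ => one_ne_zero, h1, h7, ?_, hcount⟩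
    rw [hdσ]
    congr 2
    ext1 v
    rw [hconst d hd v]
    have := mu_mul_of_comm hσA hdσ v₀
    rw [hmu v₀ hb0, hb0] at this
    rw [← this, one_mul]
  · obtain ⟨t, ht, hcomm⟩ := exists_sh_comm hσA h7
    refine ⟨t, σ, hσ.1, ht, ?_, h7, hcomm, hcount⟩
    have hall : ∀ y, Pi.single y 1 ∈ shG A := by
      intro y
      obtain ⟨d, hd, hd1, hd0⟩ := indicator_mem_shG hA h1 (ti_shG fun v => htr _)
        {w | ∀ c ∈ shG A, ∀ v, c (v + w) = c v} (fun w => Iff.rfl) y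
      convert hd using 1
      ext1 w
      by_cases hwy : w = y
      · rw [hwy, Pi.single_eq_same, hd1]
        intro c _ v
        rw [B.add_self, add_zero]
      · rw [Pi.single_eq_of_ne hwy, hd0]
        exact fun h => hS ⟨w + y, fun h0 => hwy (B.add_eq_zero.1 h0), h⟩
    have hsum : t = ∑ y, (t y).val • Pi.single y (1 : ZMod 5) := by
      ext1 w
      rw [Finset.sum_apply]
      simp only [Pi.smul_apply, Pi.single_apply]
      simp only [nsmul_eq_mul, ZMod.natCast_zmod_val, mul_ite, mul_one, mul_zero, Finset.sum_ite_eq,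
        Finset.mem_univ, if_true]
    have : t ∈ shG A := by
      rw [hsum]
      exact sum_mem fun y _ => nsmul_mem (hall y) _
    exact this

end

section

section Septets
variable {Ω : Type*} {σ : Perm Ω}

theorem fixed_of_pow (h7 : σ ^ 7 = 1) {d : ℕ} (hd : ¬ 7 ∣ d) {y : Ω} (h : (σ ^ d) y = y) :
    σ y = y := by
  obtain ⟨e, -, he⟩ := Nat.exists_mul_mod_eq_one_of_coprime
    (((Nat.Prime.coprime_iff_not_dvd (by norm_num)).2 hd).symm) (by norm_num : 1 < 7)
  have h1 : ((σ ^ d) ^ e) y = y := Function.IsFixedPt.perm_pow h e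
  rw [← pow_mul, ← Nat.mod_add_div (d * e) 7, he, pow_add, pow_mul, h7, one_pow, mul_one,
    pow_one] at h1
  exact h1

/-- Three terms of an arithmetic progression along an orbit of `σ`. -/
def prog (σ : Perm Ω) (x y z : Ω) : Prop := ∃ i : ℕ, y = (σ ^ i) x ∧ z = (σ ^ i) y

theorem mem_relAut_prog {τ : Perm Ω} (h : σ * τ = τ * σ) : τ ∈ relAut (prog σ) := by
  have hp : ∀ (i : ℕ) (x : Ω), (σ ^ i) (τ x) = τ ((σ ^ i) x) := fun i x =>
    congrArg (fun f : Perm Ω => f x) (Commute.pow_left (show Commute σ τ from h) i).eq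
  intro x y z
  simp only [prog, hp, τ.apply_eq_iff_eq]

theorem prog_mono {ρ : Perm Ω} (h : σ * ρ = ρ * σ)
    (hσ : ∀ (i : ℕ) x, ∃ j : ℕ, (σ ^ i) x = (ρ ^ j) x) {x y z : Ω} (hp : prog σ x y z) :
    prog ρ x y z := by
  obtain ⟨i, rfl, rfl⟩ := hp
  obtain ⟨j, hj⟩ := hσ i x
  refine ⟨j, hj, ?_⟩
  have hc : (σ ^ i) ((ρ ^ j) x) = (ρ ^ j) ((σ ^ i) x) :=
    congrArg (fun f : Perm Ω => f x) (Commute.pow_pow (show Commute σ ρ from h) i j).eq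
  rw [← hc, ← hj]

theorem pow_ret (h7 : σ ^ 7 = 1) (i : ℕ) (x : Ω) : (σ ^ (6 * i)) ((σ ^ i) x) = x := by
  rw [← Perm.mul_apply, ← pow_add, show 6 * i + i = 7 * i by ring, pow_mul, h7, one_pow]
  rfl

variable [Finite Ω]

theorem pow_of_mem_sevenGroup (hΩ : Nat.card Ω = 40) (h7 : σ ^ 7 = 1)
    (hfix : {x | σ x = x}.ncard = 5) {S : Subgroup (Perm Ω)} (hS : IsPGroup 7 S) (hσ : σ ∈ S)
    {s : Perm Ω} (hs : s ∈ S) (x : Ω) : ∃ i : ℕ, s x = (σ ^ i) x := by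
  by_cases hx : σ x = x
  · refine ⟨0, ?_⟩
    have h1 := hS.card_modEq_card_fixedPoints Ω
    have hsub : MulAction.fixedPoints S Ω ⊆ {x | σ x = x} := fun y hy => hy ⟨σ, hσ⟩
    have h2 := Set.ncard_le_ncard hsub (Set.toFinite _)
    rw [hΩ, Nat.card_coe_set_eq] at h1
    have h3 : (MulAction.fixedPoints S Ω).ncard % 7 = 5 := h1.symm
    have h4 := Set.eq_of_subset_of_ncard_le hsub (by omega) (Set.toFinite _)
    have h5 : x ∈ {x | σ x = x} := hx
    rw [← h4] at h5
    exact h5 ⟨s, hs⟩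
  · obtain ⟨O, hxO, hOc, hO⟩ := exists_orbit_le 7 hS (by rw [hΩ]; norm_num) x
    have h2 : 7 ≤ {u | ∃ i : ℕ, u = (σ ^ i) x}.ncard := by
      refine le_ncard_of_moved (k := 1) h7 hx ?_ ⟨0, rfl⟩
      rintro _ ⟨i, rfl⟩
      exact ⟨i + 1, by rw [pow_succ', Perm.mul_apply]⟩
    have hsub : {u | ∃ i : ℕ, u = (σ ^ i) x} ⊆ O := by
      rintro _ ⟨i, rfl⟩
      exact hO _ (pow_mem hσ i) _ hxO
    have h4 := Set.eq_of_subset_of_ncard_le hsub (hOc.trans h2) (Set.toFinite _)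
    have h5 := hO s hs x hxO
    rw [← h4] at h5
    exact h5

theorem ncard_septet_le (h7 : σ ^ 7 = 1) (y : Ω) : {u | ∃ i : ℕ, u = (σ ^ i) y}.ncard ≤ 7 := by
  have hsub : {u | ∃ i : ℕ, u = (σ ^ i) y} ⊆ Set.range fun i : Fin 7 => (σ ^ (i : ℕ)) y := by
    rintro _ ⟨i, rfl⟩
    refine ⟨⟨i % 7, Nat.mod_lt _ (by norm_num)⟩, ?_⟩
    show (σ ^ (i % 7)) y = (σ ^ i) y
    conv_rhs => rw [← Nat.mod_add_div i 7, pow_add, pow_mul, h7, one_pow, mul_one]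
  refine (Set.ncard_le_ncard hsub (Set.toFinite _)).trans ?_
  rw [← Nat.card_coe_set_eq]
  exact (Finite.card_range_le _).trans (by simp)

/-- A 5-element preserving progressions and fixing a septet fixes it pointwise. -/
theorem fixed_of_septet (h7 : σ ^ 7 = 1) {g : Perm Ω} (hg : g ∈ relAut (prog σ)) {k : ℕ}
    (hk : g ^ 5 ^ k = 1) {y : Ω} {i : ℕ} (hy : g y = (σ ^ i) y) : g y = y := by
  by_cases hσy : σ y = y
  · rw [hy]
    exact Function.IsFixedPt.perm_pow hσy i
  let W : Set Ω := {u | ∃ i : ℕ, u = (σ ^ i) y}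
  have hmaps : ∀ g ∈ relAut (prog σ), g y ∈ W → ∀ w ∈ W, g w ∈ W := by
    rintro g hg ⟨i, hi⟩ _ ⟨j, rfl⟩
    obtain ⟨m, hm, -⟩ := (hg y ((σ ^ j) y) ((σ ^ j) ((σ ^ j) y))).2 ⟨j, rfl, rfl⟩
    exact ⟨m + i, by rw [hm, hi, pow_add, Perm.mul_apply]⟩
  have hgi : g⁻¹ y ∈ W := by
    obtain ⟨m, hm, -⟩ := (inv_mem hg y ((σ ^ i) y) ((σ ^ i) ((σ ^ i) y))).2 ⟨i, rfl, rfl⟩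
    rw [← hy, inv_app] at hm
    refine ⟨6 * m, ?_⟩
    conv_rhs => rw [hm]
    exact (pow_ret h7 m _).symm
  let γ : Perm W := g.subtypePerm fun w =>
    ⟨fun h => by simpa only [inv_app] using hmaps g⁻¹ (inv_mem hg) hgi _ h,
      hmaps g hg ⟨i, hy⟩ w⟩
  have hγ : γ ^ 5 ^ k = 1 := by
    rw [Perm.subtypePerm_pow]
    ext1 w
    exact Subtype.ext (congrArg (fun f : Perm Ω => f w.1) hk)
  have hW : W.ncard = 7 := by
    refine (ncard_septet_le h7 y).antisymm (le_ncard_of_moved (k := 1) h7 hσy ?_ ⟨0, rfl⟩)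
    rintro _ ⟨i, rfl⟩
    exact ⟨i + 1, by rw [pow_succ', Perm.mul_apply]⟩
  have hmod := card_modEq_ncard_fixed hγ
  rw [Nat.card_coe_set_eq, hW] at hmod
  have hmod' : {w | γ w = w}.ncard % 5 = 2 := hmod.symm
  obtain ⟨⟨_, a, rfl⟩, h1, ⟨_, b, rfl⟩, h2, hne⟩ :=
    (Set.one_lt_ncard (Set.toFinite {w | γ w = w})).1 (by omega)
  have f1 : g ((σ ^ a) y) = (σ ^ a) y := congrArg Subtype.val h1
  have f2 : g ((σ ^ b) y) = (σ ^ b) y := congrArg Subtype.val h2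
  have hd : (σ ^ b) y = (σ ^ (b + 6 * a)) ((σ ^ a) y) := by
    rw [pow_add, Perm.mul_apply, pow_ret h7]
  have hne' : (σ ^ a) y ≠ (σ ^ b) y := fun h => hne (Subtype.ext h)
  have hw3 : (σ ^ (b + 6 * a)) ((σ ^ b) y) ∈ W :=
    ⟨b + 6 * a + b, by rw [pow_add _ (b + 6 * a) b, Perm.mul_apply]⟩
  generalize b + 6 * a = d at *
  have f3 : g ((σ ^ d) ((σ ^ b) y)) = (σ ^ d) ((σ ^ b) y) := by
    obtain ⟨m, hm1, hm2⟩ := (hg ((σ ^ a) y) ((σ ^ b) y) ((σ ^ d) ((σ ^ b) y))).2 ⟨d, hd, rfl⟩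
    rw [f1, f2] at hm1
    rw [hm2, f2]
    have hc : ∀ u, (σ ^ m) ((σ ^ d) u) = (σ ^ d) ((σ ^ m) u) := fun u => by
      rw [← Perm.mul_apply, ← Perm.mul_apply, ← pow_add, ← pow_add, add_comm]
    rw [hd, hc, ← hm1, hd]
  have hnd : ¬ 7 ∣ d := by
    rintro ⟨q, rfl⟩
    rw [pow_mul, h7, one_pow] at hd
    exact hne' hd.symm
  have hmove : ∀ u ∈ W, σ u ≠ u := by
    rintro _ ⟨j, rfl⟩ h
    apply hσy
    apply (σ ^ j).injective
    rw [← h, ← Perm.mul_apply, ← Perm.mul_apply, ← pow_succ, ← pow_succ']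
  have hthree : 3 ≤ {w | γ w = w}.ncard := by
    have hs : ({⟨_, a, rfl⟩, ⟨_, b, rfl⟩, ⟨_, hw3⟩} : Set W) ⊆ {w | γ w = w} := by
      rintro w (rfl | rfl | rfl)
      exacts [h1, h2, Subtype.ext f3]
    refine le_trans (le_of_eq ?_) (Set.ncard_le_ncard hs (Set.toFinite _))
    symm
    rw [Set.ncard_eq_three]
    refine ⟨_, _, _, hne, fun h => ?_, fun h => ?_, rfl⟩
    · have h' : (σ ^ a) y = (σ ^ d) ((σ ^ b) y) := congrArg Subtype.val h
      rw [hd, ← Perm.mul_apply, ← pow_add] at h'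
      exact hmove _ ⟨a, rfl⟩ (fixed_of_pow h7 (by omega) h'.symm)
    · have h' : (σ ^ b) y = (σ ^ d) ((σ ^ b) y) := congrArg Subtype.val h
      exact hmove _ ⟨b, rfl⟩ (fixed_of_pow h7 hnd h'.symm)
  have hle : {w | γ w = w}.ncard ≤ 7 := by
    rw [← hW, ← Nat.card_coe_set_eq W]
    exact Set.ncard_le_card _
  have hall : {w | γ w = w} = Set.univ := by
    refine Set.eq_of_subset_of_ncard_le (Set.subset_univ _) ?_ (Set.toFinite _)
    rw [Set.ncard_univ, Nat.card_coe_set_eq, hW]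
    omega
  have hyW : (⟨y, 0, rfl⟩ : W) ∈ {w | γ w = w} := hall ▸ Set.mem_univ _
  exact congrArg Subtype.val hyW

/-- Orbits of a 5-group preserving progressions have length at most 5. -/
theorem exists_orbit_le_five (hΩ : Nat.card Ω = 40) (h7 : σ ^ 7 = 1)
    (hfix : {x | σ x = x}.ncard = 5) {P : Subgroup (Perm Ω)} (hP : IsPGroup 5 P)
    (hPr : P ≤ relAut (prog σ)) (x : Ω) :
    ∃ O : Set Ω, x ∈ O ∧ O.ncard ≤ 5 ∧ ∀ r ∈ P, ∀ y ∈ O, r y ∈ O := by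
  have hinv : ∀ r ∈ P, ∀ y, σ y = y → σ (r y) = r y := by
    intro r hr y hy
    obtain ⟨i, hi, -⟩ := (inv_mem (hPr hr) (r y) (σ (r y)) (σ (σ (r y)))).2 ⟨1, rfl, rfl⟩
    rw [inv_app, Function.IsFixedPt.perm_pow (show Function.IsFixedPt σ y from hy) i] at hi
    exact Perm.inv_eq_iff_eq.1 hi
  by_cases hx : σ x = x
  · exact ⟨{x | σ x = x}, hx, hfix.le, hinv⟩
  refine ⟨MulAction.orbit P x, MulAction.mem_orbit_self x, ?_, fun r hr y hy => ?_⟩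
  swap
  · obtain ⟨s, rfl⟩ := hy
    exact ⟨⟨r, hr⟩ * s, rfl⟩
  have hne : ∀ y ∈ MulAction.orbit P x, σ y ≠ y := by
    rintro _ ⟨⟨r, hr⟩, rfl⟩ h
    have := hinv r⁻¹ (inv_mem hr) _ h
    change σ (r⁻¹ (r x)) = r⁻¹ (r x) at this
    rw [inv_app] at this
    exact hx this
  have hne' : ∀ (i : ℕ), ∀ y ∈ MulAction.orbit P x, σ ((σ ^ i) y) ≠ (σ ^ i) y := by
    intro i y hy h
    apply hne y hy
    apply (σ ^ i).injective
    rw [← h, ← Perm.mul_apply, ← Perm.mul_apply, ← pow_succ, ← pow_succ']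
  let f : MulAction.orbit P x × Fin 7 → ({x | σ x = x}ᶜ : Set Ω) := fun q =>
    ⟨(σ ^ (q.2 : ℕ)) q.1, hne' _ _ q.1.2⟩
  have hf : Function.Injective f := by
    rintro ⟨⟨y, hy⟩, i⟩ ⟨⟨y', hy'⟩, j⟩ h
    have h1 : (σ ^ (i : ℕ)) y = (σ ^ (j : ℕ)) y' := congrArg Subtype.val h
    have hyy : y = y' := by
      have hy2 := hy'
      rw [← MulAction.orbit_eq_iff.2 hy] at hy2
      obtain ⟨⟨g, hg⟩, hgy⟩ := hy2
      change g y = y' at hgy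
      obtain ⟨k, hk⟩ := hP ⟨g, hg⟩
      rw [← hgy]
      refine (fixed_of_septet (i := 6 * j + i) h7 (hPr hg) (congrArg Subtype.val hk) ?_).symm
      rw [pow_add, Perm.mul_apply, h1, pow_ret h7, hgy]
    subst hyy
    have hij : i = j := by
      have h2 : (σ ^ (6 * (j : ℕ) + i)) y = y := by
        rw [pow_add, Perm.mul_apply, h1, pow_ret h7]
      by_contra hij
      have hij' : (i : ℕ) ≠ j := fun h => hij (Fin.ext h)
      exact hne y hy (fixed_of_pow h7 (by omega) h2)
    rw [hij]
  have hcard := Nat.card_le_card_of_injective f hf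
  rw [Nat.card_prod, Nat.card_coe_set_eq, Nat.card_coe_set_eq, Set.ncard_compl, hΩ, hfix,
    Nat.card_fin] at hcard
  omega

theorem ncard_fixed_conj {Ω : Type*} (b σ : Perm Ω) :
    {x | (b * σ * b⁻¹) x = x}.ncard = {x | σ x = x}.ncard := by
  have himg : {x | (b * σ * b⁻¹) x = x} = b '' {x | σ x = x} := by
    ext x
    constructor
    · intro hx
      refine ⟨b⁻¹ x, ?_, app_inv b x⟩
      rw [Set.mem_ofPred_eq, Perm.eq_inv_iff_eq]
      exact hx
    · rintro ⟨y, hy, rfl⟩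
      rw [Set.mem_ofPred_eq, Perm.mul_apply, Perm.mul_apply, inv_app]
      exact congrArg b hy
  rw [himg, Set.ncard_image_of_injective _ b.injective]

/-- Alignment of two elements of order 5 that commute with elements of order 7. -/
theorem exists_align (hΩ : Nat.card Ω = 40) {A : Subgroup (Perm Ω)} {τ υ ρ : Perm Ω}
    (hσA : σ ∈ A) (hτA : τ ∈ A) (h7 : σ ^ 7 = 1) (hτ5 : τ ^ 5 = 1) (hστ : σ * τ = τ * σ)
    (hσf : {x | σ x = x}.ncard = 5)
    (hρA : ρ ∈ A) (hυA : υ ∈ A) (hρ7 : ρ ^ 7 = 1) (hυ5 : υ ^ 5 = 1) (hρυ : ρ * υ = υ * ρ)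
    (hρf : {x | ρ x = x}.ncard = 5) :
    ∃ a ∈ A, ∃ P : Subgroup (Perm Ω), IsPGroup 5 P ∧
      (∀ x, ∃ O : Set Ω, x ∈ O ∧ O.ncard ≤ 5 ∧ ∀ r ∈ P, ∀ y ∈ O, r y ∈ O) ∧
      τ ∈ P ∧ a * υ * a⁻¹ ∈ P := by
  obtain ⟨a, ha, S, -, hS, hRS, hρS⟩ := sylow_conj 7 (zpowers_pgroup h7) (zpowers_pgroup hρ7)
    ((Subgroup.zpowers_le).2 hσA) ((Subgroup.zpowers_le).2 hρA)
  have hσS := hRS (Subgroup.mem_zpowers σ)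
  replace hρS := hρS ρ (Subgroup.mem_zpowers ρ)
  have hρ7' : (a * ρ * a⁻¹) ^ 7 = 1 := by rw [conj_pow, hρ7]; group
  have hυ5' : (a * υ * a⁻¹) ^ 5 = 1 := by rw [conj_pow, hυ5]; group
  have hρυ' : (a * ρ * a⁻¹) * (a * υ * a⁻¹) = (a * υ * a⁻¹) * (a * ρ * a⁻¹) := by
    have e1 : (a * ρ * a⁻¹) * (a * υ * a⁻¹) = a * (ρ * υ) * a⁻¹ := by group
    rw [e1, hρυ]
    group
  have hρf' : {x | (a * ρ * a⁻¹) x = x}.ncard = 5 := by rw [ncard_fixed_conj, hρf]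
  have hυA' : a * υ * a⁻¹ ∈ A := mul_mem (mul_mem ha hυA) (inv_mem ha)
  generalize hρe : a * ρ * a⁻¹ = ρ' at *
  generalize hυe : a * υ * a⁻¹ = υ' at *
  have hcomm : σ * ρ' = ρ' * σ := comm_of_orbit_le 7 hS
    (exists_orbit_le 7 hS (by rw [hΩ]; norm_num)) hσS hρS
  have hτN : τ ∈ A ⊓ relAut (prog σ) := ⟨hτA, mem_relAut_prog hστ⟩
  have hprog : prog σ = prog ρ' := by
    funext x y z
    refine propext ⟨prog_mono hcomm fun i x => ?_, prog_mono hcomm.symm fun i x => ?_⟩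
    · exact pow_of_mem_sevenGroup hΩ hρ7' hρf' hS hρS (pow_mem hσS i) x
    · exact pow_of_mem_sevenGroup hΩ h7 hσf hS hσS (pow_mem hρS i) x
  have hυN : υ' ∈ A ⊓ relAut (prog σ) := ⟨hυA', by rw [hprog]; exact mem_relAut_prog hρυ'⟩
  obtain ⟨b, hb, P, hPN, hP, hτP, hυP⟩ := sylow_conj 5 (zpowers_pgroup hτ5) (zpowers_pgroup hυ5')
    ((Subgroup.zpowers_le).2 hτN) ((Subgroup.zpowers_le).2 hυN)
  refine ⟨b * a, mul_mem hb.1 ha, P, hP,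
    exists_orbit_le_five hΩ h7 hσf hP (hPN.trans inf_le_right), hτP (Subgroup.mem_zpowers _), ?_⟩
  have := hυP _ (Subgroup.mem_zpowers _)
  rw [← hυe] at this
  convert this using 1
  group

end Septets

end

section

section Five

theorem ne_zero_of_conj_sh {p : ℕ} {c t : B → ZMod p} (hc : ∀ v, c v ≠ 0) {b : Perm (Pt p)}
    (h : b * sh c * b⁻¹ = sh t) (v : B) : t v ≠ 0 := fun hv => by
  have h1 : (b * sh c * b⁻¹) (v, 0) = (v, 0) := by rw [h, sh_apply, hv, add_zero]
  rw [Perm.mul_apply, Perm.mul_apply, ← Perm.eq_inv_iff_eq] at h1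
  have h2 := congrArg Prod.snd h1
  rw [sh_apply] at h2
  exact hc _ (add_eq_left.1 h2)

/-- If one fixed-point-free shift is conjugated to a shift, so are all shifts. -/
theorem conj_sh_of_conj_sh {p : ℕ} [Fact p.Prime] {c t : B → ZMod p} (hc : ∀ v, c v ≠ 0)
    {b : Perm (Pt p)} (h : b * sh c * b⁻¹ = sh t) (d : B → ZMod p) :
    ∃ e, b * sh d * b⁻¹ = sh e := by
  refine exists_eq_sh (ne_zero_of_conj_sh hc h) ?_ fun ω => ?_
  · have e1 : b * sh d * b⁻¹ * (b * sh c * b⁻¹) = b * (sh d * sh c) * b⁻¹ := by group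
    rw [← h, e1, sh_comm]
    group
  · obtain ⟨i, hi⟩ := exists_pow_sh hc (b⁻¹ ω).1 (b⁻¹ ω).2 (sh d (b⁻¹ ω)).2
    refine ⟨i, ?_⟩
    rw [← h, conj_pow, Perm.mul_apply, Perm.mul_apply, Perm.mul_apply, Perm.mul_apply]
    exact congrArg b hi

theorem exists_conj_sh_of_five {A : Subgroup (Perm (Pt 5))} (hA : Closed3 A)
    (htr : ∀ γ, tr γ ∈ A) {ψ : Perm (Pt 5)} (hψ : ∀ γ, ψ⁻¹ * tr γ * ψ ∈ A) :
    ∃ a ∈ A, ∃ c, a * (ψ⁻¹ * sh (fun _ => 1) * ψ) * a⁻¹ = sh c := by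
  have h1 : sh (fun _ => 1) ∈ A := by rw [← tr_snd]; exact htr _
  have hψ1 : ψ⁻¹ * sh (fun _ => 1) * ψ ∈ A := by rw [← tr_snd]; exact hψ _
  have one_ne : ∀ v : B, (fun _ => 1 : B → ZMod 5) v ≠ 0 := fun _ => one_ne_zero
  have pow5 : ∀ c : B → ZMod 5, (ψ⁻¹ * sh c * ψ) ^ 5 = 1 := fun c => by
    have := conj_pow (i := 5) (a := ψ⁻¹) (b := sh c)
    rw [inv_inv, sh_pow_prime] at this
    rw [this]
    group
  rcases conj_sh_or_exists_nrm hψ1 (pow5 _) with h | ⟨n, hn, hnT, k, hk⟩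
  · exact h
  obtain ⟨t, σ, hσA, ht, htA, h7, hcomm, hf⟩ := exists_seven hA htr hn hnT hk
  let A' : Subgroup (Perm (Pt 5)) := A.comap (MulAut.conj ψ⁻¹).toMonoidHom
  have memA' : ∀ {σ}, σ ∈ A' ↔ ψ⁻¹ * σ * ψ ∈ A := fun {σ} => Iff.rfl
  have htr' : ∀ γ, tr γ ∈ A' := hψ
  have hz' : ψ * sh (fun _ => 1) * ψ⁻¹ ∈ A' := by
    rw [memA']
    convert h1 using 1
    group
  have hz5 : (ψ * sh (fun _ => 1) * ψ⁻¹) ^ 5 = 1 := by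
    rw [conj_pow, sh_pow_prime]
    group
  rcases conj_sh_or_exists_nrm hz' hz5 with ⟨a', ha', c, hc⟩ | ⟨n', hn', hnT', k', hk'⟩
  · have hc0 : ∀ v, c v ≠ 0 :=
      ne_zero_of_conj_sh one_ne (b := a' * ψ) (by rw [← hc]; group)
    have ha := memA'.1 ha'
    obtain ⟨e, he⟩ := conj_sh_of_conj_sh hc0 (b := ψ⁻¹ * a'⁻¹) (t := fun _ => 1)
      (by rw [← hc]; group) fun _ => 1
    refine ⟨_, inv_mem ha, e, ?_⟩
    rw [← he]
    group
  · obtain ⟨t', σ', hσA', ht', htA', h7', hcomm', hf'⟩ := exists_seven (hA.comap _) htr' hn' hnT' hk'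
    obtain ⟨a, ha, P, hP, horb, htP, hυP⟩ := exists_align (card_pt 5) hσA htA h7
      (sh_pow_prime t) hcomm hf (ρ := ψ⁻¹ * σ' * ψ) (υ := ψ⁻¹ * sh t' * ψ) hσA' htA'
      (by
        have := conj_pow (i := 7) (a := ψ⁻¹) (b := σ')
        rw [inv_inv, h7'] at this
        rw [this]
        group)
      (pow5 _)
      (by
        have e1 : ψ⁻¹ * σ' * ψ * (ψ⁻¹ * sh t' * ψ) = ψ⁻¹ * (σ' * sh t') * ψ := by group
        rw [e1, hcomm']
        group)
      (by
        have := ncard_fixed_conj ψ⁻¹ σ'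
        rwa [inv_inv, hf'] at this)
    obtain ⟨t₂, ht₂⟩ := exists_eq_sh_of_orbit_le hP horb ht htP hυP
    obtain ⟨e, he⟩ := conj_sh_of_conj_sh ht' (b := a * ψ⁻¹) (t := t₂)
      (by rw [← ht₂]; group) fun _ => 1
    refine ⟨a, ha, e, ?_⟩
    rw [← he]
    group

end Five

/-- The regular representations inside a closed group are conjugate. -/
theorem good_of_closed {p : ℕ} [hp : Fact p.Prime] (h3 : p ≠ 3) (h7 : p ≠ 7)
    {A : Subgroup (Perm (Pt p))} (hA : Closed3 A) (htr : ∀ γ, tr γ ∈ A) {ψ : Perm (Pt p)}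
    (hψ : ∀ γ, ψ⁻¹ * tr γ * ψ ∈ A) : Good A fun γ => ψ⁻¹ * tr γ * ψ := by
  have hreg : IsReg fun γ => ψ⁻¹ * tr γ * ψ := by
    have := (isReg_tr (p := p)).conj ψ⁻¹
    rwa [inv_inv] at this
  by_cases h2 : p = 2
  · subst h2
    exact good_two hA htr hreg hψ
  have hconj : ∃ a ∈ A, ∃ c, a * (ψ⁻¹ * tr ((0, 1) : Pt p) * ψ) * a⁻¹ = sh c := by
    have h1 : sh (fun _ => (1 : ZMod p)) ∈ A := by rw [← tr_snd]; exact htr _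
    by_cases h8 : 8 < p
    · refine exists_conj_sh_of_large h8 h1 (hψ _) ?_
      have := conj_pow (i := p) (a := ψ⁻¹) (b := tr ((0, 1) : Pt p))
      rw [inv_inv, tr_snd, sh_pow_prime] at this
      rw [tr_snd, this]
      group
    · have h5 : p = 5 := by
        have := hp.out
        interval_cases p <;> first | rfl | contradiction
      subst h5
      rw [tr_snd]
      exact exists_conj_sh_of_five hA htr hψ
  obtain ⟨a, ha, c, hc⟩ := hconj
  refine Good.of_cj ha (Good.mono inf_le_left ((core_of_sh hA htr (hreg.conj a) ?_ hc).good_of_odd h2))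
  exact fun γ => mul_mem (mul_mem ha (hψ γ)) (inv_mem ha)

theorem isCI_of_ne {p : ℕ} (hp : p.Prime) (h3 : p ≠ 3) (h7 : p ≠ 7) :
    IsCIGroupColorTernary (Multiplicative (Pt p)) := by
  have : Fact p.Prime := ⟨hp⟩
  refine isCIGroup_of_conj fun A hA hmul ψ hψ => ?_
  obtain ⟨a, ha, h⟩ := good_of_closed (A := A) (ψ := ψ) h3 h7 hA
    (fun γ => hmul (Multiplicative.ofAdd γ)) fun γ => hψ (Multiplicative.ofAdd γ)
  refine ⟨a, ha, fun g => ?_⟩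
  obtain ⟨γ', hγ'⟩ := h (Multiplicative.toAdd g)
  exact ⟨Multiplicative.ofAdd γ', hγ'⟩

end

section

section Negative

variable {p : ℕ}

/-- Triples in a common level with `v'' + v = α (v' + v)`. -/
def levelRel (p : ℕ) (α : B →+ B) : Set (Pt p × Pt p × Pt p) :=
  {ω | ω.2.1.2 = ω.1.2 ∧ ω.2.2.2 = ω.1.2 ∧ ω.2.2.1 + ω.1.1 = α (ω.2.1.1 + ω.1.1)}

/-- Triples in consecutive levels with `v'' + v' = α (v' + v)`. -/
def fwdRel (p : ℕ) (α : B →+ B) : Set (Pt p × Pt p × Pt p) :=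
  {ω | ω.2.1.2 = ω.1.2 + 1 ∧ ω.2.2.2 = ω.1.2 + 1 + 1 ∧
    ω.2.2.1 + ω.2.1.1 = α (ω.2.1.1 + ω.1.1)}

/-- Triples in consecutive levels with `v' + v = α (v'' + v')`. -/
def bwdRel (p : ℕ) (α : B →+ B) : Set (Pt p × Pt p × Pt p) :=
  {ω | ω.2.1.2 = ω.1.2 + 1 ∧ ω.2.2.2 = ω.1.2 + 1 + 1 ∧
    ω.2.1.1 + ω.1.1 = α (ω.2.2.1 + ω.2.1.1)}

theorem B.add_add_add_left (s a b : B) : (s + a) + (s + b) = a + b := by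
  rw [add_add_add_comm, B.add_self, zero_add]

theorem tr_fst (γ ω : Pt p) : (tr γ ω).1 = γ.1 + ω.1 := rfl

theorem tr_level (γ ω : Pt p) : (tr γ ω).2 = γ.2 + ω.2 := rfl

theorem tr_mem_levelRel (α : B →+ B) (γ u v w : Pt p) :
    (tr γ u, tr γ v, tr γ w) ∈ levelRel p α ↔ (u, v, w) ∈ levelRel p α := by
  simp only [levelRel, Set.mem_ofPred_eq, tr_fst, tr_level, B.add_add_add_left, add_right_inj]

theorem tr_mem_fwdRel (α : B →+ B) (γ u v w : Pt p) :
    (tr γ u, tr γ v, tr γ w) ∈ fwdRel p α ↔ (u, v, w) ∈ fwdRel p α := by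
  simp only [fwdRel, Set.mem_ofPred_eq, tr_fst, tr_level, B.add_add_add_left, add_assoc γ.2,
    add_right_inj]

theorem tr_mem_bwdRel (α : B →+ B) (γ u v w : Pt p) :
    (tr γ u, tr γ v, tr γ w) ∈ bwdRel p α ↔ (u, v, w) ∈ bwdRel p α := by
  simp only [bwdRel, Set.mem_ofPred_eq, tr_fst, tr_level, B.add_add_add_left, add_assoc γ.2,
    add_right_inj]

theorem iterate_val_add [Fact p.Prime] {α : B → B} (hα : α^[p] = id) (x y : ZMod p) (v : B) :
    α^[(x + y).val] v = α^[x.val] (α^[y.val] v) := by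
  have hmod : ∀ n, α^[n % p] = α^[n] := fun n => by
    conv_rhs => rw [← Nat.mod_add_div n p, Function.iterate_add, Function.iterate_mul, hα,
      Function.iterate_id, Function.comp_id]
  rw [ZMod.val_add, hmod, Function.iterate_add_apply]

/-- `(v, x) ↦ (α ^ x v, x)`. -/
def twist [Fact p.Prime] (α : B → B) (hα : α^[p] = id) : Perm (Pt p) where
  toFun ω := (α^[ω.2.val] ω.1, ω.2)
  invFun ω := (α^[(-ω.2).val] ω.1, ω.2)
  left_inv ω := by
    refine Prod.ext ?_ rfl
    change α^[(-ω.2).val] (α^[ω.2.val] ω.1) = ω.1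
    rw [← iterate_val_add hα, neg_add_cancel, ZMod.val_zero, Function.iterate_zero, id]
  right_inv ω := by
    refine Prod.ext ?_ rfl
    change α^[ω.2.val] (α^[(-ω.2).val] ω.1) = ω.1
    rw [← iterate_val_add hα, add_neg_cancel, ZMod.val_zero, Function.iterate_zero, id]

theorem iterate_injective [Fact p.Prime] {α : B → B} (hα : α^[p] = id) (n : ℕ) :
    Function.Injective α^[n] := by
  refine Function.Injective.iterate (fun v w h => ?_) n
  have h' := congrArg α^[p - 1] h
  rwa [← Function.iterate_succ_apply, ← Function.iterate_succ_apply, Nat.succ_eq_add_one,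
    Nat.sub_add_cancel (Fact.out : p.Prime).one_le, hα] at h'

theorem twist_mem_levelRel [Fact p.Prime] {α : B →+ B} (hα : α^[p] = id) (u v w : Pt p) :
    (twist α hα u, twist α hα v, twist α hα w) ∈ levelRel p α ↔ (u, v, w) ∈ levelRel p α := by
  obtain ⟨u, x⟩ := u
  obtain ⟨v, y⟩ := v
  obtain ⟨w, z⟩ := w
  refine and_congr_right fun (h1 : y = x) => and_congr_right fun (h2 : z = x) => ?_
  subst h1 h2
  change α^[z.val] w + α^[z.val] u = α (α^[z.val] v + α^[z.val] u) ↔ w + u = α (v + u)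
  rw [← iterate_map_add, ← iterate_map_add, ← Function.iterate_succ_apply' (⇑α),
    Function.iterate_succ_apply]
  exact (iterate_injective hα _).eq_iff

theorem twist_mem_fwdRel [Fact p.Prime] {α : B →+ B} (hα : α^[p] = id) (u v w : Pt p) :
    (twist α hα u, twist α hα v, twist α hα w) ∈ fwdRel p α ↔ (u, v, w) ∈ bwdRel p α := by
  obtain ⟨u, x⟩ := u
  obtain ⟨v, y⟩ := v
  obtain ⟨w, z⟩ := w
  refine and_congr_right fun (h1 : y = x + 1) => and_congr_right fun (h2 : z = x + 1 + 1) => ?_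
  subst h1 h2
  have e : ∀ (y : ZMod p) v, α^[(y + 1).val] v = α^[y.val] (α v) := fun y v => by
    rw [iterate_val_add hα, ZMod.val_one]
    rfl
  change α^[(x + 1 + 1).val] w + α^[(x + 1).val] v =
    α (α^[(x + 1).val] v + α^[x.val] u) ↔ v + u = α (w + v)
  rw [e, e, e, ← iterate_map_add, ← iterate_map_add, ← Function.iterate_succ_apply' (⇑α),
    Function.iterate_succ_apply, (iterate_injective hα _).eq_iff, ← map_add,
    (iterate_injective hα 1).eq_iff (f := α), map_add, ← B.add_eq_zero, ← B.add_eq_zero (v := v + u)]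
  apply Eq.congr_left
  abel

theorem inv_mem_iff {Ω : Type*} {τ : Perm Ω} {X Y : Set (Ω × Ω × Ω)}
    (h : ∀ u v w, (τ u, τ v, τ w) ∈ X ↔ (u, v, w) ∈ Y) (u v w : Ω) :
    (τ⁻¹ u, τ⁻¹ v, τ⁻¹ w) ∈ Y ↔ (u, v, w) ∈ X := by
  rw [← h, app_inv, app_inv, app_inv]

theorem B.odd_nsmul {n : ℕ} (hn : Odd n) (v : B) : n • v = v := by
  obtain ⟨m, rfl⟩ := hn
  rw [add_nsmul, one_nsmul, mul_nsmul', two_nsmul, B.add_self, zero_add]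

theorem not_isCI_of_aut [Fact p.Prime] (hp : p ≠ 2) {α : B →+ B} (hα : α^[p] = id)
    (h2 : ∃ v, α (α v) ≠ v) : ¬ IsCIGroupColorTernary (Multiplicative (Pt p)) := by
  intro H
  have disj : ∀ X : Set (Pt p × Pt p × Pt p), (∀ ω ∈ X, ω.2.1.2 = ω.1.2 + 1) →
      Pairwise (Function.onFun Disjoint ![X, levelRel p α]) := by
    intro X hX
    have h : Disjoint X (levelRel p α) := Set.disjoint_left.2 fun ω h1 h2 => by
      have := (hX ω h1).symm.trans h2.1
      exact one_ne_zero (add_eq_left.1 this)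
    intro i j hij
    fin_cases i <;> fin_cases j
    · exact absurd rfl hij
    · exact h
    · exact h.symm
    · exact absurd rfl hij
  obtain ⟨φ, hφ⟩ := H 2 ![fwdRel p α, levelRel p α] ![bwdRel p α, levelRel p α]
    (disj _ fun ω h => h.1) (disj _ fun ω h => h.1)
    (fun g i u v w => by
      fin_cases i
      · exact tr_mem_fwdRel α g u v w
      · exact tr_mem_levelRel α g u v w)
    (fun g i u v w => by
      fin_cases i
      · exact tr_mem_bwdRel α g u v w
      · exact tr_mem_levelRel α g u v w)
    ⟨(twist α hα)⁻¹, fun i u v w => by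
      fin_cases i
      · exact inv_mem_iff (twist_mem_fwdRel hα) u v w
      · exact inv_mem_iff (twist_mem_levelRel hα) u v w⟩
  obtain ⟨f, hf0, hf1⟩ : ∃ f : Pt p ≃+ Pt p,
      (∀ u v w, (u, v, w) ∈ fwdRel p α → (f u, f v, f w) ∈ bwdRel p α) ∧
      ∀ u v w, (u, v, w) ∈ levelRel p α → (f u, f v, f w) ∈ levelRel p α :=
    ⟨AddEquiv.toMultiplicative.symm φ, fun u v w => (hφ 0 u v w).2, fun u v w => (hφ 1 u v w).2⟩
  have hodd : Odd p := (Fact.out : p.Prime).odd_of_ne_two hp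
  have h2p : (2 : ZMod p) ≠ 0 := by
    intro h
    have : ((2 : ℕ) : ZMod p) = 0 := by exact_mod_cast h
    rw [ZMod.natCast_eq_zero_iff] at this
    exact hp ((Nat.prime_dvd_prime_iff_eq Fact.out Nat.prime_two).1 this)
  have level : ∀ (e : Pt p ≃+ Pt p) (v : B), (e (v, 0)).2 = 0 := fun e v => by
    have h : e (v, 0) + e (v, 0) = 0 := by
      rw [← map_add, Prod.mk_add_mk, B.add_self, add_zero]
      exact map_zero e
    have h' := congrArg Prod.snd h
    rw [Prod.snd_add, ← two_mul] at h'
    exact (mul_eq_zero.1 h').resolve_left h2p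
  have hone : (f (0, 1)).1 = 0 := by
    have h : p • f (0, 1) = 0 := by
      rw [← map_nsmul, Prod.smul_mk, smul_zero, nsmul_one, ZMod.natCast_self]
      exact map_zero f
    have h' := congrArg Prod.fst h
    exact (B.odd_nsmul hodd _).symm.trans h'
  have hfst : ∀ v x, (f (v, x + 1)).1 = (f (v, x)).1 := fun v x => by
    have : ((v, x + 1) : Pt p) = (v, x) + (0, 1) := by simp
    rw [this, map_add, Prod.fst_add, hone, add_zero]
  have hcomm : ∀ v, (f (α v, 0)).1 = α (f (v, 0)).1 := fun v => by
    have := (hf1 0 (v, 0) (α v, 0) ⟨rfl, rfl, by simp⟩).2.2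
    simpa [map_zero f] using this
  obtain ⟨v, h2⟩ := h2
  obtain ⟨w, hw⟩ : ∃ w, f (w, 0) = (v, 0) :=
    ⟨(f.symm (v, 0)).1, by
      have : ((f.symm (v, 0)).1, (0 : ZMod p)) = f.symm (v, 0) := Prod.ext rfl (level _ _).symm
      rw [this, AddEquiv.apply_symm_apply]⟩
  have h := (hf0 0 (w, 0 + 1) (α w + w, 0 + 1 + 1)
    ⟨rfl, rfl, by simp [add_assoc, B.add_self]⟩).2.2
  have hsum : ∀ a b : B, (f (a + b, 0)).1 = (f (a, 0)).1 + (f (b, 0)).1 := fun a b => by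
    have : ((a + b, 0) : Pt p) = (a, 0) + (b, 0) := by simp
    rw [this, map_add, Prod.fst_add]
  simp only [hfst, map_zero f, hsum, B.add_add_self, hcomm, hw] at h
  exact h2 (by simpa using h.symm)

/-- The cyclic permutation of the coordinates. -/
def rot : B →+ B where
  toFun v := (v.2.1, v.2.2, v.1)
  map_zero' := rfl
  map_add' _ _ := rfl

/-- The companion matrix of `X ^ 3 + X + 1`. -/
def singer : B →+ B where
  toFun v := (v.2.1, v.2.2, v.1 + v.2.1)
  map_zero' := rfl
  map_add' v w := by
    refine Prod.ext rfl (Prod.ext rfl ?_)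
    exact add_add_add_comm _ _ _ _

theorem not_isCI_three : ¬ IsCIGroupColorTernary (Multiplicative (Pt 3)) :=
  not_isCI_of_aut (by decide) (α := rot) rfl ⟨(1, 0, 0), by decide⟩

theorem not_isCI_seven : ¬ IsCIGroupColorTernary (Multiplicative (Pt 7)) :=
  not_isCI_of_aut (by decide) (α := singer) (funext (by decide)) ⟨(1, 0, 0), by decide⟩

end Negative

end

end TernaryCI

theorem statement_13 (p : ℕ) (hp : p.Prime) :
    IsCIGroupColorTernary (Multiplicative ((ZMod 2 × ZMod 2 × ZMod 2) × ZMod p)) ↔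
      (p ≠ 3 ∧ p ≠ 7) := by
  refine ⟨fun h => ⟨?_, ?_⟩, fun h => TernaryCI.isCI_of_ne hp h.1 h.2⟩
  · rintro rfl
    exact TernaryCI.not_isCI_three h
  · rintro rfl
    exact TernaryCI.not_isCI_seven h
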